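/- There exists an absolute constant M such that for every squarefree positive integer r and every real Y > 1, the number of GL₂(ℤ)-equivalence classes of integral binary cubic forms x with 0 < |D(x)| < Y and r² ∣ D(x) is less than M · 6^{ω(r)} · Y / r², where ω(r) is the number of distinct prime factors of r. -/

import Mathlib

/-- The action of an integer 2×2 matrix `γ` on the coefficient vector `x = (a,b,c,d)` of the
integral binary cubic form `a u³ + b u²v + c uv² + d v³`, given by `(γ·f)(u,v) = f((u,v)·γ)`
(untwisted). -/
def cubicAct (g : Matrix (Fin 2) (Fin 2) ℤ) (x : Fin 4 → ℤ) : Fin 4 → ℤ :=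
  ![x 0 * g 0 0 ^ 3 + x 1 * g 0 0 ^ 2 * g 0 1 + x 2 * g 0 0 * g 0 1 ^ 2 + x 3 * g 0 1 ^ 3,
    3 * x 0 * g 0 0 ^ 2 * g 1 0 + x 1 * (g 0 0 ^ 2 * g 1 1 + 2 * g 0 0 * g 0 1 * g 1 0)
      + x 2 * (2 * g 0 0 * g 0 1 * g 1 1 + g 1 0 * g 0 1 ^ 2) + 3 * x 3 * g 0 1 ^ 2 * g 1 1,
    3 * x 0 * g 0 0 * g 1 0 ^ 2 + x 1 * (2 * g 0 0 * g 1 0 * g 1 1 + g 1 0 ^ 2 * g 0 1)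
      + x 2 * (g 0 0 * g 1 1 ^ 2 + 2 * g 1 0 * g 0 1 * g 1 1) + 3 * x 3 * g 0 1 * g 1 1 ^ 2,
    x 0 * g 1 0 ^ 3 + x 1 * g 1 0 ^ 2 * g 1 1 + x 2 * g 1 0 * g 1 1 ^ 2 + x 3 * g 1 1 ^ 3]

/-- The discriminant of the binary cubic form with coefficients `(a,b,c,d)`. -/
def cubicDisc (x : Fin 4 → ℤ) : ℤ :=
  x 1 ^ 2 * x 2 ^ 2 + 18 * x 0 * x 1 * x 2 * x 3 - 4 * x 0 * x 2 ^ 3 - 4 * x 1 ^ 3 * x 3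
    - 27 * x 0 ^ 2 * x 3 ^ 2

/-- The set of `GL₂(ℤ)`-equivalence classes (for the twisted action
`(γ·f)(u,v) = det(γ)⁻¹ f((u,v)·γ)`; note `det γ = det γ⁻¹ = ±1`) of integral binary cubic
forms `x` with `0 < |D(x)| < Y` and `r² ∣ D(x)`. -/
def classSet (r : ℕ) (Y : ℝ) : Set (Set (Fin 4 → ℤ)) :=
  {O | ∃ x : Fin 4 → ℤ, cubicDisc x ≠ 0 ∧ ((|cubicDisc x| : ℤ) : ℝ) < Y ∧
    (r : ℤ) ^ 2 ∣ cubicDisc x ∧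
    O = {y | ∃ γ : Matrix (Fin 2) (Fin 2) ℤ, IsUnit γ.det ∧ y = γ.det • cubicAct γ x}}


namespace CubicCount

abbrev V := Fin 4 → ℤ
abbrev M2 := Matrix (Fin 2) (Fin 2) ℤ

/-- value of the cubic form -/
def ev (x : V) (u v : ℤ) : ℤ := x 0 * u ^ 3 + x 1 * u ^ 2 * v + x 2 * u * v ^ 2 + x 3 * v ^ 3

def hA (x : V) : ℤ := x 1 ^ 2 - 3 * x 0 * x 2
def hB (x : V) : ℤ := x 1 * x 2 - 9 * x 0 * x 3
def hC (x : V) : ℤ := x 2 ^ 2 - 3 * x 1 * x 3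

lemma act0 (g : M2) (x : V) : cubicAct g x 0 = x 0 * g 0 0 ^ 3 + x 1 * g 0 0 ^ 2 * g 0 1 + x 2 * g 0 0 * g 0 1 ^ 2 + x 3 * g 0 1 ^ 3 := rfl
lemma act1 (g : M2) (x : V) : cubicAct g x 1 = 3 * x 0 * g 0 0 ^ 2 * g 1 0 + x 1 * (g 0 0 ^ 2 * g 1 1 + 2 * g 0 0 * g 0 1 * g 1 0)
      + x 2 * (2 * g 0 0 * g 0 1 * g 1 1 + g 1 0 * g 0 1 ^ 2) + 3 * x 3 * g 0 1 ^ 2 * g 1 1 := rfl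
lemma act2 (g : M2) (x : V) : cubicAct g x 2 = 3 * x 0 * g 0 0 * g 1 0 ^ 2 + x 1 * (2 * g 0 0 * g 1 0 * g 1 1 + g 1 0 ^ 2 * g 0 1)
      + x 2 * (g 0 0 * g 1 1 ^ 2 + 2 * g 1 0 * g 0 1 * g 1 1) + 3 * x 3 * g 0 1 * g 1 1 ^ 2 := rfl
lemma act3 (g : M2) (x : V) : cubicAct g x 3 = x 0 * g 1 0 ^ 3 + x 1 * g 1 0 ^ 2 * g 1 1 + x 2 * g 1 0 * g 1 1 ^ 2 + x 3 * g 1 1 ^ 3 := rfl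

lemma V_ext {x y : V} (h0 : x 0 = y 0) (h1 : x 1 = y 1) (h2 : x 2 = y 2) (h3 : x 3 = y 3) : x = y := by
  funext i; fin_cases i <;> assumption

lemma act_mul (g h : M2) (x : V) : cubicAct h (cubicAct g x) = cubicAct (h * g) x := by
  apply V_ext <;> simp only [act0, act1, act2, act3, Matrix.mul_apply, Fin.sum_univ_two] <;> ring

lemma act_one (x : V) : cubicAct 1 x = x := by
  apply V_ext <;> simp [act0, act1, act2, act3]

lemma act_smul (g : M2) (c : ℤ) (x : V) : cubicAct g (c • x) = c • cubicAct g x := by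
  apply V_ext <;> simp only [act0, act1, act2, act3, Pi.smul_apply, smul_eq_mul] <;> ring

lemma act_neg (g : M2) (x : V) : cubicAct (-g) x = - cubicAct g x := by
  apply V_ext <;> simp only [act0, act1, act2, act3, Pi.neg_apply, Matrix.neg_apply] <;> ring

lemma ev_act (g : M2) (x : V) (u v : ℤ) :
    ev (cubicAct g x) u v = ev x (u * g 0 0 + v * g 1 0) (u * g 0 1 + v * g 1 1) := by
  simp only [ev, act0, act1, act2, act3]; ring

lemma ev_ext {x y : V} (h : ∀ u v, ev x u v = ev y u v) : x = y := by
  have h1 := h 1 0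
  have h2 := h 0 1
  have h3 := h 1 1
  have h4 := h 1 (-1)
  simp only [ev] at h1 h2 h3 h4
  apply V_ext <;> linarith

lemma disc_act (g : M2) (x : V) : cubicDisc (cubicAct g x) = g.det ^ 6 * cubicDisc x := by
  simp only [cubicDisc, act0, act1, act2, act3, Matrix.det_fin_two]; ring

lemma disc_smul (c : ℤ) (x : V) : cubicDisc (c • x) = c ^ 4 * cubicDisc x := by
  simp only [cubicDisc, Pi.smul_apply, smul_eq_mul]; ring

lemma hA_act (g : M2) (x : V) : hA (cubicAct g x) =
    g.det ^ 2 * (hA x * g 0 0 ^ 2 + hB x * g 0 0 * g 0 1 + hC x * g 0 1 ^ 2) := by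
  simp only [hA, hB, hC, act0, act1, act2, act3, Matrix.det_fin_two]; ring
lemma hC_act (g : M2) (x : V) : hC (cubicAct g x) =
    g.det ^ 2 * (hA x * g 1 0 ^ 2 + hB x * g 1 0 * g 1 1 + hC x * g 1 1 ^ 2) := by
  simp only [hA, hB, hC, act0, act1, act2, act3, Matrix.det_fin_two]; ring
lemma hB_act (g : M2) (x : V) : hB (cubicAct g x) =
    g.det ^ 2 * (2 * hA x * g 0 0 * g 1 0 + hB x * (g 0 0 * g 1 1 + g 0 1 * g 1 0) + 2 * hC x * g 0 1 * g 1 1) := by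
  simp only [hA, hB, hC, act0, act1, act2, act3, Matrix.det_fin_two]; ring

lemma hess_disc (x : V) : hB x ^ 2 - 4 * hA x * hC x = -3 * cubicDisc x := by
  simp only [hA, hB, hC, cubicDisc]; ring

/-- `SL₂(ℤ)`-equivalence -/
def SEqv (x y : V) : Prop := ∃ g : M2, g.det = 1 ∧ y = cubicAct g x
/-- untwisted `GL₂(ℤ)`-equivalence -/
def GEqv (x y : V) : Prop := ∃ g : M2, IsUnit g.det ∧ y = cubicAct g x

lemma SEqv.toG {x y : V} (h : SEqv x y) : GEqv x y := by
  obtain ⟨g, hg, rfl⟩ := h; exact ⟨g, by rw [hg]; exact isUnit_one, rfl⟩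
lemma SEqv.refl (x : V) : SEqv x x := ⟨1, by simp, (act_one x).symm⟩
lemma GEqv.refl (x : V) : GEqv x x := (SEqv.refl x).toG
lemma SEqv.trans {x y z : V} (h : SEqv x y) (h' : SEqv y z) : SEqv x z := by
  obtain ⟨g, hg, rfl⟩ := h
  obtain ⟨g', hg', rfl⟩ := h'
  exact ⟨g' * g, by rw [Matrix.det_mul, hg, hg', one_mul], act_mul _ _ _⟩
lemma GEqv.trans {x y z : V} (h : GEqv x y) (h' : GEqv y z) : GEqv x z := by
  obtain ⟨g, hg, rfl⟩ := h
  obtain ⟨g', hg', rfl⟩ := h'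
  exact ⟨g' * g, by rw [Matrix.det_mul]; exact hg'.mul hg, act_mul _ _ _⟩
lemma GEqv.symm {x y : V} (h : GEqv x y) : GEqv y x := by
  obtain ⟨g, hg, rfl⟩ := h
  refine ⟨g⁻¹, ?_, ?_⟩
  · exact Matrix.isUnit_nonsing_inv_det g hg
  · rw [act_mul, Matrix.nonsing_inv_mul _ hg, act_one]
lemma SEqv.symm {x y : V} (h : SEqv x y) : SEqv y x := by
  obtain ⟨g, hg, rfl⟩ := h
  have hu : IsUnit g.det := by rw [hg]; exact isUnit_one
  refine ⟨g⁻¹, ?_, ?_⟩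
  · have := Matrix.det_nonsing_inv_mul_det g hu
    rwa [hg, mul_one] at this
  · rw [act_mul, Matrix.nonsing_inv_mul _ hu, act_one]
lemma GEqv.disc {x y : V} (h : GEqv x y) : cubicDisc y = cubicDisc x := by
  obtain ⟨g, hg, rfl⟩ := h
  rw [disc_act]
  rcases Int.isUnit_iff.1 hg with h | h <;> rw [h] <;> norm_num
lemma SEqv.disc {x y : V} (h : SEqv x y) : cubicDisc y = cubicDisc x := h.toG.disc

/-- covering number statements -/
def SCov (P : V → Prop) (N : ℝ) : Prop :=
  ∃ R : Finset V, (R.card : ℝ) ≤ N ∧ ∀ x, P x → ∃ y ∈ R, SEqv y x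
def GCov (P : V → Prop) (N : ℝ) : Prop :=
  ∃ R : Finset V, (R.card : ℝ) ≤ N ∧ ∀ x, P x → ∃ y ∈ R, GEqv y x

lemma GCov.mono {P Q : V → Prop} {N N' : ℝ} (h : GCov P N) (hQ : ∀ x, Q x → P x) (hN : N ≤ N') : GCov Q N' := by
  obtain ⟨R, h1, h2⟩ := h
  exact ⟨R, h1.trans hN, fun x hx => h2 x (hQ x hx)⟩

lemma GCov.or {P Q : V → Prop} {N N' : ℝ} (h : GCov P N) (h' : GCov Q N') : GCov (fun x => P x ∨ Q x) (N + N') := by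
  classical
  obtain ⟨R, h1, h2⟩ := h
  obtain ⟨R', h1', h2'⟩ := h'
  refine ⟨R ∪ R', ?_, ?_⟩
  · have : ((R ∪ R').card : ℝ) ≤ R.card + R'.card := by exact_mod_cast Finset.card_union_le R R'
    linarith
  · rintro x (hx | hx)
    · obtain ⟨y, hy, e⟩ := h2 x hx
      exact ⟨y, Finset.mem_union_left _ hy, e⟩
    · obtain ⟨y, hy, e⟩ := h2' x hx
      exact ⟨y, Finset.mem_union_right _ hy, e⟩

/-- row `(u, v)` coprime: complete to `SL₂`. -/
lemma exists_row (u v : ℤ) (h : IsCoprime u v) : ∃ g : M2, g.det = 1 ∧ g 0 0 = u ∧ g 0 1 = v := by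
  obtain ⟨s, t, hst⟩ := h
  refine ⟨!![u, v; -t, s], ?_, by simp, by simp⟩
  rw [Matrix.det_fin_two_of]; linarith

lemma exists_hA_ne (x : V) (h : cubicDisc x ≠ 0) : ∃ y, SEqv x y ∧ hA y ≠ 0 := by
  by_contra! hc
  have key : ∀ u v : ℤ, IsCoprime u v → hA x * u ^ 2 + hB x * u * v + hC x * v ^ 2 = 0 := by
    intro u v huv
    obtain ⟨g, hg, rfl, rfl⟩ := exists_row u v huv
    have := hc _ ⟨g, hg, rfl⟩
    rw [hA_act, hg] at this
    linarith
  have h1 := key 1 0 isCoprime_one_left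
  have h2 := key 0 1 isCoprime_one_right
  have h3 := key 1 1 isCoprime_one_left
  have hd := hess_disc x
  have e1 : hA x = 0 := by linarith
  have e2 : hC x = 0 := by linarith
  have e3 : hB x = 0 := by rw [e1, e2] at h3; linarith
  rw [e1, e2, e3] at hd
  apply h; linarith

end CubicCount

namespace CubicCount
open QuadraticAlgebra
open scoped Pointwise

abbrev QR (Δ e : ℤ) := QuadraticAlgebra ℤ (-e) Δ

structure Dat (Δ e : ℤ) where
  (a0 a1 a2 a3 m A k C : ℤ)
  he : 4 * e = Δ ^ 2 - Δ
  hA : a1 ^ 2 - a0 * a2 = m * A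
  hB : a1 * a2 - a0 * a3 = m * (Δ + 2 * k)
  hC : a2 ^ 2 - a1 * a3 = m * C
  hm : 0 < m
  hA0 : A ≠ 0
  hΔ : Δ ≠ 0
  hprim : ∃ p q r : ℤ, p * A + q * (Δ + 2 * k) + r * C = 1
  hdisc : k ^ 2 + k * Δ + e = A * C

lemma qr_cancel {Δ e : ℤ} {z w w' : QR Δ e} (hz : z.norm ≠ 0) (h : z * w = z * w') : w = w' := by
  have hz' : z ∈ nonZeroDivisors (QR Δ e) := by
    rw [← norm_mem_nonZeroDivisors_iff]
    exact mem_nonZeroDivisors_of_ne_zero hz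
  exact (mul_cancel_left_mem_nonZeroDivisors hz').1 h

lemma qr_norm_int {Δ e : ℤ} (n : ℤ) : ((n : QR Δ e)).norm = n ^ 2 := norm_intCast n

lemma qr_mul_star {Δ e : ℤ} (z : QR Δ e) : z * star z = ((z.norm : ℤ) : QR Δ e) := by
  have := algebraMap_norm_eq_mul_star z
  rw [← this]; rfl

lemma ideal_cancel {Δ e : ℤ} {z : QR Δ e} (hz : z.norm ≠ 0) {I J : Ideal (QR Δ e)}
    (h : Ideal.span {z} * I ≤ Ideal.span {z} * J) : I ≤ J := by
  intro x hx
  have h1 : z * x ∈ Ideal.span {z} * J := h (Ideal.mul_mem_mul (Ideal.mem_span_singleton_self z) hx)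
  rw [Ideal.mem_span_singleton_mul] at h1
  obtain ⟨y, hy, e⟩ := h1
  rw [← qr_cancel hz e]; exact hy

lemma ideal_cancel_eq {Δ e : ℤ} {z : QR Δ e} (hz : z.norm ≠ 0) {I J : Ideal (QR Δ e)}
    (h : Ideal.span {z} * I = Ideal.span {z} * J) : I = J :=
  le_antisymm (ideal_cancel hz h.le) (ideal_cancel hz h.ge)

namespace Dat
variable {Δ e : ℤ} (d : Dat Δ e)

def w : QR Δ e := ⟨d.k, 1⟩
def T0 : QR Δ e := ⟨d.A * d.a1 - (d.k + Δ) * d.a0, d.a0⟩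
def T1 : QR Δ e := ⟨d.A * d.a2 - (d.k + Δ) * d.a1, d.a1⟩
def T2 : QR Δ e := ⟨d.A * d.a3 - (d.k + Δ) * d.a2, d.a2⟩
def T3 : QR Δ e := ⟨d.k * d.a3 - d.C * d.a2, d.a3⟩

def I : Ideal (QR Δ e) := Ideal.span {(d.A : QR Δ e), d.w}
def aI : Ideal (QR Δ e) := Ideal.span {d.T0, d.T1, d.T2, d.T3}

lemma rec1 : d.A * d.a2 = (Δ + 2 * d.k) * d.a1 - d.C * d.a0 := by
  apply mul_left_cancel₀ d.hm.ne'
  linear_combination -d.hA * d.a2 + d.hB * d.a1 - d.hC * d.a0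

lemma rec2 : d.A * d.a3 = (Δ + 2 * d.k) * d.a2 - d.C * d.a1 := by
  apply mul_left_cancel₀ d.hm.ne'
  linear_combination -d.hA * d.a3 + d.hB * d.a2 - d.hC * d.a1

lemma T0w : d.T0 * d.w = d.A * d.T1 := by
  have h1 := d.rec1
  have h2 := d.hdisc
  ext
  · simp [T0, T1, w]; linear_combination (-d.a0) * h2 - d.A * h1
  · simp [T0, T1, w]; ring

lemma T1w : d.T1 * d.w = d.A * d.T2 := by
  have h1 := d.rec2
  have h2 := d.hdisc
  ext
  · simp [T1, T2, w]; linear_combination (-d.a1) * h2 - d.A * h1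
  · simp [T1, T2, w]; ring

lemma T2w : d.T2 * d.w = d.A * d.T3 := by
  have h2 := d.hdisc
  ext
  · simp [T2, T3, w]; linear_combination (-d.a2) * h2
  · simp [T2, T3, w]; ring

lemma normT0 : d.T0.norm = d.m * d.A ^ 3 := by
  rw [norm_def]
  simp [T0]
  have h2 := d.hdisc
  linear_combination d.a0 ^ 2 * h2 + d.A ^ 2 * d.hA + d.A * d.a0 * d.rec1

lemma normT0_ne : d.T0.norm ≠ 0 := by
  rw [normT0]; exact mul_ne_zero d.hm.ne' (pow_ne_zero _ d.hA0)

lemma normA_ne : ((d.A : QR Δ e)).norm ≠ 0 := by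
  rw [qr_norm_int]; exact pow_ne_zero _ d.hA0

lemma norm_w : d.w.norm = d.A * d.C := by
  rw [norm_def]; simp [w]; linear_combination d.hdisc

lemma I_mul_star : d.I * d.I.map (starRingEnd (QR Δ e)) = Ideal.span {(d.A : QR Δ e)} := by
  have hw : d.w * star d.w = (d.A : QR Δ e) * d.C := by
    rw [qr_mul_star, norm_w]; push_cast; rfl
  have hs : d.w + star d.w = ((Δ + 2 * d.k : ℤ) : QR Δ e) := by
    ext <;> simp [w]; ring
  have hAs : star (d.A : QR Δ e) = d.A := by ext <;> simp
  rw [I, Ideal.map_span, Ideal.span_mul_span']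
  apply le_antisymm
  · rw [Ideal.span_le]
    rintro x hx
    rw [Set.mem_mul] at hx
    obtain ⟨a, ha, b, hb, rfl⟩ := hx
    rw [Set.image_pair] at hb
    simp only [Set.mem_insert_iff, Set.mem_singleton_iff, starRingEnd_apply] at ha hb
    rw [SetLike.mem_coe, Ideal.mem_span_singleton]
    rcases ha with rfl | rfl
    · exact dvd_mul_right _ _
    · rcases hb with rfl | rfl
      · rw [hAs]; exact dvd_mul_left _ _
      · rw [hw]; exact dvd_mul_right _ _
  · rw [Ideal.span_singleton_le_iff_mem]
    obtain ⟨p, q, r, h⟩ := d.hprim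
    have h' : (p : QR Δ e) * d.A + q * (d.w + star d.w) + r * d.C = 1 := by
      rw [hs]; exact_mod_cast congrArg (Int.cast (R := QR Δ e)) h
    have e1 : (d.A : QR Δ e) = p * (d.A * star (d.A : QR Δ e)) + q * (d.w * star (d.A : QR Δ e))
        + q * (d.A * star d.w) + r * (d.w * star d.w) := by
      rw [hw, hAs]; linear_combination (-(d.A : QR Δ e)) * h'
    rw [Set.image_pair]
    have mem : ∀ a b : QR Δ e, a ∈ ({(d.A : QR Δ e), d.w} : Set (QR Δ e)) →
      b ∈ ({(starRingEnd (QR Δ e)) (d.A : QR Δ e), (starRingEnd (QR Δ e)) d.w} : Set (QR Δ e)) → ∀ c : QR Δ e,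
      c * (a * b) ∈ Ideal.span (({(d.A : QR Δ e), d.w} : Set (QR Δ e)) * ({(starRingEnd (QR Δ e)) (d.A : QR Δ e), (starRingEnd (QR Δ e)) d.w} : Set (QR Δ e))) := by
      intro a b ha hb c
      exact Ideal.mul_mem_left _ _ (Ideal.subset_span (Set.mul_mem_mul ha hb))
    refine (congrArg (fun z => z ∈ Ideal.span (({(d.A : QR Δ e), d.w} : Set (QR Δ e)) * ({(starRingEnd (QR Δ e)) (d.A : QR Δ e), (starRingEnd (QR Δ e)) d.w} : Set (QR Δ e)))) e1).mpr ?_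
    refine Ideal.add_mem _ (Ideal.add_mem _ (Ideal.add_mem _ ?_ ?_) ?_) ?_
    · exact mem _ _ (Or.inl rfl) (Or.inl rfl) _
    · exact mem _ _ (Or.inr rfl) (Or.inl rfl) _
    · exact mem _ _ (Or.inl rfl) (Or.inr rfl) _
    · exact mem _ _ (Or.inr rfl) (Or.inr rfl) _

lemma I_cube : d.I ^ 3 = Ideal.span {(d.A : QR Δ e) ^ 3, (d.A : QR Δ e) ^ 2 * d.w, (d.A : QR Δ e) * d.w ^ 2, d.w ^ 3} := by
  rw [I, pow_three, Ideal.span_mul_span', Ideal.span_mul_span']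
  congr 1
  ext x
  simp only [Set.mem_mul, Set.mem_insert_iff, Set.mem_singleton_iff]
  constructor
  · rintro ⟨a, ha, b, ⟨c, hc, f, hf, rfl⟩, rfl⟩
    rcases ha with rfl | rfl <;> rcases hc with rfl | rfl <;> rcases hf with rfl | rfl <;> ring_nf <;> simp
  · rintro (rfl | rfl | rfl | rfl)
    · exact ⟨_, Or.inl rfl, _, ⟨_, Or.inl rfl, _, Or.inl rfl, rfl⟩, by ring⟩
    · exact ⟨_, Or.inl rfl, _, ⟨_, Or.inl rfl, _, Or.inr rfl, rfl⟩, by ring⟩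
    · exact ⟨_, Or.inl rfl, _, ⟨_, Or.inr rfl, _, Or.inr rfl, rfl⟩, by ring⟩
    · exact ⟨_, Or.inr rfl, _, ⟨_, Or.inr rfl, _, Or.inr rfl, rfl⟩, by ring⟩

lemma A3_aI : Ideal.span {(d.A : QR Δ e) ^ 3} * d.aI = Ideal.span {d.T0} * d.I ^ 3 := by
  rw [I_cube, aI, Ideal.span_mul_span', Ideal.span_mul_span', Set.singleton_mul, Set.singleton_mul]
  simp only [Set.image_insert_eq, Set.image_singleton]
  have h1 := d.T0w
  have h2 := d.T1w
  have h3 := d.T2w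
  congr 1
  have e0 : (d.A : QR Δ e) ^ 3 * d.T0 = d.T0 * (d.A : QR Δ e) ^ 3 := mul_comm _ _
  have e1 : (d.A : QR Δ e) ^ 3 * d.T1 = d.T0 * ((d.A : QR Δ e) ^ 2 * d.w) := by
    linear_combination -(d.A : QR Δ e) ^ 2 * h1
  have e2 : (d.A : QR Δ e) ^ 3 * d.T2 = d.T0 * ((d.A : QR Δ e) * d.w ^ 2) := by
    linear_combination -(d.A : QR Δ e) * d.w * h1 - (d.A : QR Δ e) ^ 2 * h2
  have e3 : (d.A : QR Δ e) ^ 3 * d.T3 = d.T0 * (d.w ^ 3) := by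
    linear_combination - d.w ^ 2 * h1 - (d.A : QR Δ e) * d.w * h2 - (d.A : QR Δ e) ^ 2 * h3
  rw [e0, e1, e2, e3]

lemma star_int (n : ℤ) : star (n : QR Δ e) = n := by ext <;> simp

lemma aI_mul_star : d.aI * d.aI.map (starRingEnd (QR Δ e)) = Ideal.span {(d.m : QR Δ e)} := by
  have h := d.A3_aI
  have h2 := congrArg (Ideal.map (starRingEnd (QR Δ e))) h
  rw [Ideal.map_mul, Ideal.map_mul, Ideal.map_pow, Ideal.map_span, Ideal.map_span, Set.image_singleton,
    Set.image_singleton, starRingEnd_apply, starRingEnd_apply, star_pow, star_int] at h2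
  have h3 : (Ideal.span {(d.A : QR Δ e) ^ 3} * Ideal.span {(d.A : QR Δ e) ^ 3}) * (d.aI * d.aI.map (starRingEnd (QR Δ e)))
      = Ideal.span {d.T0} * Ideal.span {star d.T0} * (d.I * d.I.map (starRingEnd (QR Δ e))) ^ 3 := by
    rw [mul_pow]
    calc _ = (Ideal.span {(d.A : QR Δ e) ^ 3} * d.aI) * (Ideal.span {(d.A : QR Δ e) ^ 3} * d.aI.map (starRingEnd (QR Δ e))) := by ring
      _ = _ := by rw [h, h2]; ring
  rw [I_mul_star, Ideal.span_singleton_mul_span_singleton, Ideal.span_singleton_mul_span_singleton,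
    Ideal.span_singleton_pow, Ideal.span_singleton_mul_span_singleton, qr_mul_star, normT0] at h3
  have hn : ((d.A : QR Δ e) ^ 3 * (d.A : QR Δ e) ^ 3).norm ≠ 0 := by
    rw [map_mul, map_pow]; exact mul_ne_zero (pow_ne_zero _ d.normA_ne) (pow_ne_zero _ d.normA_ne)
  apply ideal_cancel_eq hn
  rw [h3, Ideal.span_singleton_mul_span_singleton]
  congr 2
  push_cast; ring

end Dat
end CubicCount

namespace CubicCount
open QuadraticAlgebra
open scoped Pointwise

def sq (Δ e : ℤ) : QR Δ e := ⟨-Δ, 2⟩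

lemma sq_sq {Δ e : ℤ} (he : 4 * e = Δ ^ 2 - Δ) : sq Δ e * sq Δ e = (Δ : QR Δ e) := by
  ext
  · simp [sq]; linear_combination -he
  · simp [sq]; ring

lemma sub_star {Δ e : ℤ} (t : QR Δ e) : t - star t = (t.im : QR Δ e) * sq Δ e := by
  ext <;> simp [sq] <;> ring

lemma add_star {Δ e : ℤ} (t : QR Δ e) : t + star t = ((2 * t.re + Δ * t.im : ℤ) : QR Δ e) := by
  ext <;> simp; ring

lemma star_mem_map {Δ e : ℤ} {a : Ideal (QR Δ e)} {x : QR Δ e} (h : x ∈ a) :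
    star x ∈ a.map (starRingEnd (QR Δ e)) := by
  have := Ideal.mem_map_of_mem (starRingEnd (QR Δ e)) h
  simpa [starRingEnd_apply] using this

/-- Hermite normal form of an invertible ideal -/
lemma hnf {Δ e : ℤ} (a : Ideal (QR Δ e)) (m : ℤ) (hm : m ≠ 0)
    (h : a * a.map (starRingEnd (QR Δ e)) = Ideal.span {(m : QR Δ e)}) :
    ∃ c g b : ℤ, 0 < c ∧ 0 < g ∧ 0 ≤ b ∧ b < g ∧ |m| = c ^ 2 * g ∧ g ∣ b ^ 2 + b * Δ + e ∧
      ∀ x : QR Δ e, x ∈ a ↔ ∃ p q : ℤ, x = p * ((c * g : ℤ) : QR Δ e) + q * (⟨c * b, c⟩ : QR Δ e) := by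
  classical
  have hma : (m : QR Δ e) ∈ a := by
    have : (m : QR Δ e) ∈ a * a.map (starRingEnd (QR Δ e)) := by
      rw [h]; exact Ideal.mem_span_singleton_self (m : QR Δ e)
    have hle : a * a.map (starRingEnd (QR Δ e)) ≤ a := Ideal.mul_le_left
    exact hle this
  -- the integers in a
  obtain ⟨h0, hh0⟩ : ∃ h0 : ℤ, ∀ n : ℤ, (n : QR Δ e) ∈ a ↔ h0 ∣ n := by
    obtain ⟨h0, hh⟩ := (IsPrincipalIdealRing.principal (a.comap (Int.castRingHom (QR Δ e))))
    refine ⟨h0, fun n => ?_⟩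
    rw [← Ideal.mem_span_singleton]
    have : n ∈ a.comap (Int.castRingHom (QR Δ e)) ↔ n ∈ Ideal.span {h0} := by rw [hh, Ideal.submodule_span_eq]
    rw [← this, Ideal.mem_comap, eq_intCast]
  -- the imaginary parts
  let imI : Ideal ℤ :=
    { carrier := {n | ∃ x ∈ a, x.im = n}
      add_mem' := by
        rintro _ _ ⟨x, hx, rfl⟩ ⟨y, hy, rfl⟩
        exact ⟨x + y, a.add_mem hx hy, by simp⟩
      zero_mem' := ⟨0, a.zero_mem, by simp⟩
      smul_mem' := by
        rintro n _ ⟨x, hx, rfl⟩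
        exact ⟨(n : QR Δ e) * x, a.mul_mem_left _ hx, by simp⟩ }
  obtain ⟨c0, hc0'⟩ := IsPrincipalIdealRing.principal imI
  have hc0 : ∀ n : ℤ, (∃ x ∈ a, x.im = n) ↔ c0 ∣ n := by
    intro n
    rw [← Ideal.mem_span_singleton]
    have : n ∈ imI ↔ n ∈ Ideal.span {c0} := by rw [hc0', Ideal.submodule_span_eq]
    rw [← this]; rfl
  have hh0ne : h0 ≠ 0 := by
    rintro rfl
    exact hm (zero_dvd_iff.1 ((hh0 m).1 hma))
  have hc0h0 : c0 ∣ h0 := by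
    apply (hc0 h0).1
    refine ⟨⟨0, 1⟩ * (h0 : QR Δ e), a.mul_mem_left _ ((hh0 h0).2 dvd_rfl), by simp⟩
  have hc0ne : c0 ≠ 0 := by
    rintro rfl
    exact hh0ne (zero_dvd_iff.1 hc0h0)
  set c := |c0| with hc
  have hcpos : 0 < c := abs_pos.2 hc0ne
  have hcc : ∀ n : ℤ, (∃ x ∈ a, x.im = n) ↔ c ∣ n := fun n => by rw [hc0, hc, abs_dvd]
  obtain ⟨g, hg⟩ : c ∣ |h0| := by rw [hc, abs_dvd, dvd_abs]; exact hc0h0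
  have hgpos : 0 < g := by
    have : 0 < |h0| := abs_pos.2 hh0ne
    rw [hg] at this
    exact pos_of_mul_pos_right this hcpos.le
  have hcg : ∀ n : ℤ, (n : QR Δ e) ∈ a ↔ c * g ∣ n := fun n => by rw [hh0, ← hg, abs_dvd]
  obtain ⟨z, hz, hzim⟩ := (hcc c).2 dvd_rfl
  obtain ⟨b', hb'⟩ : c ∣ z.re := by
    have h1 : c ∣ z.re + Δ * c := by
      apply (hcc _).1
      refine ⟨⟨0, 1⟩ * z, a.mul_mem_left _ hz, ?_⟩
      simp [hzim]
    exact (dvd_add_left (dvd_mul_left c Δ)).1 h1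
  set b := b' % g with hb
  have hcgm : ((c * g : ℤ) : QR Δ e) ∈ a := (hcg _).2 dvd_rfl
  have hz2 : (⟨c * b, c⟩ : QR Δ e) ∈ a := by
    have : (⟨c * b, c⟩ : QR Δ e) = z - ((b' / g : ℤ) : QR Δ e) * ((c * g : ℤ) : QR Δ e) := by
      have := Int.emod_add_mul_ediv b' g
      ext
      · simp [hb']; linear_combination c * this
      · simp [hzim]
    rw [this]
    exact a.sub_mem hz (a.mul_mem_left _ hcgm)
  have hmem : ∀ x : QR Δ e, x ∈ a ↔ ∃ p q : ℤ, x = p * ((c * g : ℤ) : QR Δ e) + q * (⟨c * b, c⟩ : QR Δ e) := by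
    intro x
    constructor
    · intro hx
      obtain ⟨q, hq⟩ := (hcc x.im).1 ⟨x, hx, rfl⟩
      have h1 : x - q * (⟨c * b, c⟩ : QR Δ e) = ((x.re - q * (c * b) : ℤ) : QR Δ e) := by
        ext
        · simp
        · simp [hq]; ring
      have h2 : ((x.re - q * (c * b) : ℤ) : QR Δ e) ∈ a := by
        rw [← h1]; exact a.sub_mem hx (a.mul_mem_left _ hz2)
      obtain ⟨p, hp⟩ := (hcg _).1 h2
      refine ⟨p, q, ?_⟩
      rw [hp] at h1
      rw [sub_eq_iff_eq_add] at h1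
      rw [h1]; push_cast; ring
    · rintro ⟨p, q, rfl⟩
      exact a.add_mem (a.mul_mem_left _ hcgm) (a.mul_mem_left _ hz2)
  have hgN : g ∣ b ^ 2 + b * Δ + e := by
    have h1 : ((c * (b ^ 2 + b * Δ + e) : ℤ) : QR Δ e) ∈ a := by
      have : ((c * (b ^ 2 + b * Δ + e) : ℤ) : QR Δ e) = (⟨b + Δ, -1⟩ : QR Δ e) * ⟨c * b, c⟩ := by
        ext <;> simp [pow_two] <;> ring
      rw [this]; exact a.mul_mem_left _ hz2
    have h2 := (hcg _).1 h1
    exact (mul_dvd_mul_iff_left hcpos.ne').1 h2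
  refine ⟨c, g, b, hcpos, hgpos, Int.emod_nonneg _ hgpos.ne', Int.emod_lt_of_pos _ hgpos, ?_, hgN, hmem⟩
  have hdvd : ∀ x : QR Δ e, x ∈ a * a.map (starRingEnd (QR Δ e)) → (m : QR Δ e) ∣ x := by
    intro x hx; rw [h] at hx; exact Ideal.mem_span_singleton.1 hx
  have d1 : m ∣ c ^ 2 * g := by
    have : (m : QR Δ e) ∣ (⟨c * b, c⟩ : QR Δ e) * star (((c * g : ℤ) : QR Δ e)) :=
      hdvd _ (Ideal.mul_mem_mul hz2 (star_mem_map hcgm))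
    obtain ⟨y, hy⟩ := this
    have h3 := congrArg QuadraticAlgebra.im hy
    simp [pow_two] at h3
    exact ⟨y.im, by linear_combination h3⟩
  have d2 : c ^ 2 * g ∣ m := by
    have h1 : a * a.map (starRingEnd (QR Δ e)) ≤ Ideal.span {((c ^ 2 * g : ℤ) : QR Δ e)} := by
      obtain ⟨N, hN⟩ := hgN
      rw [Ideal.mul_le]
      intro r hr s hs
      obtain ⟨s', hs', rfl⟩ := (Ideal.mem_map_of_equiv (starRingAut (R := QR Δ e)) s).1 hs
      obtain ⟨p, q, rfl⟩ := (hmem _).1 hr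
      obtain ⟨p', q', rfl⟩ := (hmem _).1 hs'
      rw [Ideal.mem_span_singleton]
      refine ⟨(p * p' * g : ℤ) + p * q' * ⟨b + Δ, -1⟩ + q * p' * ⟨b, 1⟩ + q * q' * N, ?_⟩
      change _ * star _ = _
      ext
      · simp [pow_two]; linear_combination c ^ 2 * q * q' * hN
      · simp [pow_two]; ring
    have h2 : (m : QR Δ e) ∈ Ideal.span {((c ^ 2 * g : ℤ) : QR Δ e)} := by
      apply h1; rw [h]; exact Ideal.mem_span_singleton_self _
    obtain ⟨y, hy⟩ := Ideal.mem_span_singleton.1 h2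
    have h3 := congrArg QuadraticAlgebra.re hy
    simp [pow_two] at h3
    exact ⟨y.re, by linear_combination h3⟩
  have : |m| = |c ^ 2 * g| := Int.natAbs_inj_of_nonneg_of_nonneg (abs_nonneg _) (abs_nonneg _) |>.1 (by
    rw [Int.natAbs_abs, Int.natAbs_abs]; exact Int.natAbs_eq_of_dvd_dvd d1 d2)
  rw [this, abs_of_pos (by positivity)]

end CubicCount

namespace CubicCount
open QuadraticAlgebra
open scoped Pointwise

namespace Dat
variable {Δ e : ℤ}

/-- the relation between two data with the same associated ideal -/
structure Rel (d d0 : Dat Δ e) (z1 z2 t0 t1 t2 t3 : QR Δ e) : Prop where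
  gen : ∀ x : QR Δ e, x ∈ d.I * d0.I.map (starRingEnd (QR Δ e)) ↔ ∃ p q : ℤ, x = p * z1 + q * z2
  ori : z1 * star z2 - z2 * star z1 = ((d.A * d0.A : ℤ) : QR Δ e) * sq Δ e
  e0 : d.T0 * star d0.T0 * z1 ^ 3 = ((d.m * (d.A * d0.A) ^ 3 : ℤ) : QR Δ e) * t0
  e1 : d.T0 * star d0.T0 * (z1 ^ 2 * z2) = ((d.m * (d.A * d0.A) ^ 3 : ℤ) : QR Δ e) * t1
  e2 : d.T0 * star d0.T0 * (z1 * z2 ^ 2) = ((d.m * (d.A * d0.A) ^ 3 : ℤ) : QR Δ e) * t2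
  e3 : d.T0 * star d0.T0 * z2 ^ 3 = ((d.m * (d.A * d0.A) ^ 3 : ℤ) : QR Δ e) * t3

lemma int_ne {n : ℤ} (h : n ≠ 0) : ((n : QR Δ e)).norm ≠ 0 := by
  rw [qr_norm_int]; exact pow_ne_zero _ h

lemma star_star_map (a : Ideal (QR Δ e)) : (a.map (starRingEnd (QR Δ e))).map (starRingEnd (QR Δ e)) = a := by
  rw [Ideal.map_map]
  have : (starRingEnd (QR Δ e)).comp (starRingEnd (QR Δ e)) = RingHom.id _ := by
    ext x <;> simp
  rw [this, Ideal.map_id]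

lemma exists_rel (d d0 : Dat Δ e) (hm : d.m = d0.m) (ha : d.aI = d0.aI) :
    ∃ z1 z2 t0 t1 t2 t3, Rel d d0 z1 z2 t0 t1 t2 t3 ∧ z1.norm ≠ 0 := by
  set J := d.I * d0.I.map (starRingEnd (QR Δ e)) with hJ
  have hn : d.A * d0.A ≠ 0 := mul_ne_zero d.hA0 d0.hA0
  have hJJ : J * J.map (starRingEnd (QR Δ e)) = Ideal.span {((d.A * d0.A : ℤ) : QR Δ e)} := by
    rw [hJ, Ideal.map_mul, star_star_map]
    have h1 := d.I_mul_star
    have h2 := d0.I_mul_star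
    calc _ = (d.I * d.I.map (starRingEnd (QR Δ e))) * (d0.I * d0.I.map (starRingEnd (QR Δ e))) := by ring
      _ = _ := by rw [h1, h2, Ideal.span_singleton_mul_span_singleton]; push_cast; rfl
  have hT : Ideal.span {d.T0 * star d0.T0} * J ^ 3 = Ideal.span {((d.m * (d.A * d0.A) ^ 3 : ℤ) : QR Δ e)} := by
    have h := d.A3_aI
    have h2 := congrArg (Ideal.map (starRingEnd (QR Δ e))) d0.A3_aI
    rw [Ideal.map_mul, Ideal.map_mul, Ideal.map_pow, Ideal.map_span, Ideal.map_span, Set.image_singleton,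
      Set.image_singleton, starRingEnd_apply, starRingEnd_apply, star_pow, star_int] at h2
    rw [hJ, mul_pow, ← Ideal.span_singleton_mul_span_singleton]
    have h3 := d0.aI_mul_star
    calc _ = (Ideal.span {d.T0} * d.I ^ 3) * (Ideal.span {star d0.T0} * (d0.I.map (starRingEnd (QR Δ e))) ^ 3) := by ring
      _ = (Ideal.span {(d.A : QR Δ e) ^ 3} * Ideal.span {(d0.A : QR Δ e) ^ 3}) * (d.aI * d0.aI.map (starRingEnd (QR Δ e))) := by
          rw [← h, ← h2]; ring
      _ = _ := by
          rw [ha, h3, Ideal.span_singleton_mul_span_singleton, Ideal.span_singleton_mul_span_singleton, hm]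
          congr 2; push_cast; ring
  obtain ⟨c, g, b, hc, hg, -, -, hmm, -, hmem⟩ := hnf J _ hn hJJ
  -- choose the sign
  obtain ⟨σ, hσ, hσ2⟩ : ∃ σ : ℤ, σ * (c ^ 2 * g) = - (d.A * d0.A) ∧ σ * σ = 1 := by
    rcases abs_choice (d.A * d0.A) with h | h
    · exact ⟨-1, by rw [← hmm, h]; ring, by norm_num⟩
    · exact ⟨1, by rw [← hmm, h]; ring, by norm_num⟩
  set z1 : QR Δ e := ((c * g : ℤ) : QR Δ e)
  set z2 : QR Δ e := (σ : QR Δ e) * ⟨c * b, c⟩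
  have m1 : z1 ∈ J := (hmem _).2 ⟨1, 0, by simp [z1]⟩
  have m2 : z2 ∈ J := (hmem _).2 ⟨0, σ, by simp [z2]⟩
  have key : ∀ y ∈ J ^ 3, ∃ t, d.T0 * star d0.T0 * y = ((d.m * (d.A * d0.A) ^ 3 : ℤ) : QR Δ e) * t := by
    intro y hy
    have : d.T0 * star d0.T0 * y ∈ Ideal.span {d.T0 * star d0.T0} * J ^ 3 :=
      Ideal.mul_mem_mul (Ideal.mem_span_singleton_self _) hy
    rw [hT] at this
    exact Ideal.mem_span_singleton.1 this
  have cube : ∀ x ∈ J, ∀ y ∈ J, ∀ z ∈ J, x * (y * z) ∈ J ^ 3 := by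
    intro x hx y hy z hz
    rw [pow_three]
    exact Ideal.mul_mem_mul hx (Ideal.mul_mem_mul hy hz)
  obtain ⟨t0, ht0⟩ := key _ (cube _ m1 _ m1 _ m1)
  obtain ⟨t1, ht1⟩ := key _ (cube _ m1 _ m1 _ m2)
  obtain ⟨t2, ht2⟩ := key _ (cube _ m1 _ m2 _ m2)
  obtain ⟨t3, ht3⟩ := key _ (cube _ m2 _ m2 _ m2)
  refine ⟨z1, z2, t0, t1, t2, t3, ⟨?_, ?_, ?_, ?_, ?_, ?_⟩, ?_⟩
  · intro x
    rw [hmem]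
    constructor
    · rintro ⟨p, q, rfl⟩
      refine ⟨p, q * σ, ?_⟩
      have : ((σ : QR Δ e)) * σ = 1 := by exact_mod_cast congrArg (Int.cast (R := QR Δ e)) hσ2
      simp only [z1, z2]; push_cast
      linear_combination (-(q : QR Δ e)) * ⟨c * b, c⟩ * this
    · rintro ⟨p, q, rfl⟩
      refine ⟨p, q * σ, ?_⟩
      simp only [z1, z2]; push_cast; ring
  · have h1 : z1 * star z2 - z2 * star z1 = ((-(σ * (c ^ 2 * g)) : ℤ) : QR Δ e) * sq Δ e := by
      ext <;> simp [z1, z2, sq, pow_two] <;> ring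
    rw [h1, hσ, neg_neg]
  · rw [← ht0]; ring
  · rw [← ht1]; ring
  · rw [← ht2]; ring
  · rw [← ht3]; ring
  · exact int_ne (by positivity)

/-- the associated cubic form -/
def gOf (t0 t1 t2 t3 : QR Δ e) : V := ![t0.im, 3 * t1.im, 3 * t2.im, t3.im]

lemma Rel.act {d d0 : Dat Δ e} {z1 z2 t0 t1 t2 t3 : QR Δ e} (h : Rel d d0 z1 z2 t0 t1 t2 t3) (γ : M2)
    (hγ : γ.det = 1) : ∃ z1' z2' t0' t1' t2' t3', Rel d d0 z1' z2' t0' t1' t2' t3' ∧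
      gOf t0' t1' t2' t3' = cubicAct γ (gOf t0 t1 t2 t3) := by
  rw [Matrix.det_fin_two] at hγ
  have hγ' : (γ 0 0 : QR Δ e) * γ 1 1 - γ 0 1 * γ 1 0 = 1 := by
    exact_mod_cast congrArg (Int.cast (R := QR Δ e)) hγ
  refine ⟨γ 0 0 * z1 + γ 0 1 * z2, γ 1 0 * z1 + γ 1 1 * z2,
    γ 0 0 ^ 3 * t0 + 3 * γ 0 0 ^ 2 * γ 0 1 * t1 + 3 * γ 0 0 * γ 0 1 ^ 2 * t2 + γ 0 1 ^ 3 * t3,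
    γ 0 0 ^ 2 * γ 1 0 * t0 + (γ 0 0 ^ 2 * γ 1 1 + 2 * γ 0 0 * γ 0 1 * γ 1 0) * t1
      + (γ 0 1 ^ 2 * γ 1 0 + 2 * γ 0 0 * γ 0 1 * γ 1 1) * t2 + γ 0 1 ^ 2 * γ 1 1 * t3,
    γ 1 0 ^ 2 * γ 0 0 * t0 + (γ 1 0 ^ 2 * γ 0 1 + 2 * γ 1 0 * γ 1 1 * γ 0 0) * t1
      + (γ 1 1 ^ 2 * γ 0 0 + 2 * γ 1 0 * γ 1 1 * γ 0 1) * t2 + γ 1 1 ^ 2 * γ 0 1 * t3,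
    γ 1 0 ^ 3 * t0 + 3 * γ 1 0 ^ 2 * γ 1 1 * t1 + 3 * γ 1 0 * γ 1 1 ^ 2 * t2 + γ 1 1 ^ 3 * t3,
    ⟨?_, ?_, ?_, ?_, ?_, ?_⟩, ?_⟩
  · intro x
    rw [h.gen]
    constructor
    · rintro ⟨p, q, rfl⟩
      refine ⟨p * γ 1 1 - q * γ 1 0, -p * γ 0 1 + q * γ 0 0, ?_⟩
      push_cast
      linear_combination (-(p : QR Δ e) * z1 - q * z2) * hγ'
    · rintro ⟨p, q, rfl⟩
      refine ⟨p * γ 0 0 + q * γ 1 0, p * γ 0 1 + q * γ 1 1, ?_⟩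
      push_cast; ring
  · simp only [star_add, star_mul', star_int]
    linear_combination ((γ 0 0 : QR Δ e) * γ 1 1 - γ 0 1 * γ 1 0) * h.ori +
      (((d.A * d0.A : ℤ) : QR Δ e) * sq Δ e) * hγ'
  · linear_combination (γ 0 0 : QR Δ e) ^ 3 * h.e0 + 3 * (γ 0 0 : QR Δ e) ^ 2 * γ 0 1 * h.e1
      + 3 * (γ 0 0 : QR Δ e) * γ 0 1 ^ 2 * h.e2 + (γ 0 1 : QR Δ e) ^ 3 * h.e3
  · linear_combination (γ 0 0 : QR Δ e) ^ 2 * γ 1 0 * h.e0 +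
      ((γ 0 0 : QR Δ e) ^ 2 * γ 1 1 + 2 * γ 0 0 * γ 0 1 * γ 1 0) * h.e1
      + ((γ 0 1 : QR Δ e) ^ 2 * γ 1 0 + 2 * γ 0 0 * γ 0 1 * γ 1 1) * h.e2 + (γ 0 1 : QR Δ e) ^ 2 * γ 1 1 * h.e3
  · linear_combination (γ 1 0 : QR Δ e) ^ 2 * γ 0 0 * h.e0 +
      ((γ 1 0 : QR Δ e) ^ 2 * γ 0 1 + 2 * γ 1 0 * γ 1 1 * γ 0 0) * h.e1
      + ((γ 1 1 : QR Δ e) ^ 2 * γ 0 0 + 2 * γ 1 0 * γ 1 1 * γ 0 1) * h.e2 + (γ 1 1 : QR Δ e) ^ 2 * γ 0 1 * h.e3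
  · linear_combination (γ 1 0 : QR Δ e) ^ 3 * h.e0 + 3 * (γ 1 0 : QR Δ e) ^ 2 * γ 1 1 * h.e1
      + 3 * (γ 1 0 : QR Δ e) * γ 1 1 ^ 2 * h.e2 + (γ 1 1 : QR Δ e) ^ 3 * h.e3
  · apply V_ext <;> simp only [act0, act1, act2, act3, gOf] <;> simp [pow_succ] <;> ring

lemma Rel.facts {d d0 : Dat Δ e} (hm : d.m = d0.m) {z1 z2 t0 t1 t2 t3 : QR Δ e} (h : Rel d d0 z1 z2 t0 t1 t2 t3) :
    cubicDisc (gOf t0 t1 t2 t3) = -27 * Δ ∧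
    2 * t0.re + Δ * t0.im = -(2 * t1.im ^ 3 - 3 * t0.im * t1.im * t2.im + t0.im ^ 2 * t3.im) ∧
    2 * t1.re + Δ * t1.im = -(t1.im ^ 2 * t2.im + t0.im * t1.im * t3.im - 2 * t0.im * t2.im ^ 2) := by
  have hn : d.A * d0.A ≠ 0 := mul_ne_zero d.hA0 d0.hA0
  set n : ℤ := d.A * d0.A with hnd
  have hβ : (d.T0 * star d0.T0) * star (d.T0 * star d0.T0) = ((d.m ^ 2 * n ^ 3 : ℤ) : QR Δ e) := by
    rw [star_mul', star_star]
    calc _ = (d.T0 * star d.T0) * (d0.T0 * star d0.T0) := by ring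
      _ = _ := by rw [qr_mul_star, qr_mul_star, normT0, normT0, ← hm, hnd]; push_cast; ring
  set β := d.T0 * star d0.T0 with hβd
  set β' := star β
  set y1 := star z1 with hy1
  set y2 := star z2 with hy2
  have ori := h.ori
  rw [← hnd, ← hy1, ← hy2] at ori
  set N : ℤ := d.m * n ^ 3 with hN
  have hNne : N ≠ 0 := mul_ne_zero d.hm.ne' (pow_ne_zero _ hn)
  have c0 := h.e0
  have c1 := h.e1
  have c2 := h.e2
  have c3 := h.e3
  rw [← hnd, ← hN, ← hβd] at c0 c1 c2 c3
  have s0 := congrArg star c0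
  have s1 := congrArg star c1
  have s2 := congrArg star c2
  have s3 := congrArg star c3
  simp only [star_mul', star_pow, star_int, ← hy1, ← hy2] at s0 s1 s2 s3
  have f0 : β * z1 ^ 3 - β' * y1 ^ 3 = N * (t0.im * sq Δ e) := by
    rw [← sub_star]; linear_combination c0 - s0
  have f1 : β * (z1 ^ 2 * z2) - β' * (y1 ^ 2 * y2) = N * (t1.im * sq Δ e) := by
    rw [← sub_star]; linear_combination c1 - s1
  have f2 : β * (z1 * z2 ^ 2) - β' * (y1 * y2 ^ 2) = N * (t2.im * sq Δ e) := by
    rw [← sub_star]; linear_combination c2 - s2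
  have f3 : β * z2 ^ 3 - β' * y2 ^ 3 = N * (t3.im * sq Δ e) := by
    rw [← sub_star]; linear_combination c3 - s3
  have g0 : β * z1 ^ 3 + β' * y1 ^ 3 = N * ((2 * t0.re + Δ * t0.im : ℤ) : QR Δ e) := by
    rw [← add_star]; linear_combination c0 + s0
  have g1 : β * (z1 ^ 2 * z2) + β' * (y1 ^ 2 * y2) = N * ((2 * t1.re + Δ * t1.im : ℤ) : QR Δ e) := by
    rw [← add_star]; linear_combination c1 + s1
  have hss := sq_sq d.he
  set s := sq Δ e with hs
  have hsn : s.norm ≠ 0 := by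
    intro h0
    have := congrArg QuadraticAlgebra.norm hss
    rw [map_mul, h0, qr_norm_int] at this
    exact pow_ne_zero 2 d.hΔ (by rw [← this]; ring)
  have hcast : ∀ a b : ℤ, (a : QR Δ e) = b → a = b := by
    intro a b hab
    have := congrArg QuadraticAlgebra.re hab
    simpa using this
  set x0 : ℤ := t0.im
  set x1 : ℤ := t1.im
  set x2 : ℤ := t2.im
  set x3 : ℤ := t3.im
  -- names
  have hMn : ((N ^ 4 : ℤ) : QR Δ e).norm ≠ 0 := int_ne (pow_ne_zero _ hNne)
  have hMn3 : ((N ^ 3 : ℤ) : QR Δ e).norm ≠ 0 := int_ne (pow_ne_zero _ hNne)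
  have hβ2 : β * β' = (d.m : QR Δ e) ^ 2 * n ^ 3 := by rw [hβ]; push_cast; rfl
  have hNc : (N : QR Δ e) = d.m * n ^ 3 := by rw [hN]; push_cast; rfl
  refine ⟨?_, ?_, ?_⟩
  · have : x0 ^ 2 * x3 ^ 2 - 6 * x0 * x1 * x2 * x3 + 4 * x0 * x2 ^ 3 + 4 * x1 ^ 3 * x3 - 3 * x1 ^ 2 * x2 ^ 2 = Δ := by
      apply hcast
      apply qr_cancel hMn
      apply qr_cancel (z := s ^ 4) (by rw [map_pow]; exact pow_ne_zero _ hsn)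
      have id1 : (β * z1 ^ 3 - β' * y1 ^ 3) ^ 2 * (β * z2 ^ 3 - β' * y2 ^ 3) ^ 2
        - 6 * (β * z1 ^ 3 - β' * y1 ^ 3) * (β * (z1 ^ 2 * z2) - β' * (y1 ^ 2 * y2)) * (β * (z1 * z2 ^ 2) - β' * (y1 * y2 ^ 2)) * (β * z2 ^ 3 - β' * y2 ^ 3)
        + 4 * (β * z1 ^ 3 - β' * y1 ^ 3) * (β * (z1 * z2 ^ 2) - β' * (y1 * y2 ^ 2)) ^ 3
        + 4 * (β * (z1 ^ 2 * z2) - β' * (y1 ^ 2 * y2)) ^ 3 * (β * z2 ^ 3 - β' * y2 ^ 3)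
        - 3 * (β * (z1 ^ 2 * z2) - β' * (y1 ^ 2 * y2)) ^ 2 * (β * (z1 * z2 ^ 2) - β' * (y1 * y2 ^ 2)) ^ 2
        = (β * β') ^ 2 * (z1 * y2 - z2 * y1) ^ 6 := by ring
      rw [f0, f1, f2, f3, ori, hβ2] at id1
      push_cast
      rw [← hss]
      rw [hNc] at id1 ⊢
      linear_combination id1
    simp only [cubicDisc, gOf]
    simp
    change (3 * x1) ^ 2 * (3 * x2) ^ 2 + 18 * x0 * (3 * x1) * (3 * x2) * x3 - 4 * x0 * (3 * x2) ^ 3 - 4 * (3 * x1) ^ 3 * x3 - 27 * x0 ^ 2 * x3 ^ 2 = _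
    linear_combination -27 * this
  · apply hcast
    apply qr_cancel hMn3
    apply qr_cancel (z := s ^ 3) (by rw [map_pow]; exact pow_ne_zero _ hsn)
    have id1 : -(β * β') * (z1 * y2 - z2 * y1) ^ 3 * (β * z1 ^ 3 + β' * y1 ^ 3) =
      2 * (β * (z1 ^ 2 * z2) - β' * (y1 ^ 2 * y2)) ^ 3 - 3 * (β * z1 ^ 3 - β' * y1 ^ 3) * (β * (z1 ^ 2 * z2) - β' * (y1 ^ 2 * y2)) * (β * (z1 * z2 ^ 2) - β' * (y1 * y2 ^ 2))
      + (β * z1 ^ 3 - β' * y1 ^ 3) ^ 2 * (β * z2 ^ 3 - β' * y2 ^ 3) := by ring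
    rw [f0, f1, f2, f3, ori, hβ2, g0] at id1
    push_cast at id1 ⊢
    rw [hNc] at id1 ⊢
    linear_combination -id1
  · apply hcast
    apply qr_cancel hMn3
    apply qr_cancel (z := s ^ 3) (by rw [map_pow]; exact pow_ne_zero _ hsn)
    have id1 : -(β * β') * (z1 * y2 - z2 * y1) ^ 3 * (β * (z1 ^ 2 * z2) + β' * (y1 ^ 2 * y2)) =
      (β * (z1 ^ 2 * z2) - β' * (y1 ^ 2 * y2)) ^ 2 * (β * (z1 * z2 ^ 2) - β' * (y1 * y2 ^ 2))
      + (β * z1 ^ 3 - β' * y1 ^ 3) * (β * (z1 ^ 2 * z2) - β' * (y1 ^ 2 * y2)) * (β * z2 ^ 3 - β' * y2 ^ 3)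
      - 2 * (β * z1 ^ 3 - β' * y1 ^ 3) * (β * (z1 * z2 ^ 2) - β' * (y1 * y2 ^ 2)) ^ 2 := by ring
    rw [f0, f1, f2, f3, ori, hβ2, g1] at id1
    push_cast at id1 ⊢
    rw [hNc] at id1 ⊢
    linear_combination -id1

end Dat
end CubicCount

namespace CubicCount
open QuadraticAlgebra
open scoped Pointwise

namespace Dat
variable {Δ e : ℤ}

def IsFor (d : Dat Δ e) (f : V) : Prop := d.a0 = 3 * f 0 ∧ d.a1 = f 1 ∧ d.a2 = f 2 ∧ d.a3 = 3 * f 3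

lemma mem_I (d : Dat Δ e) (x : QR Δ e) (hx : x ∈ d.I) : ∃ p q : ℤ, x = p * d.A + q * d.w := by
  rw [I, Ideal.mem_span_pair] at hx
  obtain ⟨α, β, rfl⟩ := hx
  refine ⟨α.re - α.im * d.k - β.im * d.C, α.im * d.A + β.re + β.im * (Δ + d.k), ?_⟩
  have := d.hdisc
  ext
  · simp [w]; linear_combination -β.im * this
  · simp [w]; ring

lemma Tf (d : Dat Δ e) (u v : QR Δ e) :
    d.T0 * (u * d.A + v * d.w) ^ 3 = d.A ^ 3 * (d.T0 * u ^ 3 + 3 * d.T1 * u ^ 2 * v + 3 * d.T2 * u * v ^ 2 + d.T3 * v ^ 3) := by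
  have h1 := d.T0w
  have h2 := d.T1w
  have h3 := d.T2w
  have e1 : (d.A : QR Δ e) ^ 3 * d.T1 = d.T0 * ((d.A : QR Δ e) ^ 2 * d.w) := by
    linear_combination -(d.A : QR Δ e) ^ 2 * h1
  have e2 : (d.A : QR Δ e) ^ 3 * d.T2 = d.T0 * ((d.A : QR Δ e) * d.w ^ 2) := by
    linear_combination -(d.A : QR Δ e) * d.w * h1 - (d.A : QR Δ e) ^ 2 * h2
  have e3 : (d.A : QR Δ e) ^ 3 * d.T3 = d.T0 * (d.w ^ 3) := by
    linear_combination - d.w ^ 2 * h1 - (d.A : QR Δ e) * d.w * h2 - (d.A : QR Δ e) ^ 2 * h3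
  linear_combination -3 * u ^ 2 * v * e1 - 3 * u * v ^ 2 * e2 - v ^ 3 * e3

lemma qr_ext_of {t t' : QR Δ e} (h1 : t.im = t'.im) (h2 : 2 * t.re + Δ * t.im = 2 * t'.re + Δ * t'.im) : t = t' := by
  ext
  · rw [h1] at h2; linarith
  · exact h1

lemma inj {d d' d0 : Dat Δ e} (hm : d.m = d0.m) (hm' : d'.m = d0.m)
    {z1 z2 t0 t1 t2 t3 : QR Δ e} (h : Rel d d0 z1 z2 t0 t1 t2 t3)
    {y1 y2 s0 s1 s2 s3 : QR Δ e} (h' : Rel d' d0 y1 y2 s0 s1 s2 s3)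
    (hg : gOf t0 t1 t2 t3 = gOf s0 s1 s2 s3) (hy : y1.norm ≠ 0)
    {f f' : V} (hf : d.IsFor f) (hf' : d'.IsFor f') (hD : cubicDisc f = cubicDisc f')
    (hD0 : cubicDisc f ≠ 0) : GEqv f' f := by
  have i0 : t0.im = s0.im := congrFun hg 0
  have i1 : t1.im = s1.im := by
    have : 3 * t1.im = 3 * s1.im := congrFun hg 1
    linarith
  have i2 : t2.im = s2.im := by
    have : 3 * t2.im = 3 * s2.im := congrFun hg 2
    linarith
  have i3 : t3.im = s3.im := congrFun hg 3
  obtain ⟨-, ha, hb⟩ := h.facts hm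
  obtain ⟨-, ha', hb'⟩ := h'.facts hm'
  have et0 : t0 = s0 := qr_ext_of i0 (by rw [ha, ha', i0, i1, i2, i3])
  have et1 : t1 = s1 := qr_ext_of i1 (by rw [hb, hb', i0, i1, i2, i3])
  have hstar0 : (star d0.T0).norm ≠ 0 := by
    rw [QuadraticAlgebra.norm_star]; exact d0.normT0_ne
  have E0 : (d'.A : QR Δ e) ^ 3 * d.T0 * z1 ^ 3 = (d.A : QR Δ e) ^ 3 * d'.T0 * y1 ^ 3 := by
    apply qr_cancel hstar0
    have a := h.e0
    have b := h'.e0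
    rw [et0, hm] at a
    rw [hm'] at b
    push_cast at a b
    linear_combination (d'.A : QR Δ e) ^ 3 * a - (d.A : QR Δ e) ^ 3 * b
  have E1 : (d'.A : QR Δ e) ^ 3 * d.T0 * (z1 ^ 2 * z2) = (d.A : QR Δ e) ^ 3 * d'.T0 * (y1 ^ 2 * y2) := by
    apply qr_cancel hstar0
    have a := h.e1
    have b := h'.e1
    rw [et1, hm] at a
    rw [hm'] at b
    push_cast at a b
    linear_combination (d'.A : QR Δ e) ^ 3 * a - (d.A : QR Δ e) ^ 3 * b
  have hz : z1.norm ≠ 0 := by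
    intro h0
    have := congrArg QuadraticAlgebra.norm E0
    simp only [map_mul, map_pow, h0] at this
    rw [zero_pow (by norm_num), mul_zero] at this
    exact mul_ne_zero (mul_ne_zero (pow_ne_zero _ d.normA_ne) d'.normT0_ne) (pow_ne_zero _ hy) this.symm
  have hzy : z1 * y2 = y1 * z2 := by
    apply qr_cancel (z := (d'.A : QR Δ e) ^ 3 * d.T0 * z1 ^ 2)
    · simp only [map_mul, map_pow]
      exact mul_ne_zero (mul_ne_zero (pow_ne_zero _ d'.normA_ne) d.normT0_ne) (pow_ne_zero _ hz)
    · linear_combination y2 * E0 - y1 * E1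
  have hJ : Ideal.span {y1} * (d.I * d0.I.map (starRingEnd (QR Δ e))) = Ideal.span {z1} * (d'.I * d0.I.map (starRingEnd (QR Δ e))) := by
    ext x
    rw [Ideal.mem_span_singleton_mul, Ideal.mem_span_singleton_mul]
    constructor
    · rintro ⟨a, ha, rfl⟩
      obtain ⟨p, q, rfl⟩ := (h.gen a).1 ha
      exact ⟨p * y1 + q * y2, (h'.gen _).2 ⟨p, q, rfl⟩, by linear_combination q * hzy⟩
    · rintro ⟨a, ha, rfl⟩
      obtain ⟨p, q, rfl⟩ := (h'.gen a).1 ha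
      exact ⟨p * z1 + q * z2, (h.gen _).2 ⟨p, q, rfl⟩, by linear_combination -q * hzy⟩
  have hI : Ideal.span {y1} * d.I = Ideal.span {z1} * d'.I := by
    apply ideal_cancel_eq d0.normA_ne
    rw [← d0.I_mul_star]
    calc _ = d0.I * (Ideal.span {y1} * (d.I * d0.I.map (starRingEnd (QR Δ e)))) := by ring
      _ = _ := by rw [hJ]; ring
  have get : ∀ x ∈ d.I, ∃ p q : ℤ, y1 * x = z1 * (p * d'.A + q * d'.w) := by
    intro x hx
    have : y1 * x ∈ Ideal.span {y1} * d.I := Ideal.mul_mem_mul (Ideal.mem_span_singleton_self _) hx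
    rw [hI, Ideal.mem_span_singleton_mul] at this
    obtain ⟨y, hy, e⟩ := this
    obtain ⟨p, q, rfl⟩ := d'.mem_I y hy
    exact ⟨p, q, e.symm⟩
  obtain ⟨γ00, γ01, k0⟩ := get d.A (Ideal.subset_span (Or.inl rfl))
  obtain ⟨γ10, γ11, k1⟩ := get d.w (Ideal.subset_span (Or.inr rfl))
  have hfe : f = cubicAct !![γ00, γ01; γ10, γ11] f' := by
    apply ev_ext
    intro u v
    rw [ev_act]
    simp only [Matrix.of_apply, Matrix.cons_val', Matrix.cons_val_zero, Matrix.cons_val_one, Matrix.cons_val_fin_one]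
    set u' := u * γ00 + v * γ10 with hu'
    set v' := u * γ01 + v * γ11 with hv'
    have k : y1 * (u * d.A + v * d.w) = z1 * (u' * d'.A + v' * d'.w) := by
      rw [hu', hv']; push_cast
      linear_combination (u : QR Δ e) * k0 + (v : QR Δ e) * k1
    have a := d.Tf u v
    have b := d'.Tf u' v'
    have main : (d.T0 * u ^ 3 + 3 * d.T1 * u ^ 2 * v + 3 * d.T2 * u * v ^ 2 + d.T3 * v ^ 3 : QR Δ e) =
      (d'.T0 * u' ^ 3 + 3 * d'.T1 * u' ^ 2 * v' + 3 * d'.T2 * u' * v' ^ 2 + d'.T3 * v' ^ 3) := by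
      apply qr_cancel (z := (d'.A : QR Δ e) ^ 3 * (d.A : QR Δ e) ^ 3 * y1 ^ 3)
      · simp only [map_mul, map_pow]
        exact mul_ne_zero (mul_ne_zero (pow_ne_zero _ d'.normA_ne) (pow_ne_zero _ d.normA_ne)) (pow_ne_zero _ hy)
      · have k3 := congrArg (fun t => t ^ 3) k
        simp only [mul_pow] at k3
        linear_combination (-(d'.A : QR Δ e) ^ 3 * y1 ^ 3) * a + (d.A : QR Δ e) ^ 3 * y1 ^ 3 * b
          + (d'.A : QR Δ e) ^ 3 * d.T0 * k3 + ((u' : QR Δ e) * (d'.A : QR Δ e) + (v' : QR Δ e) * d'.w) ^ 3 * E0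
    have im := congrArg QuadraticAlgebra.im main
    obtain ⟨q0, q1, q2, q3⟩ := hf
    obtain ⟨q0', q1', q2', q3'⟩ := hf'
    simp [T0, T1, T2, T3, pow_succ, q0, q1, q2, q3, q0', q1', q2', q3'] at im
    simp only [ev]
    linarith
  refine ⟨_, ?_, hfe⟩
  set γ := !![γ00, γ01; γ10, γ11]
  have := disc_act γ f'
  rw [← hfe, ← hD] at this
  have h6 : γ.det ^ 6 = 1 := by
    have : (γ.det ^ 6 - 1) * cubicDisc f = 0 := by linear_combination -this
    rcases mul_eq_zero.1 this with h | h
    · linarith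
    · exact absurd h hD0
  exact IsUnit.of_pow_eq_one h6 (by norm_num)

/-- every form with nonzero leading Hessian coefficient has a datum -/
lemma exists_dat (f : V) (hA0 : CubicCount.hA f ≠ 0) (hD : cubicDisc f ≠ 0) :
    ∃ (Δ e : ℤ) (d : Dat Δ e), d.IsFor f ∧ d.m ^ 2 * Δ = -3 * cubicDisc f ∧
      ∀ q : ℤ, (q ∣ CubicCount.hA f ∧ q ∣ CubicCount.hB f ∧ q ∣ CubicCount.hC f) ↔ q ∣ d.m := by
  set m : ℤ := gcd (CubicCount.hA f) (gcd (CubicCount.hB f) (CubicCount.hC f)) with hm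
  have hmpos : 0 < m := by
    have h1 : 0 ≤ m := by
      rw [hm]; exact Int.natCast_nonneg _
    have h2 : m ≠ 0 := by
      intro h; rw [hm, gcd_eq_zero_iff] at h; exact hA0 h.1
    omega
  have hdv : ∀ q : ℤ, (q ∣ CubicCount.hA f ∧ q ∣ CubicCount.hB f ∧ q ∣ CubicCount.hC f) ↔ q ∣ m := by
    intro q; rw [hm, dvd_gcd_iff, dvd_gcd_iff]
  obtain ⟨⟨A, hA⟩, ⟨B, hB⟩, ⟨C, hC⟩⟩ := (hdv m).2 dvd_rfl
  have hprim : ∃ p q r : ℤ, p * A + q * B + r * C = 1 := by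
    obtain ⟨x, y, h1⟩ := exists_gcd_eq_mul_add_mul (CubicCount.hA f) (gcd (CubicCount.hB f) (CubicCount.hC f))
    obtain ⟨x', y', h2⟩ := exists_gcd_eq_mul_add_mul (CubicCount.hB f) (CubicCount.hC f)
    rw [← hm, h2] at h1
    refine ⟨x, x' * y, y' * y, ?_⟩
    apply mul_left_cancel₀ hmpos.ne'
    rw [hA, hB, hC] at h1
    linear_combination -h1
  have hes := hess_disc f
  obtain ⟨k, e, hk, he⟩ : ∃ k e : ℤ, B = (B ^ 2 - 4 * A * C) + 2 * k ∧
      4 * e = (B ^ 2 - 4 * A * C) ^ 2 - (B ^ 2 - 4 * A * C) := by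
    obtain ⟨j, hj⟩ : Even (B * (B - 1)) := Int.even_mul_pred_self B
    rcases Int.even_or_odd B with ⟨l, hl⟩ | ⟨l, hl⟩
    · refine ⟨l - 2 * l ^ 2 + 2 * A * C, (l ^ 2 - A * C) * (4 * l ^ 2 - 4 * A * C - 1), ?_, ?_⟩ <;> subst hl <;> ring
    · refine ⟨l - 2 * l ^ 2 - 2 * l + 2 * A * C, (l ^ 2 + l - A * C) * (4 * l ^ 2 + 4 * l + 1 - 4 * A * C), ?_, ?_⟩ <;> subst hl <;> ring
  have hΔ : m ^ 2 * (B ^ 2 - 4 * A * C) = -3 * cubicDisc f := by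
    rw [← hes, hA, hB, hC]; ring
  refine ⟨B ^ 2 - 4 * A * C, e, ⟨3 * f 0, f 1, f 2, 3 * f 3, m, A, k, C, he, ?_, ?_, ?_, hmpos, ?_, ?_, ?_, ?_⟩, ⟨rfl, rfl, rfl, rfl⟩, hΔ, hdv⟩
  · rw [← hA, CubicCount.hA]
  · rw [← hk, ← hB, CubicCount.hB]; ring
  · rw [← hC, CubicCount.hC]; ring
  · rintro rfl; exact hA0 (by rw [hA]; ring)
  · intro h; rw [h] at hΔ; apply hD; linarith
  · rw [← hk]; exact hprim
  · set Δ := B ^ 2 - 4 * A * C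
    have hΔd : Δ = B ^ 2 - 4 * A * C := rfl
    have h4 : 4 * (k ^ 2 + k * Δ + e) = 4 * (A * C) := by
      linear_combination he - hΔd - (B + Δ + 2 * k) * hk
    linarith

end Dat
end CubicCount

namespace CubicCount

/-- roots of the quadratic congruence -/
noncomputable def rts (Δ e : ℤ) (g : ℕ) : Finset ℤ := (Finset.Ico (0 : ℤ) g).filter (fun b => (g : ℤ) ∣ b ^ 2 + b * Δ + e)

lemma card_class (g M : ℕ) (hM : 0 < M) (hMg : M ∣ g) (v : ℤ) :
    ((Finset.Ico (0 : ℤ) g).filter (fun b => (M : ℤ) ∣ b - v)).card ≤ g / M := by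
  have : ((Finset.Ico (0 : ℤ) g).filter (fun b => (M : ℤ) ∣ b - v)).card ≤ (Finset.Ico (0 : ℤ) (g / M : ℕ)).card := by
    apply Finset.card_le_card_of_injOn (fun b : ℤ => b / (M:ℤ))
    · intro b hb
      simp only [Finset.coe_filter, Finset.mem_Ico, Set.mem_ofPred_eq] at hb
      simp only [Finset.coe_Ico, Set.mem_Ico]
      obtain ⟨k, rfl⟩ := hMg
      rw [Nat.mul_div_cancel_left _ hM]
      push_cast at hb
      refine ⟨Int.ediv_nonneg hb.1.1 (by positivity), ?_⟩
      apply Int.ediv_lt_of_lt_mul (by exact_mod_cast hM)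
      linarith [hb.1.2]
    · intro b hb b' hb' h
      simp only [Finset.coe_filter, Finset.mem_Ico, Set.mem_ofPred_eq] at hb hb'
      have h1 : (M : ℤ) ∣ b - b' := by have := dvd_sub hb.2 hb'.2; simpa using this
      have h2 : b % M = b' % M := (Int.emod_emod_of_dvd _ dvd_rfl).symm.trans (by
        rw [Int.emod_emod]; exact Int.emod_eq_emod_iff_emod_sub_eq_zero.2 (Int.emod_eq_zero_of_dvd h1))
      have e1 := Int.emod_add_mul_ediv b M
      have e2 := Int.emod_add_mul_ediv b' M
      simp only at h
      rw [← e1, ← e2, h2, h]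
  rwa [Int.card_Ico, sub_zero, Int.toNat_natCast] at this

lemma card_rts_le (Δ e : ℤ) (g : ℕ) (hg : 0 < g) :
    ((rts Δ e g).card : ℝ) ≤ ∑ d ∈ g.divisorsAntidiagonal, Real.sqrt (d.1 * d.2) := by
  classical
  rcases (rts Δ e g).eq_empty_or_nonempty with h | ⟨b0, hb0⟩
  · rw [h]; simp; exact Finset.sum_nonneg (fun _ _ => by positivity)
  have hsub : rts Δ e g ⊆ g.divisorsAntidiagonal.biUnion (fun d =>
      if d.1 ≤ d.2 then (Finset.Ico (0 : ℤ) g).filter (fun b => (d.2 : ℤ) ∣ b - (-b0 - Δ))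
      else (Finset.Ico (0 : ℤ) g).filter (fun b => (d.1 : ℤ) ∣ b - b0)) := by
    intro b hb
    rw [rts, Finset.mem_filter] at hb hb0
    have h1 : (g : ℤ) ∣ (b - b0) * (b + b0 + Δ) := by
      have := dvd_sub hb.2 hb0.2
      have h0 : (b - b0) * (b + b0 + Δ) = (b ^ 2 + b * Δ + e) - (b0 ^ 2 + b0 * Δ + e) := by ring
      rw [h0]; exact this
    set d := Int.gcd g (b - b0) with hd
    have hdg : d ∣ g := by
      have := Int.gcd_dvd_left (a := (g : ℤ)) (b := b - b0)
      exact_mod_cast this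
    obtain ⟨k, hk⟩ := hdg
    have hdpos : 0 < d := Nat.pos_of_ne_zero (by rintro h; rw [h] at hk; omega)
    have hk2 : (k : ℤ) ∣ b + b0 + Δ := by
      obtain ⟨u, v, huv⟩ : ∃ u v : ℤ, (d : ℤ) = g * u + (b - b0) * v := ⟨_, _, Int.gcd_eq_gcd_ab _ _⟩
      have h2 : (d : ℤ) * k ∣ d * (b + b0 + Δ) := by
        have : (d : ℤ) * k = g := by exact_mod_cast hk.symm
        rw [this, huv]
        have : (g * u + (b - b0) * v) * (b + b0 + Δ) = g * (u * (b + b0 + Δ)) + ((b - b0) * (b + b0 + Δ)) * v := by ring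
        rw [this]
        exact dvd_add (dvd_mul_right _ _) (h1.mul_right _)
      exact (mul_dvd_mul_iff_left (by exact_mod_cast hdpos.ne')).1 h2
    rw [Finset.mem_biUnion]
    refine ⟨(d, k), by rw [Nat.mem_divisorsAntidiagonal]; exact ⟨hk.symm, hg.ne'⟩, ?_⟩
    split_ifs
    · rw [Finset.mem_filter]
      refine ⟨hb.1, ?_⟩
      convert hk2 using 1; ring
    · rw [Finset.mem_filter]
      exact ⟨hb.1, Int.gcd_dvd_right ..⟩
  have h1 : ((rts Δ e g).card : ℝ) ≤ ((∑ d ∈ g.divisorsAntidiagonal, (if d.1 ≤ d.2 then (Finset.Ico (0 : ℤ) g).filter (fun b => (d.2 : ℤ) ∣ b - (-b0 - Δ))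
      else (Finset.Ico (0 : ℤ) g).filter (fun b => (d.1 : ℤ) ∣ b - b0)).card : ℕ) : ℝ) := by
    exact_mod_cast (Finset.card_le_card hsub).trans Finset.card_biUnion_le
  refine h1.trans ?_
  rw [Nat.cast_sum]
  apply Finset.sum_le_sum
  rintro ⟨d, k⟩ hdk
  rw [Nat.mem_divisorsAntidiagonal] at hdk
  obtain ⟨hdk, -⟩ := hdk
  simp only at hdk ⊢
  have hd : 0 < d := Nat.pos_of_ne_zero (by rintro rfl; omega)
  have hk : 0 < k := Nat.pos_of_ne_zero (by rintro rfl; omega)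
  apply Real.le_sqrt_of_sq_le
  split_ifs with hle
  · have h2 := card_class g k hk ⟨d, by rw [← hdk, mul_comm]⟩ (-b0 - Δ)
    rw [← hdk, Nat.mul_div_cancel _ hk, hdk] at h2
    have h3 : (((Finset.Ico (0 : ℤ) g).filter (fun b => (k : ℤ) ∣ b - (-b0 - Δ))).card : ℝ) ≤ d := by exact_mod_cast h2
    have h4 : (d : ℝ) ≤ k := by exact_mod_cast hle
    calc _ ≤ (d : ℝ) ^ 2 := by gcongr
      _ ≤ d * k := by rw [pow_two]; gcongr
  · have h2 := card_class g d hd ⟨k, by rw [← hdk]⟩ b0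
    rw [← hdk, Nat.mul_div_cancel_left _ hd, hdk] at h2
    have h3 : (((Finset.Ico (0 : ℤ) g).filter (fun b => (d : ℤ) ∣ b - b0)).card : ℝ) ≤ k := by exact_mod_cast h2
    have h4 : (k : ℝ) ≤ d := by exact_mod_cast (not_le.1 hle).le
    calc _ ≤ (k : ℝ) ^ 2 := by gcongr
      _ ≤ d * k := by rw [pow_two]; gcongr

lemma card_rts_prime (Δ e : ℤ) (p g : ℕ) (hp : p.Prime) (hg : 0 < g) (hpg : ¬ p ∣ g) :
    (rts Δ e (p * g)).card ≤ 2 * (rts Δ e g).card := by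
  classical
  have := Fact.mk hp
  apply Finset.card_le_mul_card_image_of_maps_to (f := fun b => b % (g : ℤ))
  · intro b hb
    rw [rts, Finset.mem_filter] at hb ⊢
    have hgz : (0 : ℤ) < g := by exact_mod_cast hg
    refine ⟨Finset.mem_Ico.2 ⟨Int.emod_nonneg _ hgz.ne', Int.emod_lt_of_pos _ hgz⟩, ?_⟩
    have h1 : (g : ℤ) ∣ b ^ 2 + b * Δ + e := by
      refine dvd_trans ?_ hb.2
      push_cast; exact dvd_mul_left _ _
    have h2 := Int.emod_add_mul_ediv b g
    set q := b / (g : ℤ)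
    set r := b % (g : ℤ)
    rw [← h2] at h1
    have : (r + g * q) ^ 2 + (r + g * q) * Δ + e = (r ^ 2 + r * Δ + e) + g * (2 * r * q + g * q ^ 2 + q * Δ) := by ring
    rw [this] at h1
    exact (dvd_add_left (dvd_mul_right _ _)).1 h1
  · intro c hc
    have hinj : ((rts Δ e (p * g)).filter (fun b => b % (g : ℤ) = c)).card ≤
        (((rts Δ e (p * g)).filter (fun b => b % (g : ℤ) = c)).image (fun b : ℤ => (b : ZMod p))).card := by
      rw [Finset.card_image_of_injOn]
      intro b hb b' hb' h
      simp only [rts, Finset.coe_filter, Finset.mem_filter, Finset.mem_Ico, Set.mem_ofPred_eq] at hb hb'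
      have h1 : (p : ℤ) ∣ b - b' := by
        rw [← ZMod.intCast_zmod_eq_zero_iff_dvd]; push_cast
        simp only at h; rw [h, sub_self]
      have h2 : (g : ℤ) ∣ b - b' := Int.ModEq.dvd (show b' ≡ b [ZMOD g] from (hb'.2.trans hb.2.symm))
      have hcop : IsCoprime (p : ℤ) (g : ℤ) := Nat.isCoprime_iff_coprime.2 ((Nat.Prime.coprime_iff_not_dvd hp).2 hpg)
      have h3 : ((p : ℤ) * g) ∣ b - b' := hcop.mul_dvd h1 h2
      obtain ⟨⟨⟨a1, a2⟩, -⟩, -⟩ := hb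
      obtain ⟨⟨⟨a3, a4⟩, -⟩, -⟩ := hb'
      push_cast at a2 a4
      have h4 : b - b' = 0 := Int.eq_zero_of_abs_lt_dvd h3 (by rw [abs_lt]; constructor <;> linarith)
      linarith
    refine hinj.trans ?_
    rcases (((rts Δ e (p * g)).filter (fun b => b % (g : ℤ) = c)).image (fun b : ℤ => (b : ZMod p))).eq_empty_or_nonempty with h | ⟨x0, hx0⟩
    · rw [h]; simp
    have hroot : ∀ x ∈ (((rts Δ e (p * g)).filter (fun b => b % (g : ℤ) = c)).image (fun b : ℤ => (b : ZMod p))),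
        x ^ 2 + x * Δ + e = 0 := by
      intro x hx
      rw [Finset.mem_image] at hx
      obtain ⟨b, hb, rfl⟩ := hx
      rw [Finset.mem_filter, rts, Finset.mem_filter] at hb
      have h1 : (p : ℤ) ∣ b ^ 2 + b * Δ + e := by
        refine dvd_trans ?_ hb.1.2
        push_cast; exact dvd_mul_right _ _
      rw [← ZMod.intCast_zmod_eq_zero_iff_dvd] at h1
      exact_mod_cast h1
    have hsub : (((rts Δ e (p * g)).filter (fun b => b % (g : ℤ) = c)).image (fun b : ℤ => (b : ZMod p))) ⊆ {x0, -x0 - Δ} := by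
      intro x hx
      have h1 := hroot x hx
      have h2 := hroot x0 hx0
      have h3 : (x - x0) * (x - (-x0 - Δ)) = 0 := by linear_combination h1 - h2
      rcases mul_eq_zero.1 h3 with h | h
      · rw [sub_eq_zero] at h; simp [h]
      · rw [sub_eq_zero] at h; simp [h]
    exact (Finset.card_le_card hsub).trans Finset.card_le_two

lemma card_rts_prod (Δ e : ℤ) (s : Finset ℕ) : (∀ p ∈ s, p.Prime) → ∀ (g : ℕ), 0 < g → (∀ p ∈ s, ¬ p ∣ g) →
    (rts Δ e ((∏ p ∈ s, p) * g)).card ≤ 2 ^ s.card * (rts Δ e g).card := by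
  classical
  induction s using Finset.induction_on with
  | empty => intro _ g _ _; simp
  | insert p s hps ih =>
    intro hp g hg hn
    rw [Finset.prod_insert hps, Finset.card_insert_of_notMem hps]
    have h1 := ih (fun q hq => hp q (Finset.mem_insert_of_mem hq)) g hg (fun q hq => hn q (Finset.mem_insert_of_mem hq))
    have hpp := hp p (Finset.mem_insert_self _ _)
    have h2 := card_rts_prime Δ e p ((∏ p ∈ s, p) * g) hpp
      (Nat.mul_pos (Finset.prod_pos (fun q hq => (hp q (Finset.mem_insert_of_mem hq)).pos)) hg) (by
        rw [hpp.dvd_mul]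
        rintro (h | h)
        · obtain ⟨q, hq, hd⟩ := (Prime.dvd_finsetProd_iff hpp.prime _).1 h
          have := (Nat.prime_dvd_prime_iff_eq hpp (hp q (Finset.mem_insert_of_mem hq))).1 hd
          exact hps (this ▸ hq)
        · exact hn p (Finset.mem_insert_self _ _) h)
    rw [mul_assoc]
    calc _ ≤ _ := h2
      _ ≤ 2 * (2 ^ s.card * (rts Δ e g).card) := by gcongr
      _ = _ := by ring

/-- the convergent sum -/
lemma sum_W : ∃ K : ℝ, 0 < K ∧ ∀ n : ℕ, ∑ c ∈ Finset.Icc 1 n, ∑ g ∈ Finset.Icc 1 n,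
    (∑ d ∈ g.divisorsAntidiagonal, Real.sqrt (d.1 * d.2)) / ((c : ℝ) ^ 4 * (g : ℝ) ^ 2) ≤ K := by
  have hs : Summable (fun n : ℕ => 1 / (n : ℝ) ^ (3 / 2 : ℝ)) := Real.summable_one_div_nat_rpow.2 (by norm_num)
  have hs4 : Summable (fun n : ℕ => 1 / (n : ℝ) ^ 4) := Real.summable_one_div_nat_pow.2 (by norm_num)
  set S := ∑' n : ℕ, 1 / (n : ℝ) ^ (3 / 2 : ℝ)
  set S4 := ∑' n : ℕ, 1 / (n : ℝ) ^ 4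
  have hS : 0 ≤ S := tsum_nonneg (fun n => by positivity)
  have hS4 : 0 ≤ S4 := tsum_nonneg (fun n => by positivity)
  refine ⟨S4 * (S * S) + 1, by positivity, fun n => ?_⟩
  have h1 : ∑ g ∈ Finset.Icc 1 n, (∑ d ∈ g.divisorsAntidiagonal, Real.sqrt (d.1 * d.2)) / (g : ℝ) ^ 2 ≤ S * S := by
    have h2 : ∀ g ∈ Finset.Icc 1 n, (∑ d ∈ g.divisorsAntidiagonal, Real.sqrt (d.1 * d.2)) / (g : ℝ) ^ 2 =
        ∑ d ∈ g.divisorsAntidiagonal, (1 / (d.1 : ℝ) ^ (3 / 2 : ℝ)) * (1 / (d.2 : ℝ) ^ (3 / 2 : ℝ)) := by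
      intro g hg
      rw [Finset.sum_div]
      apply Finset.sum_congr rfl
      rintro ⟨d, k⟩ hdk
      rw [Nat.mem_divisorsAntidiagonal] at hdk
      obtain ⟨h, hg0⟩ := hdk
      simp only at h ⊢
      have hd : 0 < d := Nat.pos_of_ne_zero (by rintro rfl; omega)
      have hk : 0 < k := Nat.pos_of_ne_zero (by rintro rfl; omega)
      rw [← h]; push_cast
      rw [Real.sqrt_eq_rpow, one_div_mul_one_div, ← Real.mul_rpow (by positivity) (by positivity)]
      have hx : (0 : ℝ) < (d : ℝ) * k := by positivity
      rw [div_eq_div_iff (by positivity) (by positivity), ← Real.rpow_natCast, ← Real.rpow_add hx]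
      norm_num
    rw [Finset.sum_congr rfl h2, Finset.sum_sigma']
    calc _ ≤ ∑ x ∈ Finset.Icc 1 n ×ˢ Finset.Icc 1 n, (1 / (x.1 : ℝ) ^ (3 / 2 : ℝ)) * (1 / (x.2 : ℝ) ^ (3 / 2 : ℝ)) := by
          have hinj : Set.InjOn (fun x : (_ : ℕ) × (ℕ × ℕ) => x.2)
              ((Finset.Icc 1 n).sigma (fun g => g.divisorsAntidiagonal) : Finset ((_ : ℕ) × (ℕ × ℕ))) := by
            rintro ⟨g, d⟩ hx ⟨g', d'⟩ hx' h
            simp only [Finset.coe_sigma, Set.mem_sigma_iff, Finset.mem_coe, Nat.mem_divisorsAntidiagonal] at hx hx' h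
            subst h
            have : g = g' := hx.2.1.symm.trans hx'.2.1
            subst this; rfl
          rw [← Finset.sum_image (f := fun d : ℕ × ℕ => (1 / (d.1 : ℝ) ^ (3 / 2 : ℝ)) * (1 / (d.2 : ℝ) ^ (3 / 2 : ℝ))) hinj]
          apply Finset.sum_le_sum_of_subset_of_nonneg
          · intro d hd
            rw [Finset.mem_image] at hd
            obtain ⟨⟨g, d'⟩, hx, rfl⟩ := hd
            simp only [Finset.mem_sigma, Nat.mem_divisorsAntidiagonal, Finset.mem_Icc] at hx
            obtain ⟨⟨_, h3⟩, h1, h2⟩ := hx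
            have a1 : 0 < d'.1 := Nat.pos_of_ne_zero (by rintro h; rw [h] at h1; omega)
            have a2 : 0 < d'.2 := Nat.pos_of_ne_zero (by rintro h; rw [h] at h1; omega)
            simp only [Finset.mem_product, Finset.mem_Icc]
            refine ⟨⟨a1, ?_⟩, a2, ?_⟩ <;> nlinarith
          · intros; positivity
      _ = (∑ x ∈ Finset.Icc 1 n, 1 / (x : ℝ) ^ (3 / 2 : ℝ)) * ∑ x ∈ Finset.Icc 1 n, 1 / (x : ℝ) ^ (3 / 2 : ℝ) := by
          rw [Finset.sum_mul_sum, Finset.sum_product]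
      _ ≤ S * S := by
          have := hs.sum_le_tsum (Finset.Icc 1 n) (fun i _ => by positivity)
          exact mul_le_mul this this (Finset.sum_nonneg (fun i _ => by positivity)) hS
  have h3 : ∑ c ∈ Finset.Icc 1 n, 1 / (c : ℝ) ^ 4 ≤ S4 := hs4.sum_le_tsum (Finset.Icc 1 n) (fun i _ => by positivity)
  have h4 : ∑ c ∈ Finset.Icc 1 n, ∑ g ∈ Finset.Icc 1 n,
    (∑ d ∈ g.divisorsAntidiagonal, Real.sqrt (d.1 * d.2)) / ((c : ℝ) ^ 4 * (g : ℝ) ^ 2) =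
    (∑ c ∈ Finset.Icc 1 n, 1 / (c : ℝ) ^ 4) * ∑ g ∈ Finset.Icc 1 n, (∑ d ∈ g.divisorsAntidiagonal, Real.sqrt (d.1 * d.2)) / (g : ℝ) ^ 2 := by
    rw [Finset.sum_mul_sum]
    apply Finset.sum_congr rfl; intro c _
    apply Finset.sum_congr rfl; intro g _
    rw [one_div_mul_eq_div, div_div, mul_comm]
  rw [h4]
  have := mul_le_mul h3 h1 (Finset.sum_nonneg (fun i _ => by positivity)) hS4
  linarith

end CubicCount

namespace CubicCount

lemma GCov.of_labels {ι : Type*} {P : V → Prop} (L : Finset ι) (Lab : V → ι → Prop)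
    (h1 : ∀ x, P x → ∃ l ∈ L, Lab x l) (h2 : ∀ x x' l, Lab x l → Lab x' l → GEqv x x') :
    GCov P (L.card : ℝ) := by
  classical
  refine ⟨L.image (fun l => if h : ∃ x, Lab x l then h.choose else 0), ?_, ?_⟩
  · exact_mod_cast Finset.card_image_le
  · intro x hx
    obtain ⟨l, hl, hxl⟩ := h1 x hx
    refine ⟨_, Finset.mem_image_of_mem _ hl, ?_⟩
    have h : ∃ x, Lab x l := ⟨x, hxl⟩
    simp only [h, dite_true]
    exact h2 _ _ l h.choose_spec hxl

lemma GCov.biUnion {ι : Type*} (I : Finset ι) (P : ι → V → Prop) (N : ι → ℝ) (h : ∀ i ∈ I, GCov (P i) (N i)) :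
    GCov (fun x => ∃ i ∈ I, P i x) (∑ i ∈ I, N i) := by
  classical
  choose! R hR using h
  refine ⟨I.biUnion R, ?_, ?_⟩
  · calc ((I.biUnion R).card : ℝ) ≤ ((∑ i ∈ I, (R i).card : ℕ) : ℝ) := by exact_mod_cast Finset.card_biUnion_le
      _ = ∑ i ∈ I, ((R i).card : ℝ) := by push_cast; rfl
      _ ≤ _ := Finset.sum_le_sum (fun i hi => (hR i hi).1)
  · rintro x ⟨i, hi, hx⟩
    obtain ⟨y, hy, e⟩ := (hR i hi).2 x hx
    exact ⟨y, Finset.mem_biUnion.2 ⟨i, hi, hy⟩, e⟩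

/-- `q` divides the content of the Hessian -/
def HD (q : ℤ) (x : V) : Prop := q ∣ hA x ∧ q ∣ hB x ∧ q ∣ hC x

lemma HD.act {q : ℤ} {x : V} (h : HD q x) (γ : M2) : HD q (cubicAct γ x) := by
  obtain ⟨⟨a, ha⟩, ⟨b, hb⟩, ⟨c, hc⟩⟩ := h
  refine ⟨?_, ?_, ?_⟩
  · rw [hA_act, ha, hb, hc]; exact ⟨γ.det ^ 2 * (a * γ 0 0 ^ 2 + b * γ 0 0 * γ 0 1 + c * γ 0 1 ^ 2), by ring⟩
  · rw [hB_act, ha, hb, hc]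
    exact ⟨γ.det ^ 2 * (2 * a * γ 0 0 * γ 1 0 + b * (γ 0 0 * γ 1 1 + γ 0 1 * γ 1 0) + 2 * c * γ 0 1 * γ 1 1), by ring⟩
  · rw [hC_act, ha, hb, hc]; exact ⟨γ.det ^ 2 * (a * γ 1 0 ^ 2 + b * γ 1 0 * γ 1 1 + c * γ 1 1 ^ 2), by ring⟩

lemma SEqv.HD_iff {q : ℤ} {x y : V} (h : SEqv x y) : HD q x ↔ HD q y := by
  have key : ∀ {x y : V}, SEqv x y → HD q x → HD q y := by
    rintro x y ⟨g, -, rfl⟩ hx; exact hx.act g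
  exact ⟨key h, key h.symm⟩

/-- the inductive predicate -/
def Pred (s1 s2 : Finset ℕ) (Y : ℝ) (x : V) : Prop :=
  cubicDisc x ≠ 0 ∧ ((|cubicDisc x| : ℤ) : ℝ) < Y ∧ (∀ p ∈ s1, (p : ℤ) ^ 2 ∣ cubicDisc x) ∧
    ∀ p ∈ s2, HD (p : ℤ) x ∧ ¬ HD ((p : ℤ) ^ 2) x

def Good (c g : ℕ) (Δ e b : ℤ) (d : Dat Δ e) : Prop :=
  d.m = (c : ℤ) ^ 2 * g ∧ ∀ x : QR Δ e, x ∈ d.aI ↔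
    ∃ p q : ℤ, x = p * (((c : ℤ) * (g : ℤ) : ℤ) : QR Δ e) + q * (⟨c * b, c⟩ : QR Δ e)

def Slice (c g : ℕ) (Y : ℝ) (f : V) : Prop :=
  cubicDisc f ≠ 0 ∧ ((|cubicDisc f| : ℤ) : ℝ) < Y ∧ ∃ (Δ e b : ℤ) (d : Dat Δ e), 0 ≤ b ∧ b < g ∧
    (g : ℤ) ∣ b ^ 2 + b * Δ + e ∧ d.IsFor f ∧ d.m ^ 2 * Δ = -3 * cubicDisc f ∧ Good c g Δ e b d

/-- labels -/
def Lab (c g : ℕ) (f : V) (l : (_ : V) × ℤ) : Prop :=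
  ∃ (Δ e : ℤ) (d : Dat Δ e) (h : ∃ d, Good c g Δ e l.2 d) (z1 z2 t0 t1 t2 t3 : QR Δ e),
    d.IsFor f ∧ d.m ^ 2 * Δ = -3 * cubicDisc f ∧ cubicDisc f ≠ 0 ∧ d.m = (c : ℤ) ^ 2 * g ∧
    Dat.Rel d h.choose z1 z2 t0 t1 t2 t3 ∧ z1.norm ≠ 0 ∧ SEqv l.1 (Dat.gOf t0 t1 t2 t3)

lemma Lab.inj {c g : ℕ} {f f' : V} {l : (_ : V) × ℤ} (h : Lab c g f l) (h' : Lab c g f' l) : GEqv f f' := by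
  obtain ⟨Δ, e, d, hd, z1, z2, t0, t1, t2, t3, hf, hΔ, hD, hm, hr, hz, hs⟩ := h
  obtain ⟨Δ', e', d', hd', y1, y2, s0, s1, s2, s3, hf', hΔ', hD', hm', hr', hy, hs'⟩ := h'
  have hm0 := hd.choose_spec.1
  have hm0' := hd'.choose_spec.1
  have f1 := (hr.facts (hm.trans hm0.symm)).1
  have f2 := (hr'.facts (hm'.trans hm0'.symm)).1
  have hΔΔ : Δ = Δ' := by
    have e1 := hs.disc
    have e2 := hs'.disc
    rw [f1] at e1; rw [f2] at e2
    linarith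
  subst hΔΔ
  have hee : e = e' := by
    have e1 := d.he
    have e2 := d'.he
    linarith
  subst hee
  obtain ⟨γ, hγ, e1⟩ := hs.symm.trans hs'
  obtain ⟨z1', z2', t0', t1', t2', t3', hr2, e2⟩ := hr.act γ hγ
  have hDD : cubicDisc f = cubicDisc f' := by
    rw [hm] at hΔ; rw [hm'] at hΔ'; linarith
  exact (Dat.inj (hm.trans hm0.symm) (hm'.trans hm0.symm) hr2 hr' (e2.trans e1.symm) hy hf hf' hDD hD).symm

lemma slice_cov {c g : ℕ} (hc : 0 < c) (hg : 0 < g) {Y B N : ℝ}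
    (hR : SCov (fun x => cubicDisc x ≠ 0 ∧ ((|cubicDisc x| : ℤ) : ℝ) < 81 * Y / ((c : ℝ) ^ 2 * g) ^ 2) N)
    (hB : ∀ Δ e, ((rts Δ e g).card : ℝ) ≤ B) : GCov (Slice c g Y) (N * B) := by
  classical
  have hB0 : 0 ≤ B := le_trans (by positivity) (hB 0 0)
  obtain ⟨R, hN, hR⟩ := hR
  have := GCov.of_labels (P := Slice c g Y)
    (R.sigma (fun ρ => rts (cubicDisc ρ / (-27)) (((cubicDisc ρ / (-27)) ^ 2 - cubicDisc ρ / (-27)) / 4) g))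
    (Lab c g) ?_ (fun x x' l h h' => h.inj h')
  · refine this.mono (fun _ h => h) ?_
    rw [Finset.card_sigma]; push_cast
    calc _ ≤ ∑ ρ ∈ R, B := Finset.sum_le_sum (fun ρ _ => hB _ _)
      _ = R.card * B := by rw [Finset.sum_const, nsmul_eq_mul]
      _ ≤ N * B := by gcongr
  · rintro f ⟨hD, hY, Δ, e, b, d, hb0, hbg, hb, hf, hΔ, hgood⟩
    have hex : ∃ d, Good c g Δ e b d := ⟨d, hgood⟩
    have hm0 := hex.choose_spec.1
    have hmm : d.m = hex.choose.m := hgood.1.trans hm0.symm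
    have haI : d.aI = hex.choose.aI := by
      ext x; rw [hgood.2, hex.choose_spec.2]
    obtain ⟨z1, z2, t0, t1, t2, t3, hr, hz⟩ := Dat.exists_rel d hex.choose hmm haI
    have f1 := (hr.facts hmm).1
    have hΔ0 : Δ ≠ 0 := by
      rintro rfl; rw [mul_zero] at hΔ; exact hD (by linarith)
    obtain ⟨ρ, hρ, hs⟩ := hR (Dat.gOf t0 t1 t2 t3) ⟨by rw [f1]; simpa using hΔ0, by
      have e1 : |cubicDisc (Dat.gOf t0 t1 t2 t3)| * d.m ^ 2 = 81 * |cubicDisc f| := by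
        rw [f1, ← abs_of_nonneg (sq_nonneg d.m), ← abs_mul, ← abs_of_nonneg (show (0:ℤ) ≤ 81 by norm_num), ← abs_mul]
        congr 1
        linear_combination -27 * hΔ
      have e2 : ((|cubicDisc (Dat.gOf t0 t1 t2 t3)| : ℤ) : ℝ) * ((c : ℝ) ^ 2 * g) ^ 2 = 81 * ((|cubicDisc f| : ℤ) : ℝ) := by
        rw [hgood.1] at e1
        exact_mod_cast e1
      rw [lt_div_iff₀ (by positivity), e2]
      linarith⟩
    have hρD : cubicDisc ρ = -27 * Δ := by
      have := hs.disc; rw [f1] at this; linarith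
    have h27 : cubicDisc ρ / (-27) = Δ := by rw [hρD]; exact Int.mul_ediv_cancel_left _ (by norm_num)
    have h4 : (Δ ^ 2 - Δ) / 4 = e := by rw [← d.he]; exact Int.mul_ediv_cancel_left _ (by norm_num)
    refine ⟨⟨ρ, b⟩, ?_, Δ, e, d, hex, z1, z2, t0, t1, t2, t3, hf, hΔ, hD, hgood.1, hr, hz, hs⟩
    rw [Finset.mem_sigma]
    refine ⟨hρ, ?_⟩
    simp only
    rw [h27, h4, rts, Finset.mem_filter, Finset.mem_Ico]
    exact ⟨⟨hb0, hbg⟩, hb⟩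

lemma exists_slice (s : Finset ℕ) (hs : ∀ p ∈ s, p.Prime) (Y : ℝ) (x : V) (hx : Pred ∅ s Y x) :
    ∃ f, SEqv f x ∧ ∃ c g : ℕ, 0 < c ∧ 0 < g ∧ c ≤ ⌈3 * Y⌉₊ ∧ g ≤ ⌈3 * Y⌉₊ ∧ (∀ p ∈ s, ¬ p ∣ g) ∧
      Slice c ((∏ p ∈ s, p) * g) Y f := by
  obtain ⟨hD, hY, -, h2⟩ := hx
  obtain ⟨f, hxf, hAf⟩ := exists_hA_ne x hD
  have hDf : cubicDisc f = cubicDisc x := by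
    have := hxf.disc; exact this
  have hDf0 : cubicDisc f ≠ 0 := hDf ▸ hD
  obtain ⟨Δ, e, d, hf, hΔ, hq⟩ := Dat.exists_dat f hAf hDf0
  obtain ⟨c, g, b, hc, hg, hb0, hbg, hm, hdvd, hmem⟩ := hnf d.aI d.m d.hm.ne' d.aI_mul_star
  rw [abs_of_pos d.hm] at hm
  lift c to ℕ using hc.le
  lift g to ℕ using hg.le
  have hc' : 0 < c := by exact_mod_cast hc
  have hg' : 0 < g := by exact_mod_cast hg
  have hpm : ∀ p ∈ s, (p : ℤ) ∣ d.m ∧ ¬ (p : ℤ) ^ 2 ∣ d.m := by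
    intro p hp
    obtain ⟨h3, h4⟩ := h2 p hp
    rw [hxf.HD_iff] at h3 h4
    exact ⟨(hq _).1 h3, fun h => h4 ((hq _).2 h)⟩
  have hpm' : ∀ p ∈ s, p ∣ c ^ 2 * g ∧ ¬ p ^ 2 ∣ c ^ 2 * g := by
    intro p hp
    have := hpm p hp
    rw [hm] at this
    exact_mod_cast this
  have hpc : ∀ p ∈ s, ¬ p ∣ c := by
    intro p hp h
    exact (hpm' p hp).2 ((pow_dvd_pow_of_dvd h 2).mul_right _)
  have hpg : ∀ p ∈ s, p ∣ g := by
    intro p hp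
    rcases (hs p hp).dvd_mul.1 (hpm' p hp).1 with h | h
    · exact absurd ((hs p hp).dvd_of_dvd_pow h) (hpc p hp)
    · exact h
  have hrg : (∏ p ∈ s, p) ∣ g := Finset.prod_primes_dvd g (fun p hp => (hs p hp).prime) hpg
  obtain ⟨g1, rfl⟩ := hrg
  have hg1 : 0 < g1 := Nat.pos_of_mul_pos_left hg'
  have hrpos : 0 < ∏ p ∈ s, p := Nat.pos_of_mul_pos_right hg'
  have hΔ0 : Δ ≠ 0 := by
    rintro rfl; rw [mul_zero] at hΔ; exact hDf0 (by linarith)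
  have hbound : ((c ^ 2 * ((∏ p ∈ s, p) * g1) : ℕ) : ℝ) ≤ 3 * Y := by
    have e1 : d.m ^ 2 * |Δ| = 3 * |cubicDisc f| := by
      rw [← abs_of_nonneg (sq_nonneg d.m), ← abs_mul, hΔ, abs_mul]; norm_num
    have e2 : d.m ≤ 3 * |cubicDisc f| := by
      rw [← e1]
      have := d.hm
      have h5 : 1 ≤ |Δ| := Int.one_le_abs hΔ0
      nlinarith [mul_le_mul_of_nonneg_left h5 (sq_nonneg d.m)]
    have e3 : ((c ^ 2 * ((∏ p ∈ s, p) * g1) : ℕ) : ℤ) ≤ 3 * |cubicDisc f| := by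
      rw [hm] at e2; push_cast at e2 ⊢; exact e2
    have e4 : ((c ^ 2 * ((∏ p ∈ s, p) * g1) : ℕ) : ℝ) ≤ 3 * ((|cubicDisc f| : ℤ) : ℝ) := by exact_mod_cast e3
    rw [hDf] at e4
    linarith
  have hbn : c ^ 2 * ((∏ p ∈ s, p) * g1) ≤ ⌈3 * Y⌉₊ := by
    exact_mod_cast hbound.trans (Nat.le_ceil _)
  refine ⟨f, hxf.symm, c, g1, hc', hg1, le_trans ?_ hbn, le_trans ?_ hbn, ?_, hDf0, by rw [hDf]; exact hY, Δ, e, b, d, hb0, hbg,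
    hdvd, hf, hΔ, hm, hmem⟩
  · rw [pow_two, mul_assoc]
    exact Nat.le_mul_of_pos_right _ (by positivity)
  · rw [← mul_assoc]
    exact Nat.le_mul_of_pos_left _ (by positivity)
  · intro p hp h
    apply (hpm' p hp).2
    rw [pow_two]
    exact (mul_dvd_mul (Finset.dvd_prod_of_mem _ hp) h).mul_left _

lemma partB (hbase : ∃ C : ℝ, 0 < C ∧ ∀ Y : ℝ, 0 < Y →
      SCov (fun x => cubicDisc x ≠ 0 ∧ ((|cubicDisc x| : ℤ) : ℝ) < Y) (C * Y)) :
    ∃ M : ℝ, 0 < M ∧ ∀ s : Finset ℕ, (∀ p ∈ s, p.Prime) → ∀ Y : ℝ, 0 < Y →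
      GCov (Pred ∅ s Y) (M * 2 ^ s.card * Y / (((∏ p ∈ s, p : ℕ) : ℝ)) ^ 2) := by
  classical
  obtain ⟨C, hC, hbase⟩ := hbase
  obtain ⟨K, hK, hsum⟩ := sum_W
  refine ⟨81 * C * K, by positivity, fun s hs Y hY => ?_⟩
  set r : ℕ := ∏ p ∈ s, p with hr
  have hr0 : 0 < r := Finset.prod_pos (fun p hp => (hs p hp).pos)
  set n := ⌈3 * Y⌉₊ with hn
  set W : ℕ → ℝ := fun g => ∑ d ∈ g.divisorsAntidiagonal, Real.sqrt (d.1 * d.2) with hW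
  have hW0 : ∀ g, 0 ≤ W g := fun g => Finset.sum_nonneg (fun _ _ => Real.sqrt_nonneg _)
  set I : Finset (ℕ × ℕ) := (Finset.Icc 1 n ×ˢ Finset.Icc 1 n).filter (fun i => ∀ p ∈ s, ¬ p ∣ i.2) with hI
  have h1 := GCov.biUnion I (fun i => Slice i.1 (r * i.2) Y)
    (fun i => (C * (81 * Y / ((i.1 : ℝ) ^ 2 * ((r * i.2 : ℕ) : ℝ)) ^ 2)) * (2 ^ s.card * W i.2)) (by
      rintro ⟨c, g⟩ hi
      rw [hI, Finset.mem_filter, Finset.mem_product, Finset.mem_Icc, Finset.mem_Icc] at hi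
      obtain ⟨⟨⟨hc, -⟩, ⟨hg, -⟩⟩, hp⟩ := hi
      simp only at hc hg hp ⊢
      have hrg : 0 < r * g := Nat.mul_pos hr0 hg
      have hc0 : (0 : ℝ) < c := by exact_mod_cast hc
      have hrg0 : (0 : ℝ) < (r * g : ℕ) := by exact_mod_cast hrg
      refine slice_cov hc hrg (hbase _ (by positivity)) (fun Δ e => ?_)
      have h2 := card_rts_prod Δ e s hs g hg hp
      have h3 := card_rts_le Δ e g hg
      calc ((rts Δ e (r * g)).card : ℝ) ≤ ((2 ^ s.card * (rts Δ e g).card : ℕ) : ℝ) := by exact_mod_cast h2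
        _ = 2 ^ s.card * ((rts Δ e g).card : ℝ) := by push_cast; rfl
        _ ≤ _ := by gcongr)
  have h2 : ∑ i ∈ I, (C * (81 * Y / ((i.1 : ℝ) ^ 2 * ((r * i.2 : ℕ) : ℝ)) ^ 2)) * (2 ^ s.card * W i.2) ≤
      81 * C * K * 2 ^ s.card * Y / (r : ℝ) ^ 2 := by
    calc _ = ∑ i ∈ I, (81 * C * 2 ^ s.card * Y / (r : ℝ) ^ 2) * (W i.2 / ((i.1 : ℝ) ^ 4 * (i.2 : ℝ) ^ 2)) := by
          apply Finset.sum_congr rfl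
          rintro ⟨c, g⟩ hi
          rw [hI, Finset.mem_filter, Finset.mem_product, Finset.mem_Icc, Finset.mem_Icc] at hi
          obtain ⟨⟨⟨hc, -⟩, ⟨hg, -⟩⟩, hp⟩ := hi
          simp only at hc hg ⊢
          have hc0 : (c : ℝ) ≠ 0 := by positivity
          have hg0 : (g : ℝ) ≠ 0 := by positivity
          have hr0' : (r : ℝ) ≠ 0 := by positivity
          push_cast
          field_simp
      _ ≤ ∑ i ∈ Finset.Icc 1 n ×ˢ Finset.Icc 1 n, (81 * C * 2 ^ s.card * Y / (r : ℝ) ^ 2) * (W i.2 / ((i.1 : ℝ) ^ 4 * (i.2 : ℝ) ^ 2)) := by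
          apply Finset.sum_le_sum_of_subset_of_nonneg (Finset.filter_subset _ _)
          intro i _ _
          have := hW0 i.2
          positivity
      _ = (81 * C * 2 ^ s.card * Y / (r : ℝ) ^ 2) * ∑ c ∈ Finset.Icc 1 n, ∑ g ∈ Finset.Icc 1 n, W g / ((c : ℝ) ^ 4 * (g : ℝ) ^ 2) := by
          rw [← Finset.mul_sum, Finset.sum_product]
      _ ≤ (81 * C * 2 ^ s.card * Y / (r : ℝ) ^ 2) * K := by
          apply mul_le_mul_of_nonneg_left (hsum n); positivity
      _ = _ := by ring
  obtain ⟨R, hR1, hR2⟩ := h1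
  refine ⟨R, hR1.trans h2, fun x hx => ?_⟩
  obtain ⟨f, hfx, c, g, hc, hg, hcn, hgn, hp, hS⟩ := exists_slice s hs Y x hx
  obtain ⟨y, hy, e⟩ := hR2 f ⟨(c, g), by
    rw [hI, Finset.mem_filter, Finset.mem_product, Finset.mem_Icc, Finset.mem_Icc]
    exact ⟨⟨⟨hc, hcn⟩, hg, hgn⟩, hp⟩, hS⟩
  exact ⟨y, hy, e.trans hfx.toG⟩

end CubicCount

namespace CubicCount

lemma field_root {F : Type*} [Field F] (h2 : (2 : F) ≠ 0) (h3 : (3 : F) ≠ 0) (a b c d : F)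
    (hab : ¬ (a = 0 ∧ b = 0))
    (hD : b ^ 2 * c ^ 2 + 18 * a * b * c * d - 4 * a * c ^ 3 - 4 * b ^ 3 * d - 27 * a ^ 2 * d ^ 2 = 0) :
    ∃ t : F, a * t ^ 3 + b * t ^ 2 + c * t + d = 0 ∧ 3 * a * t ^ 2 + 2 * b * t + c = 0 := by
  by_cases ha : a = 0
  · subst ha
    have hb : b ≠ 0 := fun h => hab ⟨rfl, h⟩
    have hc : c ^ 2 = 4 * b * d := by
      have : b ^ 2 * (c ^ 2 - 4 * b * d) = 0 := by linear_combination hD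
      rcases mul_eq_zero.1 this with h | h
      · exact absurd (pow_eq_zero_iff (two_ne_zero) |>.1 h) hb
      · linear_combination h
    have hb2 : 2 * b ≠ 0 := mul_ne_zero h2 hb
    have ht : 2 * b * (-c / (2 * b)) = -c := mul_div_cancel₀ _ hb2
    set t := -c / (2 * b)
    refine ⟨t, ?_, by linear_combination ht⟩
    have : (2 * b) ^ 2 * (0 * t ^ 3 + b * t ^ 2 + c * t + d) = 0 := by
      linear_combination (b * (2 * b * t - c) + 2 * b * c) * ht - b * hc
    exact (mul_eq_zero.1 this).resolve_left (pow_ne_zero _ hb2)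
  · by_cases hA : b ^ 2 - 3 * a * c = 0
    · have hB : b * c - 9 * a * d = 0 := by
        have : (b * c - 9 * a * d) ^ 2 = 0 := by
          linear_combination 4 * (c ^ 2 - 3 * b * d) * hA - 3 * hD
        exact pow_eq_zero_iff (two_ne_zero) |>.1 this
      have ha3 : 3 * a ≠ 0 := mul_ne_zero h3 ha
      have ht : 3 * a * (-b / (3 * a)) = -b := mul_div_cancel₀ _ ha3
      set t := -b / (3 * a)
      refine ⟨t, ?_, ?_⟩
      · have e : (3 * a) ^ 3 * (a * t ^ 3 + b * t ^ 2 + c * t + d) =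
            a * (3 * a * t) ^ 3 + 3 * a * b * (3 * a * t) ^ 2 + (3 * a) ^ 2 * c * (3 * a * t) + (3 * a) ^ 3 * d := by ring
        have : (3 * a) ^ 3 * (a * t ^ 3 + b * t ^ 2 + c * t + d) = 0 := by
          rw [e, ht]; linear_combination 2 * a * b * hA - 3 * a ^ 2 * hB
        exact (mul_eq_zero.1 this).resolve_left (pow_ne_zero _ ha3)
      · have e : (3 * a) * (3 * a * t ^ 2 + 2 * b * t + c) =
            (3 * a * t) ^ 2 + 2 * b * (3 * a * t) + 3 * a * c := by ring
        have : (3 * a) * (3 * a * t ^ 2 + 2 * b * t + c) = 0 := by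
          rw [e, ht]; linear_combination -hA
        exact (mul_eq_zero.1 this).resolve_left ha3
    · set A := b ^ 2 - 3 * a * c with hAd
      have hA2 : 2 * A ≠ 0 := mul_ne_zero h2 hA
      have ht : 2 * A * (-(b * c - 9 * a * d) / (2 * A)) = -(b * c - 9 * a * d) := mul_div_cancel₀ _ hA2
      set t := -(b * c - 9 * a * d) / (2 * A)
      refine ⟨t, ?_, ?_⟩
      · have e : (2 * A) ^ 3 * (a * t ^ 3 + b * t ^ 2 + c * t + d) =
            a * (2 * A * t) ^ 3 + (2 * A) * b * (2 * A * t) ^ 2 + (2 * A) ^ 2 * c * (2 * A * t) + (2 * A) ^ 3 * d := by ring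
        have : (2 * A) ^ 3 * (a * t ^ 3 + b * t ^ 2 + c * t + d) = 0 := by
          rw [e, ht, hAd]; linear_combination -(2 * b ^ 3 - 9 * a * b * c + 27 * a ^ 2 * d) * hD
        exact (mul_eq_zero.1 this).resolve_left (pow_ne_zero _ hA2)
      · have e : (2 * A) ^ 2 * (3 * a * t ^ 2 + 2 * b * t + c) =
            3 * a * (2 * A * t) ^ 2 + 2 * b * (2 * A) * (2 * A * t) + (2 * A) ^ 2 * c := by ring
        have : (2 * A) ^ 2 * (3 * a * t ^ 2 + 2 * b * t + c) = 0 := by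
          rw [e, ht, hAd]; linear_combination -9 * a * hD
        exact (mul_eq_zero.1 this).resolve_left (pow_ne_zero _ hA2)

lemma zmod_ne {p : ℕ} (h5 : 5 ≤ p) (n : ℕ) (hn : 0 < n) (h : n < 5) : ((n : ℕ) : ZMod p) ≠ 0 := by
  rw [Ne, ZMod.natCast_eq_zero_iff]
  intro hd
  have := Nat.le_of_dvd hn hd
  omega

lemma dbl_root {p : ℕ} (hp : p.Prime) (h5 : 5 ≤ p) (x : V) (hD : (p : ℤ) ∣ cubicDisc x) :
    ∃ y, SEqv x y ∧ (p : ℤ) ∣ y 0 ∧ (p : ℤ) ∣ y 1 := by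
  have := Fact.mk hp
  by_cases hab : (p : ℤ) ∣ x 0 ∧ (p : ℤ) ∣ x 1
  · exact ⟨x, SEqv.refl x, hab⟩
  have h2 : (2 : ZMod p) ≠ 0 := by exact_mod_cast zmod_ne h5 2 (by norm_num) (by norm_num)
  have h3 : (3 : ZMod p) ≠ 0 := by exact_mod_cast zmod_ne h5 3 (by norm_num) (by norm_num)
  rw [← ZMod.intCast_zmod_eq_zero_iff_dvd, ← ZMod.intCast_zmod_eq_zero_iff_dvd] at hab
  rw [← ZMod.intCast_zmod_eq_zero_iff_dvd, cubicDisc] at hD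
  push_cast at hD
  obtain ⟨t, e1, e2⟩ := field_root h2 h3 _ _ _ _ hab hD
  obtain ⟨t, rfl⟩ := ZMod.intCast_surjective t
  refine ⟨cubicAct !![t, 1; -1, 0] x, ⟨_, by simp [Matrix.det_fin_two], rfl⟩, ?_, ?_⟩
  · rw [← ZMod.intCast_zmod_eq_zero_iff_dvd, act0]
    simp
    linear_combination e1
  · rw [← ZMod.intCast_zmod_eq_zero_iff_dvd, act1]
    simp
    linear_combination -e2

lemma trichotomy {p : ℕ} (hp : p.Prime) (h5 : 5 ≤ p) (x : V) (hD : (p : ℤ) ^ 2 ∣ cubicDisc x) :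
    ∃ y, SEqv x y ∧ (((p : ℤ) ^ 2 ∣ y 0 ∧ (p : ℤ) ∣ y 1) ∨ (∃ z : V, y = (p : ℤ) • z) ∨
      (HD p y ∧ ¬ HD ((p : ℤ) ^ 2) y)) := by
  obtain ⟨y, hxy, h0, h1⟩ := dbl_root hp h5 x (dvd_trans (dvd_pow_self _ two_ne_zero) hD)
  refine ⟨y, hxy, ?_⟩
  have hpz : Prime (p : ℤ) := Nat.prime_iff_prime_int.1 hp
  have hn : ∀ n : ℕ, 0 < n → n < 5 → ¬ (p : ℤ) ∣ n := by
    intro n h1 h2 h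
    have := Nat.le_of_dvd h1 (by exact_mod_cast h)
    omega
  have hn2 := hn 2 (by norm_num) (by norm_num)
  have hn3 := hn 3 (by norm_num) (by norm_num)
  push_cast at hn2 hn3
  by_cases ha : (p : ℤ) ^ 2 ∣ y 0
  · exact Or.inl ⟨ha, h1⟩
  right
  obtain ⟨a, ha'⟩ := h0
  obtain ⟨b, hb'⟩ := h1
  have hpa : ¬ (p : ℤ) ∣ a := by
    rintro ⟨k, rfl⟩; exact ha ⟨k, by rw [ha']; ring⟩
  have hp0 : (p : ℤ) ≠ 0 := hpz.ne_zero
  have hc : (p : ℤ) ∣ y 2 := by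
    rw [← hxy.disc, cubicDisc, ha', hb'] at hD
    have h4 : (p : ℤ) ^ 2 ∣ (p : ℤ) * (4 * a * y 2 ^ 3) := by
      have : (p : ℤ) * (4 * a * y 2 ^ 3) = (p : ℤ) ^ 2 * (b ^ 2 * y 2 ^ 2 + 18 * a * b * y 2 * y 3 - 4 * p * b ^ 3 * y 3 - 27 * a ^ 2 * y 3 ^ 2) - ((↑p * b) ^ 2 * y 2 ^ 2 + 18 * (↑p * a) * (↑p * b) * y 2 * y 3 - 4 * (↑p * a) * y 2 ^ 3 - 4 * (↑p * b) ^ 3 * y 3 -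
    27 * (↑p * a) ^ 2 * y 3 ^ 2) := by ring
      rw [this]
      exact dvd_sub (dvd_mul_right _ _) hD
    rw [pow_two] at h4
    have h6 := (mul_dvd_mul_iff_left hp0).1 h4
    rcases hpz.dvd_or_dvd h6 with h | h
    · rcases hpz.dvd_or_dvd h with h | h
      · rw [show (4 : ℤ) = 2 * 2 by norm_num] at h
        rcases hpz.dvd_or_dvd h with h | h <;> exact absurd h hn2
      · exact absurd h hpa
    · exact hpz.dvd_of_dvd_pow h
  obtain ⟨c, hc'⟩ := hc
  by_cases hd : (p : ℤ) ∣ y 3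
  · left
    obtain ⟨d, hd'⟩ := hd
    exact ⟨![a, b, c, d], V_ext ha' hb' hc' hd'⟩
  · right
    refine ⟨⟨?_, ?_, ?_⟩, ?_⟩
    · rw [hA, ha', hb', hc']; exact ⟨p * b ^ 2 - 3 * a * p * c, by ring⟩
    · rw [hB, ha', hb', hc']; exact ⟨b * p * c - 9 * a * y 3, by ring⟩
    · rw [hC, hb', hc']; exact ⟨p * c ^ 2 - 3 * b * y 3, by ring⟩
    · rintro ⟨-, h, -⟩
      rw [hB, ha', hb', hc'] at h
      have h4 : (p : ℤ) * p ∣ p * (9 * (a * y 3)) := by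
        have : (p : ℤ) * (9 * (a * y 3)) = (p : ℤ) * p * (b * c) - (↑p * b * (↑p * c) - 9 * (↑p * a) * y 3) := by ring
        rw [this]
        rw [pow_two] at h
        exact dvd_sub (dvd_mul_right _ _) h
      have h6 := (mul_dvd_mul_iff_left hp0).1 h4
      rcases hpz.dvd_or_dvd h6 with h | h
      · rw [show (9 : ℤ) = 3 * 3 by norm_num] at h
        rcases hpz.dvd_or_dvd h with h | h <;> exact hn3 h
      · rcases hpz.dvd_or_dvd h with h | h
        · exact hpa h
        · exact hd h

/-- Hermite representatives of matrices of determinant `p` -/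
def Mt (p t : ℕ) : M2 := if t < p then !![(p : ℤ), 0; (t : ℤ), 1] else !![1, 0; 0, (p : ℤ)]

lemma exists_t {p : ℕ} (hp : p.Prime) (u v : ℤ) (hv : ¬ (p : ℤ) ∣ v) : ∃ t : ℕ, t < p ∧ (p : ℤ) ∣ u - t * v := by
  have := Fact.mk hp
  rw [← ZMod.intCast_zmod_eq_zero_iff_dvd] at hv
  refine ⟨((u : ZMod p) / v).val, ZMod.val_lt _, ?_⟩
  rw [← ZMod.intCast_zmod_eq_zero_iff_dvd]
  push_cast
  rw [ZMod.natCast_zmod_val, div_mul_cancel₀ _ hv, sub_self]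

lemma isUnit_of_mul {p : ℕ} (hp : p.Prime) {m n : ℤ} (h : n = m * p) (hn : n = p ∨ n = -p) : IsUnit m := by
  have hp0 : (p : ℤ) ≠ 0 := by exact_mod_cast hp.ne_zero
  rw [Int.isUnit_iff]
  rcases hn with h1 | h1
  · left; apply mul_right_cancel₀ hp0; linarith
  · right; apply mul_right_cancel₀ hp0; linarith

lemma hermite {p : ℕ} (hp : p.Prime) (N : M2) (hN : N.det = p ∨ N.det = -p) :
    ∃ t ∈ Finset.range (p + 1), ∃ δ : M2, IsUnit δ.det ∧ N = δ * Mt p t := by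
  have hpz : Prime (p : ℤ) := Nat.prime_iff_prime_int.1 hp
  have hdvd : (p : ℤ) ∣ N 0 0 * N 1 1 - N 0 1 * N 1 0 := by
    rw [← Matrix.det_fin_two]
    rcases hN with h | h <;> rw [h]
    exact (dvd_neg.2 dvd_rfl)
  by_cases h01 : (p : ℤ) ∣ N 0 1 ∧ (p : ℤ) ∣ N 1 1
  · obtain ⟨⟨a, ha⟩, ⟨b, hb⟩⟩ := h01
    refine ⟨p, by simp, !![N 0 0, a; N 1 0, b], ?_, ?_⟩
    · refine isUnit_of_mul hp (n := N.det) ?_ hN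
      simp [Matrix.det_fin_two, ha, hb]; ring
    · ext i j
      fin_cases i <;> fin_cases j <;> simp [Mt, Matrix.mul_apply, ha, hb, mul_comm]
  · have key : ∃ t : ℕ, t < p ∧ (p : ℤ) ∣ N 0 0 - t * N 0 1 ∧ (p : ℤ) ∣ N 1 0 - t * N 1 1 := by
      by_cases h : (p : ℤ) ∣ N 0 1
      · have h1 : ¬ (p : ℤ) ∣ N 1 1 := fun h' => h01 ⟨h, h'⟩
        obtain ⟨t, ht, htd⟩ := exists_t hp (N 1 0) (N 1 1) h1
        refine ⟨t, ht, ?_, htd⟩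
        have : (p : ℤ) ∣ N 1 1 * (N 0 0 - t * N 0 1) := by
          have e : N 1 1 * (N 0 0 - t * N 0 1) = (N 0 0 * N 1 1 - N 0 1 * N 1 0) + N 0 1 * (N 1 0 - t * N 1 1) := by ring
          rw [e]; exact dvd_add hdvd (htd.mul_left _)
        exact (hpz.dvd_or_dvd this).resolve_left h1
      · obtain ⟨t, ht, htd⟩ := exists_t hp (N 0 0) (N 0 1) h
        refine ⟨t, ht, htd, ?_⟩
        have : (p : ℤ) ∣ N 0 1 * (N 1 0 - t * N 1 1) := by
          have e : N 0 1 * (N 1 0 - t * N 1 1) = N 1 1 * (N 0 0 - t * N 0 1) - (N 0 0 * N 1 1 - N 0 1 * N 1 0) := by ring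
          rw [e]; exact dvd_sub (htd.mul_left _) hdvd
        exact (hpz.dvd_or_dvd this).resolve_left h
    obtain ⟨t, ht, ⟨a, ha⟩, ⟨b, hb⟩⟩ := key
    refine ⟨t, by simp; omega, !![a, N 0 1; b, N 1 1], ?_, ?_⟩
    · refine isUnit_of_mul hp (n := N.det) ?_ hN
      simp [Matrix.det_fin_two]; linear_combination N 1 1 * ha - N 0 1 * hb
    · ext i j
      fin_cases i <;> fin_cases j <;> simp [Mt, Matrix.mul_apply, ht]
      · linear_combination ha
      · linear_combination hb

def PDvd (p : ℕ) (x : V) : Prop := ∃ z : V, x = (p : ℤ) • z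

lemma pdvd_iff {p : ℕ} {x : V} : PDvd p x ↔ (p : ℤ) ∣ x 0 ∧ (p : ℤ) ∣ x 1 ∧ (p : ℤ) ∣ x 2 ∧ (p : ℤ) ∣ x 3 := by
  constructor
  · rintro ⟨z, rfl⟩
    refine ⟨?_, ?_, ?_, ?_⟩ <;> exact dvd_mul_right _ _
  · rintro ⟨⟨a, h0⟩, ⟨b, h1⟩, ⟨c, h2⟩, ⟨d, h3⟩⟩
    exact ⟨![a, b, c, d], V_ext h0 h1 h2 h3⟩

open Polynomial in
lemma card_roots {p : ℕ} (hp : p.Prime) (x : V) (hx : ¬ PDvd p x) (T : Finset ℕ)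
    (hT : ∀ t ∈ T, t ∈ Finset.range (p + 1) ∧ PDvd p (cubicAct (Mt p t) x)) : T.card ≤ 3 := by
  classical
  have := Fact.mk hp
  set f : (ZMod p)[X] := C (x 0 : ZMod p) * X ^ 3 + C (x 1 : ZMod p) * X ^ 2 + C (x 2 : ZMod p) * X + C (x 3 : ZMod p) with hf
  have hf0 : f ≠ 0 := by
    intro h
    apply hx
    rw [pdvd_iff]
    simp only [← ZMod.intCast_zmod_eq_zero_iff_dvd]
    have e0 : f.coeff 0 = 0 := by rw [h]; simp
    have e1 : f.coeff 1 = 0 := by rw [h]; simp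
    have e2 : f.coeff 2 = 0 := by rw [h]; simp
    have e3 : f.coeff 3 = 0 := by rw [h]; simp
    rw [hf] at e0 e1 e2 e3
    simp only [coeff_add, coeff_C_mul, coeff_X, coeff_C, coeff_X_pow] at e0 e1 e2 e3
    norm_num at e0 e1 e2 e3
    exact ⟨e3, e2, e1, e0⟩
  have h1 : (T.filter (fun t => t < p)).card ≤ f.natDegree := by
    calc _ = ((T.filter (fun t => t < p)).image (fun t : ℕ => (t : ZMod p))).card := by
          rw [Finset.card_image_of_injOn]
          intro a ha b hb hab
          simp only [Finset.coe_filter, Set.mem_ofPred_eq] at ha hb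
          simp only at hab
          rw [ZMod.natCast_eq_natCast_iff'] at hab
          rwa [Nat.mod_eq_of_lt ha.2, Nat.mod_eq_of_lt hb.2] at hab
      _ ≤ f.roots.toFinset.card := by
          apply Finset.card_le_card
          intro s hs
          rw [Finset.mem_image] at hs
          obtain ⟨t, ht, rfl⟩ := hs
          rw [Finset.mem_filter] at ht
          rw [Multiset.mem_toFinset, mem_roots hf0, IsRoot.def]
          have h2 := (pdvd_iff.1 (hT t ht.1).2).2.2.2
          rw [act3, Mt, if_pos ht.2, ← ZMod.intCast_zmod_eq_zero_iff_dvd] at h2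
          simp at h2
          simp [hf]; exact h2
      _ ≤ Multiset.card f.roots := Multiset.toFinset_card_le _
      _ ≤ f.natDegree := card_roots' _
  have h2 : T ⊆ insert p (T.filter (fun t => t < p)) := by
    intro t ht
    have := (hT t ht).1
    rw [Finset.mem_range] at this
    rw [Finset.mem_insert, Finset.mem_filter]
    by_cases h : t < p
    · right; exact ⟨ht, h⟩
    · left; omega
  by_cases hpT : p ∈ T
  · have h3 := (pdvd_iff.1 (hT p hpT).2).1
    rw [act0, Mt, if_neg (lt_irrefl _), ← ZMod.intCast_zmod_eq_zero_iff_dvd] at h3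
    simp at h3
    have h4 : f.natDegree ≤ 2 := by
      rw [hf, h3, C_0, zero_mul, zero_add]; exact natDegree_quadratic_le
    have h5 := (Finset.card_le_card h2).trans (Finset.card_insert_le _ _)
    omega
  · have h4 : f.natDegree ≤ 3 := natDegree_cubic_le
    have h5 : T ⊆ T.filter (fun t => t < p) := by
      intro t ht
      rcases Finset.mem_insert.1 (h2 ht) with rfl | h
      · exact absurd ht hpT
      · exact h
    have := Finset.card_le_card h5
    omega

end CubicCount

namespace CubicCount

lemma GEqv.smul {x y : V} (h : GEqv x y) (c : ℤ) : GEqv (c • x) (c • y) := by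
  obtain ⟨g, hg, rfl⟩ := h
  exact ⟨g, hg, (act_smul _ _ _).symm⟩

lemma Pred.congr {s1 s2 : Finset ℕ} {Y : ℝ} {x y : V} (h : SEqv x y) (hx : Pred s1 s2 Y x) : Pred s1 s2 Y y := by
  obtain ⟨h1, h2, h3, h4⟩ := hx
  have hD := h.disc
  refine ⟨by rwa [hD], by rwa [hD], by rwa [hD], fun p hp => ?_⟩
  rw [← h.HD_iff, ← h.HD_iff]; exact h4 p hp

lemma Pred.down {s1 s2 : Finset ℕ} {Y : ℝ} {x z : V} {p k : ℕ} (hp : p.Prime) (hs1 : ∀ q ∈ s1, q.Prime)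
    (hs2 : ∀ q ∈ s2, q.Prime) (h1 : p ∉ s1) (h2 : p ∉ s2) (hD : cubicDisc x = (p : ℤ) ^ k * cubicDisc z)
    (hH : ∀ n : ℤ, IsCoprime n (p : ℤ) → (HD n x ↔ HD n z)) (hx : Pred s1 s2 Y x) : Pred s1 s2 (Y / (p : ℝ) ^ k) z := by
  obtain ⟨h3, h4, h5, h6⟩ := hx
  have hp0 : (0 : ℝ) < p := by exact_mod_cast hp.pos
  have hcop : ∀ q : ℕ, q.Prime → q ≠ p → IsCoprime (q : ℤ) (p : ℤ) := fun q hq hqp =>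
    Nat.isCoprime_iff_coprime.2 ((Nat.coprime_primes hq hp).2 hqp)
  refine ⟨?_, ?_, ?_, ?_⟩
  · rintro h; rw [h, mul_zero] at hD; exact h3 hD
  · rw [lt_div_iff₀ (by positivity)]
    rw [hD, abs_mul, abs_pow] at h4
    push_cast at h4 ⊢
    rw [abs_of_pos hp0] at h4
    linarith
  · intro q hq
    have h7 := h5 q hq
    rw [hD] at h7
    exact ((hcop q (hs1 q hq) (by rintro rfl; exact h1 hq)).pow (m := 2) (n := k)).dvd_of_dvd_mul_left h7
  · intro q hq
    have hc := hcop q (hs2 q hq) (by rintro rfl; exact h2 hq)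
    rw [← hH _ hc, ← hH _ (hc.pow_left)]
    exact h6 q hq

lemma covA {Q : V → Prop} {N : ℝ} (p : ℕ) (h : GCov Q N) :
    GCov (fun x => ∃ z, GEqv ((p : ℤ) • z) x ∧ Q z) N := by
  classical
  obtain ⟨R, h1, h2⟩ := h
  refine ⟨R.image (fun z => (p : ℤ) • z), le_trans (by exact_mod_cast Finset.card_image_le) h1, ?_⟩
  rintro x ⟨z, hz, hQ⟩
  obtain ⟨y, hy, e⟩ := h2 z hQ
  exact ⟨_, Finset.mem_image_of_mem _ hy, (e.smul p).trans hz⟩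

def dg (p : ℕ) : M2 := !![(p : ℤ), 0; 0, 1]

lemma dg_hermite {p : ℕ} (hp : p.Prime) {γ : M2} (hγ : IsUnit γ.det) :
    ∃ t ∈ Finset.range (p + 1), ∃ δ : M2, IsUnit δ.det ∧ dg p * γ = δ * Mt p t := by
  apply hermite hp
  have h1 : (dg p).det = p := by simp [dg, Matrix.det_fin_two]
  rw [Matrix.det_mul, h1]
  rcases Int.isUnit_iff.1 hγ with h | h <;> rw [h]
  · left; ring
  · right; ring

lemma covN2 {Q : V → Prop} {N : ℝ} {p : ℕ} (hp : p.Prime) (h : GCov Q N) :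
    GCov (fun x => ∃ g, GEqv (cubicAct (dg p) g) x ∧ Q g) ((p + 1) * N) := by
  classical
  obtain ⟨R, h1, h2⟩ := h
  refine ⟨(R ×ˢ Finset.range (p + 1)).image (fun i => cubicAct (Mt p i.2) i.1), ?_, ?_⟩
  · calc _ ≤ (((R ×ˢ Finset.range (p + 1)).card : ℕ) : ℝ) := by exact_mod_cast Finset.card_image_le
      _ = (p + 1) * R.card := by rw [Finset.card_product, Finset.card_range]; push_cast; ring
      _ ≤ _ := by gcongr
  · rintro x ⟨g, hg, hQ⟩
    obtain ⟨y, hy, γ, hγ, rfl⟩ := h2 g hQ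
    obtain ⟨t, ht, δ, hδ, e⟩ := dg_hermite hp hγ
    refine ⟨_, Finset.mem_image_of_mem _ (Finset.mk_mem_product hy ht), ?_⟩
    refine GEqv.trans ⟨δ, hδ, ?_⟩ hg
    rw [act_mul, act_mul, e]

lemma covN1 {Q : V → Prop} {N : ℝ} {p : ℕ} (hp : p.Prime) (h : GCov Q N) :
    GCov (fun x => ∃ y g, GEqv y x ∧ (p : ℤ) • y = cubicAct (dg p) g ∧ ¬ PDvd p g ∧ Q g) (3 * N) := by
  classical
  have hp0 : (p : ℤ) ≠ 0 := by exact_mod_cast hp.ne_zero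
  obtain ⟨R, h1, h2⟩ := h
  set T : V → Finset ℕ := fun x => (Finset.range (p + 1)).filter (fun t => PDvd p (cubicAct (Mt p t) x)) with hT
  refine ⟨((R.filter (fun x => ¬ PDvd p x)).sigma T).image
    (fun i => if h : PDvd p (cubicAct (Mt p i.2) i.1) then h.choose else 0), ?_, ?_⟩
  · calc _ ≤ ((((R.filter (fun x => ¬ PDvd p x)).sigma T).card : ℕ) : ℝ) := by exact_mod_cast Finset.card_image_le
      _ = ∑ x ∈ R.filter (fun x => ¬ PDvd p x), ((T x).card : ℝ) := by rw [Finset.card_sigma]; push_cast; rfl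
      _ ≤ ∑ x ∈ R.filter (fun x => ¬ PDvd p x), (3 : ℝ) := by
          apply Finset.sum_le_sum
          intro x hx
          rw [Finset.mem_filter] at hx
          have := card_roots hp x hx.2 (T x) (by intro t ht; simpa [hT] using ht)
          exact_mod_cast this
      _ = ((R.filter (fun x => ¬ PDvd p x)).card : ℝ) * 3 := by rw [Finset.sum_const, nsmul_eq_mul]
      _ ≤ (R.card : ℝ) * 3 := by
          gcongr; exact Finset.filter_subset _ _
      _ ≤ _ := by linarith
  · rintro x ⟨y, g, hy, hyg, hpg, hQ⟩
    obtain ⟨ρ, hρ, γ, hγ, rfl⟩ := h2 g hQ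
    obtain ⟨t, ht, δ, hδ, e⟩ := dg_hermite hp hγ
    have hρp : ¬ PDvd p ρ := by
      rintro ⟨z, rfl⟩
      exact hpg ⟨cubicAct γ z, act_smul _ _ _⟩
    rw [act_mul, e, ← act_mul] at hyg
    have hdv : PDvd p (cubicAct (Mt p t) ρ) := by
      have : cubicAct (Mt p t) ρ = cubicAct δ⁻¹ ((p : ℤ) • y) := by
        rw [hyg, act_mul, Matrix.nonsing_inv_mul _ hδ, act_one]
      rw [this, act_smul]
      exact ⟨_, rfl⟩
    refine ⟨_, Finset.mem_image_of_mem _ (Finset.mem_sigma.2 (show (⟨ρ, t⟩ : (_ : V) × ℕ).1 ∈ _ ∧ _ from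
      ⟨Finset.mem_filter.2 ⟨hρ, hρp⟩, Finset.mem_filter.2 ⟨ht, hdv⟩⟩)), ?_⟩
    simp only [hdv, dite_true]
    refine GEqv.trans ⟨δ, hδ, ?_⟩ hy
    have h3 := hdv.choose_spec
    rw [h3, act_smul] at hyg
    exact smul_right_injective V hp0 hyg

lemma dvd_cop {n q a : ℤ} (h : IsCoprime n q) : n ∣ q * a ↔ n ∣ a :=
  ⟨fun h' => h.dvd_of_dvd_mul_left h', fun h' => h'.mul_left _⟩

lemma HD_smul {n q : ℤ} (h : IsCoprime n q) (z : V) : HD n (q • z) ↔ HD n z := by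
  have h2 := h.pow_right (n := 2)
  have e1 : hA (q • z) = q ^ 2 * hA z := by simp [hA]; ring
  have e2 : hB (q • z) = q ^ 2 * hB z := by simp [hB]; ring
  have e3 : hC (q • z) = q ^ 2 * hC z := by simp [hC]; ring
  rw [HD, HD, e1, e2, e3, dvd_cop h2, dvd_cop h2, dvd_cop h2]

lemma HD_dg {n : ℤ} {p : ℕ} (h : IsCoprime n (p : ℤ)) (z : V) : HD n (cubicAct (dg p) z) ↔ HD n z := by
  have e1 : hA (cubicAct (dg p) z) = (p : ℤ) ^ 4 * hA z := by rw [hA_act]; simp [dg, Matrix.det_fin_two]; ring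
  have e2 : hB (cubicAct (dg p) z) = (p : ℤ) ^ 3 * hB z := by rw [hB_act]; simp [dg, Matrix.det_fin_two]; ring
  have e3 : hC (cubicAct (dg p) z) = (p : ℤ) ^ 2 * hC z := by rw [hC_act]; simp [dg, Matrix.det_fin_two]
  rw [HD, HD, e1, e2, e3, dvd_cop h.pow_right, dvd_cop h.pow_right, dvd_cop h.pow_right]

lemma step_cases {s1 s2 : Finset ℕ} {Y : ℝ} {x : V} {p : ℕ} (hp : p.Prime) (h5 : 5 ≤ p) (hs1 : ∀ q ∈ s1, q.Prime)
    (hs2 : ∀ q ∈ s2, q.Prime) (h1 : p ∉ s1) (h2 : p ∉ s2) (hx : Pred (insert p s1) s2 Y x) :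
    (((∃ y, GEqv y x ∧ Pred s1 (insert p s2) Y y) ∨ (∃ z, GEqv ((p : ℤ) • z) x ∧ Pred s1 s2 (Y / (p : ℝ) ^ 4) z)) ∨
    (∃ y g, GEqv y x ∧ (p : ℤ) • y = cubicAct (dg p) g ∧ ¬ PDvd p g ∧ Pred s1 s2 (Y / (p : ℝ) ^ 2) g)) ∨
    (∃ g, GEqv (cubicAct (dg p) g) x ∧ Pred s1 s2 (Y / (p : ℝ) ^ 6) g) := by
  have hp0 : (p : ℤ) ≠ 0 := by exact_mod_cast hp.ne_zero
  obtain ⟨hx1, hx2, hx3, hx4⟩ := hx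
  have hx' : Pred s1 s2 Y x := ⟨hx1, hx2, fun q hq => hx3 q (Finset.mem_insert_of_mem hq), hx4⟩
  obtain ⟨y, hxy, h⟩ := trichotomy hp h5 x (hx3 p (Finset.mem_insert_self _ _))
  have hy := hx'.congr hxy
  have hyx := hxy.symm.toG
  have hdet : (dg p).det = p := by simp [dg, Matrix.det_fin_two]
  rcases h with ⟨h0, h1'⟩ | ⟨z, rfl⟩ | ⟨h3, h4⟩
  · obtain ⟨a, ha⟩ := h0
    obtain ⟨b, hb⟩ := h1'
    have key : (p : ℤ) • y = cubicAct (dg p) ![a, b, y 2, p * y 3] := by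
      apply V_ext
      · rw [act0]; simp [dg, ha]; ring
      · rw [act1]; simp [dg, hb]; ring
      · rw [act2]; simp [dg]; ring
      · rw [act3]; simp [dg]
    set g : V := ![a, b, y 2, p * y 3] with hg
    by_cases hpg : PDvd p g
    · right
      obtain ⟨z, hz⟩ := hpg
      rw [hz, act_smul] at key
      have hyz := smul_right_injective V hp0 key
      refine ⟨z, by rw [← hyz]; exact hyx, ?_⟩
      refine hy.down hp hs1 hs2 h1 h2 ?_ (fun n hn => ?_)
      · rw [hyz, disc_act, hdet]
      · rw [hyz]; exact HD_dg hn z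
    · left; right
      refine ⟨y, g, hyx, key, hpg, ?_⟩
      refine hy.down hp hs1 hs2 h1 h2 ?_ (fun n hn => ?_)
      · have := congrArg cubicDisc key
        rw [disc_smul, disc_act, hdet] at this
        apply mul_left_cancel₀ (pow_ne_zero 4 hp0)
        rw [this]; ring
      · rw [← HD_smul hn y, key, HD_dg hn]
  · left; left; right
    refine ⟨z, hyx, hy.down hp hs1 hs2 h1 h2 (disc_smul _ _) (fun n hn => HD_smul hn z)⟩
  · left; left; left
    refine ⟨y, hyx, hy.1, hy.2.1, hy.2.2.1, ?_⟩
    intro q hq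
    rcases Finset.mem_insert.1 hq with rfl | hq
    · exact ⟨h3, h4⟩
    · exact hy.2.2.2 q hq

lemma GCov.eqv {Q : V → Prop} {N : ℝ} (h : GCov Q N) : GCov (fun x => ∃ y, GEqv y x ∧ Q y) N := by
  obtain ⟨R, h1, h2⟩ := h
  refine ⟨R, h1, ?_⟩
  rintro x ⟨y, hy, hQ⟩
  obtain ⟨z, hz, e⟩ := h2 y hQ
  exact ⟨z, hz, e.trans hy⟩

lemma main_cov (M : ℝ) (hM0 : 0 < M) (hM : ∀ s : Finset ℕ, (∀ p ∈ s, p.Prime) → ∀ Y : ℝ, 0 < Y →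
      GCov (Pred ∅ s Y) (M * 2 ^ s.card * Y / (((∏ p ∈ s, p : ℕ) : ℝ)) ^ 2)) (s1 : Finset ℕ) :
    (∀ p ∈ s1, p.Prime ∧ 5 ≤ p) → ∀ s2 : Finset ℕ, (∀ p ∈ s2, p.Prime) → Disjoint s1 s2 → ∀ Y : ℝ, 0 < Y →
      GCov (Pred s1 s2 Y) (M * 6 ^ s1.card * 2 ^ s2.card * Y / ((((∏ p ∈ s1, p : ℕ) : ℝ)) * (((∏ p ∈ s2, p : ℕ) : ℝ))) ^ 2) := by
  classical
  induction s1 using Finset.induction_on with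
  | empty =>
    intro _ s2 hs2 _ Y hY
    simpa using hM s2 hs2 Y hY
  | insert p s1 hps1 ih =>
    intro hs1 s2 hs2 hdis Y hY
    have hpp := (hs1 p (Finset.mem_insert_self _ _)).1
    have hp5 := (hs1 p (Finset.mem_insert_self _ _)).2
    rw [Finset.disjoint_insert_left] at hdis
    have hs1' : ∀ q ∈ s1, q.Prime ∧ 5 ≤ q := fun q hq => hs1 q (Finset.mem_insert_of_mem hq)
    have hp0 : (5 : ℝ) ≤ p := by exact_mod_cast hp5
    have hppos : (0 : ℝ) < p := by linarith
    have c1 := (ih hs1' (insert p s2) (by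
      intro q hq
      rcases Finset.mem_insert.1 hq with rfl | hq
      · exact hpp
      · exact hs2 q hq) (Finset.disjoint_insert_right.2 ⟨hps1, hdis.2⟩) Y hY).eqv
    have c2 := covA p (ih hs1' s2 hs2 hdis.2 (Y / (p : ℝ) ^ 4) (by positivity))
    have c3 := covN1 hpp (ih hs1' s2 hs2 hdis.2 (Y / (p : ℝ) ^ 2) (by positivity))
    have c4 := covN2 hpp (ih hs1' s2 hs2 hdis.2 (Y / (p : ℝ) ^ 6) (by positivity))
    refine (((c1.or c2).or c3).or c4).mono (fun x hx =>
      step_cases hpp hp5 (fun q hq => (hs1' q hq).1) hs2 hps1 hdis.1 hx) ?_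
    rw [Finset.prod_insert hps1, Finset.card_insert_of_notMem hps1, Finset.prod_insert hdis.1,
      Finset.card_insert_of_notMem hdis.1]
    push_cast
    have hq1 : (0 : ℝ) < ∏ q ∈ s1, (q : ℝ) := Finset.prod_pos (fun q hq => by exact_mod_cast (hs1' q hq).1.pos)
    have hq2 : (0 : ℝ) < ∏ q ∈ s2, (q : ℝ) := Finset.prod_pos (fun q hq => by exact_mod_cast (hs2 q hq).pos)
    set a := ∏ q ∈ s1, (q : ℝ)
    set b := ∏ q ∈ s2, (q : ℝ)
    set E : ℝ := M * 6 ^ s1.card * 2 ^ s2.card * Y / (a * b) ^ 2 with hE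
    have hE0 : 0 < E := by positivity
    have e1 : M * 6 ^ s1.card * 2 ^ (s2.card + 1) * Y / (a * (↑p * b)) ^ 2 = E * (2 / (p : ℝ) ^ 2) := by
      rw [hE]; field_simp; ring
    have e2 : M * 6 ^ s1.card * 2 ^ s2.card * (Y / ↑p ^ 4) / (a * b) ^ 2 = E * (1 / (p : ℝ) ^ 4) := by
      rw [hE]; field_simp
    have e3 : M * 6 ^ s1.card * 2 ^ s2.card * (Y / ↑p ^ 2) / (a * b) ^ 2 = E * (1 / (p : ℝ) ^ 2) := by
      rw [hE]; field_simp
    have e4 : M * 6 ^ s1.card * 2 ^ s2.card * (Y / ↑p ^ 6) / (a * b) ^ 2 = E * (1 / (p : ℝ) ^ 6) := by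
      rw [hE]; field_simp
    have e5 : M * 6 ^ (s1.card + 1) * 2 ^ s2.card * Y / (↑p * a * b) ^ 2 = E * (6 / (p : ℝ) ^ 2) := by
      rw [hE]; field_simp; ring
    rw [e1, e2, e3, e4, e5]
    have hfin : 2 / (p : ℝ) ^ 2 + 1 / (p : ℝ) ^ 4 + 3 * (1 / (p : ℝ) ^ 2) + (p + 1) * (1 / (p : ℝ) ^ 6) ≤ 6 / (p : ℝ) ^ 2 := by
      rw [← sub_nonneg]
      have : 6 / (p : ℝ) ^ 2 - (2 / (p : ℝ) ^ 2 + 1 / (p : ℝ) ^ 4 + 3 * (1 / (p : ℝ) ^ 2) + (p + 1) * (1 / (p : ℝ) ^ 6))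
          = ((p : ℝ) ^ 4 - (p : ℝ) ^ 2 - p - 1) / (p : ℝ) ^ 6 := by
        field_simp; ring
      rw [this]
      apply div_nonneg _ (by positivity)
      nlinarith [mul_pos hppos hppos, sq_nonneg ((p : ℝ) ^ 2 - 1)]
    calc _ = E * (2 / (p : ℝ) ^ 2 + 1 / (p : ℝ) ^ 4 + 3 * (1 / (p : ℝ) ^ 2) + (p + 1) * (1 / (p : ℝ) ^ 6)) := by ring
      _ ≤ _ := mul_le_mul_of_nonneg_left hfin hE0.le

end CubicCount

namespace CubicCount

lemma twisted_iff (x y : V) :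
    (∃ γ : M2, IsUnit γ.det ∧ y = γ.det • cubicAct γ x) ↔ GEqv x y := by
  constructor
  · rintro ⟨γ, hγ, rfl⟩
    rcases Int.isUnit_iff.1 hγ with h | h
    · exact ⟨γ, hγ, by rw [h, one_smul]⟩
    · refine ⟨-γ, ?_, ?_⟩
      · rw [Matrix.det_neg]; simpa using hγ
      · rw [h, act_neg, neg_smul, one_smul]
  · rintro ⟨γ, hγ, rfl⟩
    rcases Int.isUnit_iff.1 hγ with h | h
    · exact ⟨γ, hγ, by rw [h, one_smul]⟩
    · refine ⟨-γ, ?_, ?_⟩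
      · rw [Matrix.det_neg]; simpa using hγ
      · rw [Matrix.det_neg, act_neg, h]; simp

lemma class_eq {x y : V} (h : GEqv x y) : {z | GEqv x z} = {z | GEqv y z} := by
  ext z
  exact ⟨fun hz => h.symm.trans hz, fun hz => h.trans hz⟩

lemma prod_small (r : ℕ) (hr : Squarefree r) :
    r ≤ 6 * ∏ p ∈ r.primeFactors.filter (fun p => 5 ≤ p), p := by
  classical
  have h1 := Nat.prod_primeFactors_of_squarefree hr
  have h2 := Finset.prod_filter_mul_prod_filter_not r.primeFactors (fun p => 5 ≤ p) (fun p => p)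
  have h3 : ∏ p ∈ r.primeFactors.filter (fun p => ¬ 5 ≤ p), p ≤ ∏ p ∈ ({2, 3} : Finset ℕ), p := by
    apply Finset.prod_le_prod_of_subset_of_one_le'
    · intro p hp
      rw [Finset.mem_filter] at hp
      have hpp := Nat.prime_of_mem_primeFactors hp.1
      have h4 : p < 5 := not_le.1 hp.2
      interval_cases p <;> simp_all (config := { decide := true })
    · intro p hp _
      simp at hp; omega
  simp at h3
  calc r = (∏ p ∈ r.primeFactors.filter (fun p => 5 ≤ p), p) * ∏ p ∈ r.primeFactors.filter (fun p => ¬ 5 ≤ p), p := by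
        rw [h2, h1]
    _ ≤ (∏ p ∈ r.primeFactors.filter (fun p => 5 ≤ p), p) * 6 := by
        gcongr
        simpa using h3
    _ = _ := mul_comm _ _

theorem final (hbase : ∃ C : ℝ, 0 < C ∧ ∀ Y : ℝ, 0 < Y →
      SCov (fun x => cubicDisc x ≠ 0 ∧ ((|cubicDisc x| : ℤ) : ℝ) < Y) (C * Y)) :
    ∃ M : ℝ, 0 < M ∧ ∀ r : ℕ, Squarefree r → ∀ Y : ℝ, 1 < Y →
      (classSet r Y).Finite ∧
      ((classSet r Y).ncard : ℝ) < M * 6 ^ r.primeFactors.card * Y / (r : ℝ) ^ 2 := by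
  classical
  obtain ⟨M, hM0, hM⟩ := partB hbase
  refine ⟨36 * M + 1, by positivity, fun r hr Y hY => ?_⟩
  have hr0 : 0 < r := Nat.pos_of_ne_zero hr.ne_zero
  have hrR : (0 : ℝ) < r := by exact_mod_cast hr0
  set s := r.primeFactors.filter (fun p => 5 ≤ p) with hs
  have hmem : ∀ p ∈ s, p ∈ r.primeFactors ∧ 5 ≤ p := fun p hp => Finset.mem_filter.1 hp
  obtain ⟨R, hR1, hR2⟩ := main_cov M hM0 hM s (fun p hp => ⟨Nat.prime_of_mem_primeFactors (hmem p hp).1, (hmem p hp).2⟩)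
    ∅ (by simp) (by simp) Y (by linarith)
  have hsub : classSet r Y ⊆ ((R.image (fun x => {z | GEqv x z}) : Finset (Set V)) : Set (Set V)) := by
    rintro O ⟨x, hD, hDY, hrD, rfl⟩
    obtain ⟨y, hy, e⟩ := hR2 x ⟨hD, hDY, fun p hp => by
      refine dvd_trans (pow_dvd_pow_of_dvd ?_ 2) hrD
      exact_mod_cast Nat.dvd_of_mem_primeFactors (hmem p hp).1, by simp⟩
    rw [Finset.coe_image]
    refine ⟨y, hy, ?_⟩
    simp only
    rw [class_eq e]
    ext z
    exact (twisted_iff x z).symm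
  have hfin : (classSet r Y).Finite := (Finset.finite_toSet _).subset hsub
  refine ⟨hfin, ?_⟩
  have hcard : ((classSet r Y).ncard : ℝ) ≤ R.card := by
    have h1 := Set.ncard_le_ncard hsub (Finset.finite_toSet _)
    rw [Set.ncard_coe_finset] at h1
    exact_mod_cast h1.trans Finset.card_image_le
  have hP := prod_small r hr
  have hP' : (r : ℝ) ≤ 6 * ((∏ p ∈ s, p : ℕ) : ℝ) := by exact_mod_cast hP
  have hPpos : (0 : ℝ) < ((∏ p ∈ s, p : ℕ) : ℝ) := by
    by_contra h
    linarith
  set P := ((∏ p ∈ s, p : ℕ) : ℝ)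
  have h6 : (6 : ℝ) ^ s.card ≤ 6 ^ r.primeFactors.card :=
    pow_le_pow_right₀ (by norm_num) (Finset.card_le_card (Finset.filter_subset _ _))
  have hsq : (r : ℝ) ^ 2 ≤ 36 * P ^ 2 := by nlinarith
  calc ((classSet r Y).ncard : ℝ) ≤ _ := hcard.trans hR1
    _ = M * 6 ^ s.card * Y / P ^ 2 := by simp
    _ ≤ M * 6 ^ r.primeFactors.card * Y / P ^ 2 := by gcongr
    _ ≤ 36 * M * 6 ^ r.primeFactors.card * Y / (r : ℝ) ^ 2 := by
        rw [div_le_div_iff₀ (by positivity) (by positivity)]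
        have : 0 ≤ M * 6 ^ r.primeFactors.card * Y := by positivity
        nlinarith
    _ < _ := by
        rw [div_lt_div_iff_of_pos_right (by positivity)]
        gcongr
        linarith

end CubicCount

namespace CubicCount

lemma short_vec (p q r δ : ℝ) (hp : 0 < p) (hδ : 0 < δ) (h : p * r - q ^ 2 = δ ^ 2) :
    ∃ u v : ℤ, IsCoprime u v ∧ p * (u : ℝ) ^ 2 + 2 * q * u * v + r * (v : ℝ) ^ 2 ≤ 2 * δ := by
  by_cases hpd : p ≤ 2 * δ
  · exact ⟨1, 0, isCoprime_one_left, by simpa using hpd⟩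
  push Not at hpd
  set t := Real.sqrt (p / δ) with ht
  have ht2 : t ^ 2 = p / δ := Real.sq_sqrt (by positivity)
  have ht2' : t ^ 2 * δ = p := by rw [ht2]; field_simp
  have ht0 : 0 ≤ t := Real.sqrt_nonneg _
  have ht1 : 1 ≤ t := by
    by_contra hc
    push Not at hc
    have : t ^ 2 < 1 := by nlinarith
    nlinarith
  set N := ⌊t⌋₊ with hN
  have hN1 : 0 < N := Nat.floor_pos.2 ht1
  have hNt : (N : ℝ) ≤ t := Nat.floor_le ht0
  have htN : t < N + 1 := Nat.lt_floor_add_one t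
  obtain ⟨j, k, hk0, hkN, hjk⟩ := Real.exists_int_int_abs_mul_sub_le (q / p) hN1
  have hk0' : (0 : ℝ) < k := by exact_mod_cast hk0
  have hkN' : (k : ℝ) ≤ t := le_trans (by exact_mod_cast hkN) hNt
  have hform : ∀ u v : ℝ, p * u ^ 2 + 2 * q * u * v + r * v ^ 2
      = p * (u + q / p * v) ^ 2 + δ ^ 2 / p * v ^ 2 := by
    intro u v
    rw [← h]; field_simp; ring
  have hnn : ∀ u v : ℝ, 0 ≤ p * u ^ 2 + 2 * q * u * v + r * v ^ 2 := by
    intro u v; rw [hform]; positivity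
  have hw : |(k : ℝ) * (q / p) - j| ≤ 1 / t := by
    refine hjk.trans ?_
    exact one_div_le_one_div_of_le (by linarith) htN.le
  have hw2 : ((k : ℝ) * (q / p) - j) ^ 2 ≤ (1 / t) ^ 2 := by
    rw [← sq_abs]; exact pow_le_pow_left₀ (abs_nonneg _) hw 2
  have htp : 0 < t := by linarith
  have b1 : p * (((-j : ℤ) : ℝ) + q / p * k) ^ 2 ≤ δ := by
    calc p * (((-j : ℤ) : ℝ) + q / p * k) ^ 2 = p * ((k : ℝ) * (q / p) - j) ^ 2 := by push_cast; ring
      _ ≤ p * (1 / t) ^ 2 := by gcongr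
      _ = δ := by rw [div_pow, ← ht2']; field_simp
  have b2 : δ ^ 2 / p * (k : ℝ) ^ 2 ≤ δ := by
    calc δ ^ 2 / p * (k : ℝ) ^ 2 ≤ δ ^ 2 / p * t ^ 2 := by gcongr
      _ = δ := by rw [ht2]; field_simp
  have hP : p * ((-j : ℤ) : ℝ) ^ 2 + 2 * q * ((-j : ℤ) : ℝ) * k + r * (k : ℝ) ^ 2 ≤ 2 * δ := by
    rw [hform]; linarith
  have hg : Int.gcd (-j) k ≠ 0 := by
    intro h0; rw [Int.gcd_eq_zero_iff] at h0; omega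
  obtain ⟨u, v, huv, e1, e2⟩ : ∃ u v : ℤ, IsCoprime u v ∧ -j = u * (Int.gcd (-j) k) ∧ k = v * (Int.gcd (-j) k) := by
    refine ⟨(-j) / (Int.gcd (-j) k), k / (Int.gcd (-j) k), ?_, ?_, ?_⟩
    · rw [Int.isCoprime_iff_gcd_eq_one]
      exact Int.gcd_ediv_gcd_ediv_gcd (Nat.pos_of_ne_zero hg)
    · exact (Int.ediv_mul_cancel (Int.gcd_dvd_left ..)).symm
    · exact (Int.ediv_mul_cancel (Int.gcd_dvd_right ..)).symm
  refine ⟨u, v, huv, le_trans ?_ hP⟩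
  set g := Int.gcd (-j) k
  have hg1 : (1 : ℝ) ≤ (g : ℝ) := by exact_mod_cast Nat.pos_of_ne_zero hg
  have e1' : ((-j : ℤ) : ℝ) = u * g := by rw [e1]; push_cast; rfl
  have e2' : (k : ℝ) = v * g := by rw [e2]; push_cast; rfl
  rw [e1', e2']
  have := hnn u v
  have hg2 : (1 : ℝ) ≤ (g : ℝ) ^ 2 := one_le_pow₀ hg1
  nlinarith

lemma real_cbrt (α : ℝ) : ∃ l : ℝ, l ^ 3 = α := by
  rcases le_total 0 α with h | h
  · exact ⟨α ^ ((1 : ℝ) / 3), by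
      rw [← Real.rpow_natCast, ← Real.rpow_mul h]; norm_num⟩
  · refine ⟨-((-α) ^ ((1 : ℝ) / 3)), ?_⟩
    have : ((-α) ^ ((1 : ℝ) / 3)) ^ 3 = -α := by
      rw [← Real.rpow_natCast, ← Real.rpow_mul (by linarith)]; norm_num
    linear_combination -this

lemma syz (a b c d u v : ℝ) :
    4 * ((b ^ 2 - 3 * a * c) * u ^ 2 + (b * c - 9 * a * d) * u * v + (c ^ 2 - 3 * b * d) * v ^ 2) ^ 3
    = ((2 * b ^ 3 + 27 * a ^ 2 * d - 9 * a * b * c) * u ^ 3 + 3 * (b ^ 2 * c - 6 * a * c ^ 2 + 9 * a * b * d) * u ^ 2 * v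
      + 3 * (-(b * c ^ 2) + 6 * b ^ 2 * d - 9 * a * c * d) * u * v ^ 2 + (-(2 * c ^ 3) - 27 * a * d ^ 2 + 9 * b * c * d) * v ^ 3) ^ 2
     + 27 * (b ^ 2 * c ^ 2 + 18 * a * b * c * d - 4 * a * c ^ 3 - 4 * b ^ 3 * d - 27 * a ^ 2 * d ^ 2)
       * (a * u ^ 3 + b * u ^ 2 * v + c * u * v ^ 2 + d * v ^ 3) ^ 2 := by
  ring

lemma red_pos_fin (D f H s : ℝ) (hpos : 0 < D) (hs0 : 0 < s) (hH0 : 0 ≤ H) (hHs : H ≤ s)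
    (h5 : 27 * D * f ^ 2 ≤ 4 * H ^ 3) (hs2 : s ^ 2 = 3 * D) : f ^ 4 ≤ 10 * D ∧ H ^ 2 ≤ 3 * D := by
  have h6 : H ^ 3 ≤ s ^ 3 := pow_le_pow_left₀ hH0 hHs 3
  have e3 : s ^ 3 = 3 * D * s := by rw [← hs2]; ring
  have h8 : f ^ 2 ≤ 12 / 27 * s := by
    have : D * f ^ 2 ≤ D * (12 / 27 * s) := by linarith
    exact le_of_mul_le_mul_left this hpos
  constructor
  · calc f ^ 4 = (f ^ 2) ^ 2 := by ring
      _ ≤ (12 / 27 * s) ^ 2 := pow_le_pow_left₀ (sq_nonneg _) h8 2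
      _ = (12 / 27) ^ 2 * (3 * D) := by rw [mul_pow, hs2]
      _ ≤ 10 * D := by linarith
  · rw [← hs2]; exact pow_le_pow_left₀ hH0 hHs 2

lemma red_neg_fin (x y δ ε : ℝ) (hP : x ^ 2 + y ^ 2 ≤ 2 * δ) (hδ2 : δ ^ 2 = ε ^ 2) :
    (x ^ 3 + y ^ 3) ^ 4 ≤ 10 * (27 * ε ^ 6) ∧ (-9 * ε ^ 2 * (x * y)) ^ 2 ≤ 3 * (27 * ε ^ 6) := by
  have h2 : 0 ≤ x ^ 2 + y ^ 2 := by positivity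
  constructor
  · have k1 : (x ^ 3 + y ^ 3) ^ 2 ≤ (x ^ 2 + y ^ 2) ^ 3 := by
      have : 0 ≤ x ^ 2 * y ^ 2 * (2 * x ^ 2 + 2 * y ^ 2 + (x - y) ^ 2) := by positivity
      linarith
    have k2 : (x ^ 2 + y ^ 2) ^ 3 ≤ (2 * δ) ^ 3 := pow_le_pow_left₀ h2 hP 3
    calc (x ^ 3 + y ^ 3) ^ 4 = ((x ^ 3 + y ^ 3) ^ 2) ^ 2 := by ring
      _ ≤ ((2 * δ) ^ 3) ^ 2 := pow_le_pow_left₀ (sq_nonneg _) (k1.trans k2) 2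
      _ = 64 * (δ ^ 2) ^ 3 := by ring
      _ = 64 * (ε ^ 2) ^ 3 := by rw [hδ2]
      _ ≤ 10 * (27 * ε ^ 6) := by
        have : 0 ≤ ε ^ 6 := by positivity
        linarith
  · have k1 : (x * y) ^ 2 ≤ ε ^ 2 := by
      have e1 : x * y ≤ δ := by nlinarith [sq_nonneg (x - y)]
      have e2 : -δ ≤ x * y := by nlinarith [sq_nonneg (x + y)]
      rw [← hδ2]; exact sq_le_sq' e2 e1
    calc (-9 * ε ^ 2 * (x * y)) ^ 2 = 81 * ε ^ 4 * (x * y) ^ 2 := by ring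
      _ ≤ 81 * ε ^ 4 * ε ^ 2 := by gcongr
      _ = _ := by ring

lemma red_pos (a b c d D : ℝ) (hD : D = b ^ 2 * c ^ 2 + 18 * a * b * c * d - 4 * a * c ^ 3 - 4 * b ^ 3 * d - 27 * a ^ 2 * d ^ 2)
    (hpos : 0 < D) (hA0 : b ^ 2 - 3 * a * c ≠ 0) :
    ∃ u v : ℤ, IsCoprime u v ∧ (a * u ^ 3 + b * u ^ 2 * v + c * u * v ^ 2 + d * v ^ 3) ^ 4 ≤ 10 * D ∧
    ((b ^ 2 - 3 * a * c) * u ^ 2 + (b * c - 9 * a * d) * u * v + (c ^ 2 - 3 * b * d) * v ^ 2) ^ 2 ≤ 3 * D := by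
  set A := b ^ 2 - 3 * a * c with hA
  set B := b * c - 9 * a * d with hB
  set C := c ^ 2 - 3 * b * d with hC
  have hdisc : B ^ 2 - 4 * A * C = -3 * D := by rw [hA, hB, hC, hD]; ring
  have hApos : 0 < A := by
    rcases lt_or_gt_of_ne hA0 with h | h
    · exfalso
      have := syz a b c d 1 0
      rw [← hD, ← hA] at this
      norm_num at this
      have h3 : A ^ 3 < 0 := by
        have : 0 < A ^ 2 := by positivity
        nlinarith
      have : 0 ≤ D * a ^ 2 := by positivity
      nlinarith [sq_nonneg (2 * b ^ 3 + 27 * a ^ 2 * d - 9 * a * b * c)]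
    · exact h
  set s := Real.sqrt (3 * D) with hs
  have hs2 : s ^ 2 = 3 * D := Real.sq_sqrt (by positivity)
  have hs0 : 0 < s := Real.sqrt_pos.2 (by positivity)
  obtain ⟨u, v, huv, hP⟩ := short_vec A (B / 2) C (s / 2) hApos (by positivity) (by
    rw [div_pow, div_pow, hs2]; linarith)
  set f := a * (u : ℝ) ^ 3 + b * u ^ 2 * v + c * u * v ^ 2 + d * v ^ 3 with hf
  set H := A * (u : ℝ) ^ 2 + B * u * v + C * v ^ 2 with hH
  have hHs : H ≤ s := by rw [hH]; linarith
  have hH0 : 0 ≤ H := by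
    have : 4 * A * H = (2 * A * u + B * v) ^ 2 + 3 * D * v ^ 2 := by
      rw [hH]; linear_combination (-(v : ℝ) ^ 2) * hdisc
    by_contra hc
    push Not at hc
    nlinarith [sq_nonneg (2 * A * u + B * v), sq_nonneg (v : ℝ)]
  obtain ⟨G, h4⟩ : ∃ G : ℝ, 4 * H ^ 3 = G ^ 2 + 27 * D * f ^ 2 :=
    ⟨_, (by rw [hH, hf, hD, hA, hB, hC]; exact syz a b c d u v)⟩
  have h5 : 27 * D * f ^ 2 ≤ 4 * H ^ 3 := by rw [h4]; nlinarith [sq_nonneg G]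
  obtain ⟨k1, k2⟩ := red_pos_fin D f H s hpos hs0 hH0 hHs h5 hs2
  exact ⟨u, v, huv, k1, k2⟩

lemma red_neg (a b c d D : ℝ) (hD : D = b ^ 2 * c ^ 2 + 18 * a * b * c * d - 4 * a * c ^ 3 - 4 * b ^ 3 * d - 27 * a ^ 2 * d ^ 2)
    (hneg : D < 0) (hA0 : b ^ 2 - 3 * a * c ≠ 0) :
    ∃ u v : ℤ, IsCoprime u v ∧ (a * u ^ 3 + b * u ^ 2 * v + c * u * v ^ 2 + d * v ^ 3) ^ 4 ≤ 10 * (-D) ∧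
    ((b ^ 2 - 3 * a * c) * u ^ 2 + (b * c - 9 * a * d) * u * v + (c ^ 2 - 3 * b * d) * v ^ 2) ^ 2 ≤ 3 * (-D) := by
  set A := b ^ 2 - 3 * a * c with hA
  set B := b * c - 9 * a * d with hB
  set C := c ^ 2 - 3 * b * d with hC
  have hdisc : B ^ 2 - 4 * A * C = -3 * D := by rw [hA, hB, hC, hD]; ring
  set s := Real.sqrt (-3 * D) with hs
  have hs2 : s ^ 2 = -3 * D := Real.sq_sqrt (by nlinarith)
  have hs0 : 0 < s := Real.sqrt_pos.2 (by nlinarith)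
  obtain ⟨θ, hθ⟩ : ∃ θ, θ = (B + s) / (2 * A) := ⟨_, rfl⟩
  obtain ⟨φ, hφ⟩ : ∃ φ, φ = (B - s) / (2 * A) := ⟨_, rfl⟩
  have hsum : A * (θ + φ) = B := by rw [hθ, hφ]; field_simp; ring
  have hdiff : A * (θ - φ) = s := by rw [hθ, hφ]; field_simp; ring
  have hprod : A * (θ * φ) = C := by
    have h1 : 4 * A * (A * (θ * φ)) = 4 * A * C := by
      have : 4 * A * (A * (θ * φ)) = (A * (θ + φ)) ^ 2 - (A * (θ - φ)) ^ 2 := by ring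
      rw [this, hsum, hdiff, hs2]; linarith
    exact mul_left_cancel₀ (by simpa using hA0) h1
  have hne : θ - φ ≠ 0 := by
    intro h0; rw [h0] at hdiff; simp at hdiff; linarith
  obtain ⟨α, hα⟩ : ∃ α, α = (b / 3 - a * φ) / (θ - φ) := ⟨_, rfl⟩
  obtain ⟨β, hβ⟩ : ∃ β, β = (a * θ - b / 3) / (θ - φ) := ⟨_, rfl⟩
  have ea : α + β = a := by rw [hα, hβ]; field_simp; ring
  have eb : 3 * (α * θ + β * φ) = b := by rw [hα, hβ]; field_simp; ring
  have r2 : c = b * (θ + φ) - 3 * a * (θ * φ) := by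
    apply mul_left_cancel₀ hA0
    have : A * (b * (θ + φ) - 3 * a * (θ * φ)) = b * (A * (θ + φ)) - 3 * a * (A * (θ * φ)) := by ring
    rw [this, hsum, hprod, hA, hB, hC]; ring
  have r3 : 3 * d = c * (θ + φ) - b * (θ * φ) := by
    apply mul_left_cancel₀ hA0
    have : A * (c * (θ + φ) - b * (θ * φ)) = c * (A * (θ + φ)) - b * (A * (θ * φ)) := by ring
    rw [this, hsum, hprod, hA, hB, hC]; ring
  have ec : 3 * (α * θ ^ 2 + β * φ ^ 2) = c := by rw [r2, ← ea, ← eb]; ring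
  have ed : α * θ ^ 3 + β * φ ^ 3 = d := by
    have : 3 * (α * θ ^ 3 + β * φ ^ 3) = 3 * d := by rw [r3, ← ec, ← eb]; ring
    linarith
  have hAab : A = -9 * (α * β * (θ - φ) ^ 2) := by
    rw [hA, ← ea, ← eb, ← ec]; ring
  obtain ⟨l, hl⟩ := real_cbrt α
  obtain ⟨m, hm⟩ := real_cbrt β
  set ε := l * m * (θ - φ) with hε
  have hε3 : ε ^ 3 = α * β * (θ - φ) ^ 3 := by rw [hε, ← hl, ← hm]; ring
  have hD6 : -D = 27 * ε ^ 6 := by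
    have h1 : s = -9 * ε ^ 3 := by
      rw [← hdiff, hε3]
      calc A * (θ - φ) = -9 * (α * β * (θ - φ) ^ 2) * (θ - φ) := by rw [← hAab]
        _ = _ := by ring
    rw [h1] at hs2
    linear_combination (-1 / 3 : ℝ) * hs2
  have hε0 : ε ≠ 0 := by
    intro h0; rw [h0] at hD6; norm_num at hD6; linarith
  have hl0 : l ≠ 0 := by
    intro h0; apply hε0; rw [hε, h0]; ring
  set δ := |ε| with hδ
  have hδ0 : 0 < δ := abs_pos.2 hε0
  have hδ2 : δ ^ 2 = ε ^ 2 := sq_abs ε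
  obtain ⟨u, v, huv, hP⟩ := short_vec (l ^ 2 + m ^ 2) (l ^ 2 * θ + m ^ 2 * φ) (l ^ 2 * θ ^ 2 + m ^ 2 * φ ^ 2) δ
    (by positivity) hδ0 (by rw [hδ2, hε]; ring)
  obtain ⟨x, hx⟩ : ∃ x, x = l * (u + θ * v) := ⟨_, rfl⟩
  obtain ⟨y, hy⟩ : ∃ y, y = m * (u + φ * v) := ⟨_, rfl⟩
  have hP' : x ^ 2 + y ^ 2 ≤ 2 * δ := by
    rw [hx, hy]; linarith
  have hf : a * (u : ℝ) ^ 3 + b * u ^ 2 * v + c * u * v ^ 2 + d * v ^ 3 = x ^ 3 + y ^ 3 := by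
    rw [hx, hy, mul_pow, mul_pow, hl, hm, ← ea, ← eb, ← ec, ← ed]; ring
  have hH : A * (u : ℝ) ^ 2 + B * u * v + C * v ^ 2 = -9 * ε ^ 2 * (x * y) := by
    calc A * (u : ℝ) ^ 2 + B * u * v + C * v ^ 2 = A * ((u + θ * v) * (u + φ * v)) := by
          rw [← hsum, ← hprod]; ring
      _ = -9 * (α * β * (θ - φ) ^ 2) * ((u + θ * v) * (u + φ * v)) := by rw [← hAab]
      _ = _ := by rw [hx, hy, hε, ← hl, ← hm]; ring
  obtain ⟨k1, k2⟩ := red_neg_fin x y δ ε hP' hδ2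
  exact ⟨u, v, huv, by rw [hf, hD6]; exact k1, by rw [hH, hD6]; exact k2⟩

end CubicCount

namespace CubicCount

lemma red_int (x : V) (hD : cubicDisc x ≠ 0) (hx : hA x ≠ 0) :
    ∃ u v : ℤ, IsCoprime u v ∧ (ev x u v) ^ 4 ≤ 10 * |cubicDisc x| ∧
      (hA x * u ^ 2 + hB x * u * v + hC x * v ^ 2) ^ 2 ≤ 3 * |cubicDisc x| := by
  have hA0 : ((x 1 : ℝ)) ^ 2 - 3 * (x 0 : ℝ) * (x 2 : ℝ) ≠ 0 := by
    intro h; apply hx; unfold hA; exact_mod_cast h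
  have hDR : ((cubicDisc x : ℤ) : ℝ) = (x 1 : ℝ) ^ 2 * (x 2 : ℝ) ^ 2 + 18 * (x 0 : ℝ) * (x 1) * (x 2) * (x 3) - 4 * (x 0 : ℝ) * (x 2) ^ 3
      - 4 * (x 1 : ℝ) ^ 3 * (x 3) - 27 * (x 0 : ℝ) ^ 2 * (x 3) ^ 2 := by
    unfold cubicDisc; push_cast; ring
  rcases lt_or_gt_of_ne hD with h | h
  · obtain ⟨u, v, huv, h1, h2⟩ := red_neg _ _ _ _ _ hDR (by exact_mod_cast h) hA0
    refine ⟨u, v, huv, ?_, ?_⟩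
    · rw [abs_of_neg h]; unfold ev; exact_mod_cast h1
    · rw [abs_of_neg h]; unfold hA hB hC; exact_mod_cast h2
  · obtain ⟨u, v, huv, h1, h2⟩ := red_pos _ _ _ _ _ hDR (by exact_mod_cast h) hA0
    refine ⟨u, v, huv, ?_, ?_⟩
    · rw [abs_of_pos h]; unfold ev; exact_mod_cast h1
    · rw [abs_of_pos h]; unfold hA hB hC; exact_mod_cast h2

lemma near_mult (a b : ℤ) (ha : a ≠ 0) : ∃ n : ℤ, 2 * |a * n + b| ≤ |a| := by
  have hb : 0 < |a| := abs_pos.2 ha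
  have key : ∃ n : ℤ, 2 * |(|a|) * n + b| ≤ |a| := by
    have h1 := Int.emod_add_mul_ediv b |a|
    have h2 := Int.emod_nonneg b hb.ne'
    have h3 := Int.emod_lt_of_pos b hb
    by_cases h : 2 * (b % |a|) ≤ |a|
    · refine ⟨-(b / |a|), ?_⟩
      have : |a| * -(b / |a|) + b = b % |a| := by linarith
      rw [this, abs_of_nonneg h2]; exact h
    · refine ⟨-(b / |a|) - 1, ?_⟩
      have : |a| * (-(b / |a|) - 1) + b = b % |a| - |a| := by linarith
      rw [this, abs_of_nonpos (by linarith)]; linarith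
  obtain ⟨n, hn⟩ := key
  rcases abs_choice a with h | h
  · exact ⟨n, by rw [h] at hn ⊢; exact hn⟩
  · refine ⟨-n, ?_⟩
    rw [h] at hn ⊢
    have : a * -n + b = -a * n + b := by ring
    rw [this]; exact hn

lemma trans_act (y : V) (n : ℤ) : ∃ z, SEqv y z ∧ z 0 = y 0 ∧ z 1 = 3 * y 0 * n + y 1 ∧
    z 2 = 3 * y 0 * n ^ 2 + 2 * y 1 * n + y 2 ∧ hA z = hA y := by
  refine ⟨cubicAct !![1, 0; n, 1] y, ⟨_, by simp [Matrix.det_fin_two_of], rfl⟩, ?_, ?_, ?_, ?_⟩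
  · simp [act0]
  · simp [act1]
  · simp [act2]; ring
  · simp [hA_act, Matrix.det_fin_two_of]

/-- every form of nonzero discriminant is equivalent to a reduced one -/
lemma reduce (x : V) (hD : cubicDisc x ≠ 0) : ∃ y, SEqv x y ∧ (y 0) ^ 4 ≤ 10 * |cubicDisc x| ∧
    (hA y) ^ 2 ≤ 3 * |cubicDisc x| ∧ (y 0 ≠ 0 → 2 * |y 1| ≤ 3 * |y 0|) ∧
    (y 0 = 0 → y 1 ≠ 0 ∧ |y 2| ≤ |y 1|) := by
  obtain ⟨x', hxx, hx'⟩ := exists_hA_ne x hD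
  have hd := hxx.disc
  rw [← hd] at hD ⊢
  obtain ⟨u, v, huv, h1, h2⟩ := red_int x' hD hx'
  obtain ⟨g, hg, rfl, rfl⟩ := exists_row u v huv
  obtain ⟨y, hy⟩ : ∃ y, y = cubicAct g x' := ⟨_, rfl⟩
  have hxy : SEqv x y := hxx.trans ⟨g, hg, hy⟩
  have e0 : y 0 = ev x' (g 0 0) (g 0 1) := by rw [hy]; rfl
  have eA : hA y = hA x' * g 0 0 ^ 2 + hB x' * g 0 0 * g 0 1 + hC x' * g 0 1 ^ 2 := by
    rw [hy, hA_act, hg]; ring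
  rw [← e0] at h1
  rw [← eA] at h2
  by_cases h0 : y 0 = 0
  · have hy1 : y 1 ≠ 0 := by
      intro h
      apply hD
      rw [← hd.symm, ← hxy.disc]
      unfold cubicDisc
      rw [h0, h]; ring
    obtain ⟨n, hn⟩ := near_mult (2 * y 1) (y 2) (by omega)
    obtain ⟨z, hz, z0, z1, z2, zA⟩ := trans_act y n
    refine ⟨z, hxy.trans hz, by rw [z0]; exact h1, by rw [zA]; exact h2, fun h => absurd (z0.trans h0) h, fun _ => ?_⟩
    rw [z1, z2, h0]
    simp only [mul_zero, zero_mul, zero_add]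
    refine ⟨hy1, ?_⟩
    rw [abs_mul] at hn
    norm_num at hn
    linarith
  · obtain ⟨n, hn⟩ := near_mult (3 * y 0) (y 1) (by omega)
    obtain ⟨z, hz, z0, z1, z2, zA⟩ := trans_act y n
    refine ⟨z, hxy.trans hz, by rw [z0]; exact h1, by rw [zA]; exact h2, fun _ => ?_, fun h => absurd (z0.symm.trans h) h0⟩
    rw [z1, z0]
    rw [abs_mul] at hn
    norm_num at hn
    exact hn

end CubicCount

namespace CubicCount

lemma sqrt_len1 (X W : ℝ) (hW : 0 ≤ W) : Real.sqrt (X + W) - Real.sqrt (X - W) ≤ Real.sqrt (2 * W) := by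
  rw [sub_le_iff_le_add]
  apply Real.sqrt_le_iff.2
  have h1 := Real.sqrt_nonneg (X - W)
  have h2 := Real.sqrt_nonneg (2 * W)
  refine ⟨by positivity, ?_⟩
  have h3 : Real.sqrt (2 * W) ^ 2 = 2 * W := Real.sq_sqrt (by positivity)
  rcases le_total 0 (X - W) with h | h
  · have h4 : Real.sqrt (X - W) ^ 2 = X - W := Real.sq_sqrt h
    nlinarith
  · nlinarith

lemma sqrt_len2 (X W : ℝ) (hW : 0 ≤ W) : (Real.sqrt (X + W) - Real.sqrt (X - W)) * Real.sqrt |X| ≤ 2 * W := by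
  have h0 := Real.sqrt_nonneg (X + W)
  have h5 := Real.sqrt_nonneg |X|
  have h6 : Real.sqrt |X| ^ 2 = |X| := Real.sq_sqrt (abs_nonneg _)
  rcases le_total 0 (X - W) with h | h
  · have hX : 0 ≤ X := by linarith
    have h1 := Real.sqrt_nonneg (X - W)
    have h3 : Real.sqrt (X + W) ^ 2 = X + W := Real.sq_sqrt (by linarith)
    have h4 : Real.sqrt (X - W) ^ 2 = X - W := Real.sq_sqrt h
    have h7 : Real.sqrt |X| ≤ Real.sqrt (X + W) := Real.sqrt_le_sqrt (by rw [abs_of_nonneg hX]; linarith)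
    have h8 : Real.sqrt (X - W) ≤ Real.sqrt (X + W) := Real.sqrt_le_sqrt (by linarith)
    nlinarith
  · rw [Real.sqrt_eq_zero_of_nonpos h, sub_zero]
    rcases le_total 0 (X + W) with h' | h'
    · have h3 : Real.sqrt (X + W) ^ 2 = X + W := Real.sq_sqrt h'
      have h4 : |X| ≤ W := abs_le.2 ⟨by linarith, by linarith⟩
      nlinarith [sq_nonneg (Real.sqrt (X + W) - Real.sqrt |X|)]
    · rw [Real.sqrt_eq_zero_of_nonpos h']; linarith

lemma card_Icc_real (x y : ℝ) (h : x ≤ y) : ((Finset.Icc ⌈x⌉ ⌊y⌋).card : ℝ) ≤ y - x + 1 := by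
  rw [Int.card_Icc]
  have h1 := Int.floor_le y
  have h2 := Int.le_ceil x
  have h3 : ((((⌊y⌋ + 1 - ⌈x⌉).toNat : ℕ) : ℤ) : ℝ) = ((max (⌊y⌋ + 1 - ⌈x⌉) 0 : ℤ) : ℝ) := by
    rw [Int.toNat_eq_max]
  rw [Int.cast_natCast] at h3
  rw [h3]
  push_cast
  apply max_le <;> linarith

lemma d_count_pos (κ k lo hi : ℝ) (hκ : 0 < κ) (h : lo ≤ hi) :
    ∃ T : Finset ℤ, (T.card : ℝ) ≤ 2 * ((hi - lo) / κ + 1) ∧ ∀ d : ℤ, lo ≤ |κ * d + k| → |κ * d + k| ≤ hi → d ∈ T := by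
  classical
  refine ⟨Finset.Icc ⌈(lo - k) / κ⌉ ⌊(hi - k) / κ⌋ ∪ Finset.Icc ⌈(-hi - k) / κ⌉ ⌊(-lo - k) / κ⌋, ?_, ?_⟩
  · have h1 := card_Icc_real ((lo - k) / κ) ((hi - k) / κ) (by gcongr)
    have h2 := card_Icc_real ((-hi - k) / κ) ((-lo - k) / κ) (by gcongr)
    have h3 : (((Finset.Icc ⌈(lo - k) / κ⌉ ⌊(hi - k) / κ⌋ ∪ Finset.Icc ⌈(-hi - k) / κ⌉ ⌊(-lo - k) / κ⌋).card : ℕ) : ℝ)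
      ≤ (Finset.Icc ⌈(lo - k) / κ⌉ ⌊(hi - k) / κ⌋).card + (Finset.Icc ⌈(-hi - k) / κ⌉ ⌊(-lo - k) / κ⌋).card := by
      exact_mod_cast Finset.card_union_le _ _
    have e1 : (hi - k) / κ - (lo - k) / κ = (hi - lo) / κ := by ring
    have e2 : (-lo - k) / κ - (-hi - k) / κ = (hi - lo) / κ := by ring
    linarith
  · intro d h1 h2
    rw [Finset.mem_union, Finset.mem_Icc, Finset.mem_Icc, Int.ceil_le, Int.le_floor, Int.ceil_le, Int.le_floor,
      div_le_iff₀ hκ, div_le_iff₀ hκ, le_div_iff₀ hκ, le_div_iff₀ hκ]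
    rcases abs_cases (κ * d + k) with ⟨e, _⟩ | ⟨e, _⟩
    · left; rw [e] at h1 h2; constructor <;> linarith
    · right; rw [e] at h1 h2; constructor <;> linarith

lemma d_count (κ k lo hi : ℝ) (hκ : κ ≠ 0) (h : lo ≤ hi) :
    ∃ T : Finset ℤ, (T.card : ℝ) ≤ 2 * ((hi - lo) / |κ| + 1) ∧ ∀ d : ℤ, lo ≤ |κ * d + k| → |κ * d + k| ≤ hi → d ∈ T := by
  rcases lt_or_gt_of_ne hκ with h' | h'
  · obtain ⟨T, h1, h2⟩ := d_count_pos (-κ) (-k) lo hi (by linarith) h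
    refine ⟨T, by rw [abs_of_neg h']; exact h1, fun d => ?_⟩
    have := h2 d
    rw [show -κ * (d : ℝ) + -k = -(κ * d + k) by ring, abs_neg] at this
    exact this
  · rw [abs_of_pos h']; exact d_count_pos κ k lo hi h' h

lemma sum_inv_sq (n : ℕ) : ∑ k ∈ Finset.Icc 1 n, (1 : ℝ) / (k : ℝ) ^ 2 ≤ 2 := by
  have key : ∀ n : ℕ, ∑ k ∈ Finset.Icc 1 (n + 1), (1 : ℝ) / (k : ℝ) ^ 2 ≤ 2 - 1 / ((n : ℝ) + 1) := by
    intro n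
    induction n with
    | zero => simp; norm_num
    | succ m ih =>
      rw [Finset.sum_Icc_succ_top (by omega)]
      push_cast
      have : 1 / ((m : ℝ) + 1 + 1) ^ 2 ≤ 1 / ((m : ℝ) + 1) - 1 / ((m : ℝ) + 1 + 1) := by
        rw [div_sub_div _ _ (by positivity) (by positivity), div_le_div_iff₀ (by positivity) (by positivity)]
        have : (0 : ℝ) ≤ m := by positivity
        nlinarith
      push_cast at ih
      linarith
  rcases n with _ | n
  · simp
  · refine (key n).trans ?_
    have : 0 ≤ 1 / ((n : ℝ) + 1) := by positivity
    linarith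

lemma sum_inv_sqrt (n : ℕ) : ∑ k ∈ Finset.Icc 1 n, (1 : ℝ) / Real.sqrt k ≤ 2 * Real.sqrt n := by
  induction n with
  | zero => simp
  | succ m ih =>
    rw [Finset.sum_Icc_succ_top (by omega)]
    set s := Real.sqrt (m : ℝ) with hs
    set t := Real.sqrt ((m + 1 : ℕ) : ℝ) with ht
    have hs2 : s ^ 2 = m := Real.sq_sqrt (by positivity)
    have ht2 : t ^ 2 = m + 1 := by rw [ht, Real.sq_sqrt (by positivity)]; push_cast; ring
    have ht0 : 0 < t := Real.sqrt_pos.2 (by positivity)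
    have hs0 : 0 ≤ s := Real.sqrt_nonneg _
    have : 1 / t ≤ 2 * (t - s) := by
      rw [div_le_iff₀ ht0]
      nlinarith [sq_nonneg (t - s)]
    linarith

lemma sum_tail (m N : ℕ) (hm : 0 < m) : ∑ l ∈ Finset.Ioc m N, (1 : ℝ) / (l * Real.sqrt l) ≤ 2 / Real.sqrt m := by
  have key : ∀ j : ℕ, ∑ l ∈ Finset.Ioc m (m + j), (1 : ℝ) / (l * Real.sqrt l) ≤ 2 / Real.sqrt m - 2 / Real.sqrt ((m + j : ℕ) : ℝ) := by
    intro j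
    induction j with
    | zero => simp
    | succ j ih =>
      rw [← add_assoc, Finset.sum_Ioc_succ_top (by omega)]
      obtain ⟨p, hp⟩ : ∃ p, p = m + j := ⟨_, rfl⟩
      rw [← hp] at ih ⊢
      have hp0 : 0 < p := by omega
      set s := Real.sqrt (p : ℝ) with hs
      set t := Real.sqrt ((p + 1 : ℕ) : ℝ) with ht
      have hs2 : s ^ 2 = p := Real.sq_sqrt (by positivity)
      have ht2 : t ^ 2 = ((p + 1 : ℕ) : ℝ) := by rw [ht, Real.sq_sqrt (by positivity)]
      have hts : t ^ 2 = s ^ 2 + 1 := by rw [ht2, hs2]; push_cast; ring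
      have ht0 : 0 < t := Real.sqrt_pos.2 (by positivity)
      have hs0 : 0 < s := Real.sqrt_pos.2 (by exact_mod_cast hp0)
      have hst : s ≤ t := by nlinarith
      have : 1 / (((p + 1 : ℕ) : ℝ) * t) ≤ 2 / s - 2 / t := by
        rw [← ht2, div_sub_div _ _ hs0.ne' ht0.ne', div_le_div_iff₀ (by positivity) (by positivity)]
        have e : 1 = (t - s) * (t + s) := by linarith [hts]
        have h1 : s * t * ((t - s) * (t + s)) ≤ t ^ 2 * (2 * t) * (t - s) := by
          have h2 : s * t * (t + s) ≤ t ^ 2 * (2 * t) := by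
            have : s * t ≤ t ^ 2 := by nlinarith
            have : t + s ≤ 2 * t := by linarith
            gcongr
          have h3 : 0 ≤ t - s := by linarith
          nlinarith
        rw [← e] at h1
        nlinarith
      linarith
  rcases le_total N m with h | h
  · rw [Finset.Ioc_eq_empty (by omega)]; simp; positivity
  · obtain ⟨j, rfl⟩ := Nat.exists_eq_add_of_le h
    refine (key j).trans ?_
    have : 0 ≤ 2 / Real.sqrt ((m + j : ℕ) : ℝ) := by positivity
    linarith

end CubicCount

namespace CubicCount

def FC (P : V → Prop) (N : ℝ) : Prop :=
  ∃ R : Finset V, (R.card : ℝ) ≤ N ∧ ∀ x, P x → x ∈ R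

lemma FC.mono {P Q : V → Prop} {N N' : ℝ} (h : FC P N) (hQ : ∀ x, Q x → P x) (hN : N ≤ N') : FC Q N' := by
  obtain ⟨R, h1, h2⟩ := h
  exact ⟨R, h1.trans hN, fun x hx => h2 x (hQ x hx)⟩

lemma FC.bind {ι : Type} (S : Finset ι) (P : ι → V → Prop) (f : ι → ℝ) (h : ∀ i ∈ S, FC (P i) (f i)) :
    FC (fun x => ∃ i ∈ S, P i x) (∑ i ∈ S, f i) := by
  classical
  choose! R h1 h2 using h
  refine ⟨S.biUnion R, ?_, ?_⟩
  · calc ((S.biUnion R).card : ℝ) ≤ ((∑ i ∈ S, (R i).card : ℕ) : ℝ) := by exact_mod_cast Finset.card_biUnion_le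
      _ = ∑ i ∈ S, ((R i).card : ℝ) := by push_cast; rfl
      _ ≤ _ := Finset.sum_le_sum h1
  · rintro x ⟨i, hi, hx⟩
    exact Finset.mem_biUnion.2 ⟨i, hi, h2 i hi x hx⟩

lemma FC.or {P Q : V → Prop} {N N' : ℝ} (h : FC P N) (h' : FC Q N') : FC (fun x => P x ∨ Q x) (N + N') := by
  classical
  obtain ⟨R, h1, h2⟩ := h
  obtain ⟨R', h1', h2'⟩ := h'
  refine ⟨R ∪ R', ?_, ?_⟩
  · have : ((R ∪ R').card : ℝ) ≤ R.card + R'.card := by exact_mod_cast Finset.card_union_le R R'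
    linarith
  · rintro x (hx | hx)
    · exact Finset.mem_union_left _ (h2 x hx)
    · exact Finset.mem_union_right _ (h2' x hx)

lemma leaf (a b c : ℤ) (κ k lo hi : ℝ) (hκ : κ ≠ 0) (h : lo ≤ hi) :
    FC (fun x => x 0 = a ∧ x 1 = b ∧ x 2 = c ∧ lo ≤ |κ * (x 3 : ℝ) + k| ∧ |κ * (x 3 : ℝ) + k| ≤ hi)
      (2 * ((hi - lo) / |κ| + 1)) := by
  classical
  obtain ⟨T, h1, h2⟩ := d_count κ k lo hi hκ h
  refine ⟨T.image (fun d => ![a, b, c, d]), ?_, ?_⟩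
  · exact le_trans (by exact_mod_cast Finset.card_image_le) h1
  · rintro x ⟨rfl, rfl, rfl, h3, h4⟩
    refine Finset.mem_image.2 ⟨x 3, h2 _ h3 h4, ?_⟩
    apply V_ext <;> rfl

/-- leaf with leading coefficient zero -/
lemma leaf0 (b c : ℤ) (Y : ℝ) (hY : 0 < Y) (hb : b ≠ 0) :
    FC (fun x => x 0 = 0 ∧ x 1 = b ∧ x 2 = c ∧ ((|cubicDisc x| : ℤ) : ℝ) < Y)
      (2 * (Y / (4 * |(b : ℝ)| ^ 3) + 1)) := by
  have hb' : (b : ℝ) ≠ 0 := by exact_mod_cast hb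
  have hb2 : 0 < (b : ℝ) ^ 2 := by positivity
  have hba : 0 < |(b : ℝ)| := abs_pos.2 hb'
  refine (leaf 0 b c (-4 * b) ((c : ℝ) ^ 2) 0 (Y / (b : ℝ) ^ 2) (by simpa using hb') (by positivity)).mono ?_ ?_
  · rintro x ⟨h0, h1, h2, h3⟩
    refine ⟨h0, h1, h2, abs_nonneg _, ?_⟩
    rw [le_div_iff₀ hb2]
    have : ((|cubicDisc x| : ℤ) : ℝ) = |(-4 * (b : ℝ) * (x 3 : ℝ) + (c : ℝ) ^ 2)| * (b : ℝ) ^ 2 := by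
      rw [← abs_of_pos hb2, ← abs_mul, Int.cast_abs]
      congr 1
      unfold cubicDisc
      rw [h0, h1, h2]; push_cast; ring
    linarith
  · apply le_of_eq
    rw [sub_zero, abs_mul, ← sq_abs (b : ℝ)]
    norm_num
    field_simp
    exact sq_abs _

/-- leaf with nonzero leading coefficient -/
lemma leaf1 (a b c : ℤ) (Y : ℝ) (hY : 0 < Y) (ha : a ≠ 0) :
    FC (fun x => x 0 = a ∧ x 1 = b ∧ x 2 = c ∧ ((|cubicDisc x| : ℤ) : ℝ) < Y)
      (2 * ((Real.sqrt (4 * ((b : ℝ) ^ 2 - 3 * a * c) ^ 3 + 27 * Y * (a : ℝ) ^ 2)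
        - Real.sqrt (4 * ((b : ℝ) ^ 2 - 3 * a * c) ^ 3 - 27 * Y * (a : ℝ) ^ 2)) / (27 * (a : ℝ) ^ 2) + 1)) := by
  have ha' : (a : ℝ) ≠ 0 := by exact_mod_cast ha
  have ha2 : 0 < (a : ℝ) ^ 2 := by positivity
  have hW : 0 < 27 * Y * (a : ℝ) ^ 2 := by positivity
  refine (leaf a b c (27 * (a : ℝ) ^ 2) (2 * (b : ℝ) ^ 3 - 9 * a * b * c) _ _ (by positivity)
    (Real.sqrt_le_sqrt (by linarith : 4 * ((b : ℝ) ^ 2 - 3 * a * c) ^ 3 - 27 * Y * (a : ℝ) ^ 2 ≤ 4 * ((b : ℝ) ^ 2 - 3 * a * c) ^ 3 + 27 * Y * (a : ℝ) ^ 2))).mono ?_ ?_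
  · rintro x ⟨h0, h1, h2, h3⟩
    refine ⟨h0, h1, h2, ?_⟩
    have hD : (27 * (a : ℝ) ^ 2 * (x 3 : ℝ) + (2 * (b : ℝ) ^ 3 - 9 * a * b * c)) ^ 2 =
       4 * ((b : ℝ) ^ 2 - 3 * a * c) ^ 3 - 27 * ((cubicDisc x : ℤ) : ℝ) * (a : ℝ) ^ 2 := by
      unfold cubicDisc
      rw [h0, h1, h2]; push_cast; ring
    rw [Int.cast_abs, abs_lt] at h3
    rw [← Real.sqrt_sq_eq_abs, hD]
    constructor <;> apply Real.sqrt_le_sqrt <;> nlinarith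
  · rw [abs_of_pos (by positivity)]

lemma leaf1_bound1 (a b c : ℤ) (Y μ : ℝ) (k : ℕ) (hk : 0 < k) (hak : |a| = k) (hμ : 1 ≤ μ) (hY : Y = μ ^ 4) :
    FC (fun x => x 0 = a ∧ x 1 = b ∧ x 2 = c ∧ ((|cubicDisc x| : ℤ) : ℝ) < Y) (2 + μ ^ 2 / k) := by
  have hk' : (0 : ℝ) < k := by exact_mod_cast hk
  have ha : a ≠ 0 := by intro h; rw [h] at hak; simp at hak; omega
  have ha2 : (a : ℝ) ^ 2 = (k : ℝ) ^ 2 := by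
    rw [← sq_abs]; have : |(a : ℝ)| = k := by exact_mod_cast hak
    rw [this]
  refine (leaf1 a b c Y (by rw [hY]; positivity) ha).mono (fun _ h => h) ?_
  have h1 := sqrt_len1 (4 * ((b : ℝ) ^ 2 - 3 * a * c) ^ 3) (27 * Y * (a : ℝ) ^ 2) (by rw [hY]; positivity)
  have h2 : Real.sqrt (2 * (27 * Y * (a : ℝ) ^ 2)) ≤ 8 * μ ^ 2 * k := by
    apply Real.sqrt_le_iff.2
    refine ⟨by positivity, ?_⟩
    rw [ha2, hY]
    have : 0 ≤ μ ^ 4 * (k : ℝ) ^ 2 := by positivity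
    nlinarith
  have h3 := h1.trans h2
  rw [ha2] at h3 ⊢
  have h4 : (Real.sqrt (4 * ((b : ℝ) ^ 2 - 3 * a * c) ^ 3 + 27 * Y * (k : ℝ) ^ 2)
        - Real.sqrt (4 * ((b : ℝ) ^ 2 - 3 * a * c) ^ 3 - 27 * Y * (k : ℝ) ^ 2)) / (27 * (k : ℝ) ^ 2) ≤ (8 * μ ^ 2 * k) / (27 * (k : ℝ) ^ 2) := by
    gcongr
  have h5 : (8 * μ ^ 2 * k) / (27 * (k : ℝ) ^ 2) = 8 / 27 * (μ ^ 2 / k) := by field_simp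
  have h6 : 0 ≤ μ ^ 2 / k := by positivity
  linarith

lemma leaf1_bound2 (a b c : ℤ) (Y μ : ℝ) (k l : ℕ) (hk : 0 < k) (hl : 3 * k ≤ l) (hak : |a| = k) (hcl : |c| = l)
    (hb : 2 * |b| ≤ 3 * |a|) (hμ : 1 ≤ μ) (hY : Y = μ ^ 4) :
    FC (fun x => x 0 = a ∧ x 1 = b ∧ x 2 = c ∧ ((|cubicDisc x| : ℤ) : ℝ) < Y)
      (2 + 2 * μ ^ 4 / (k * Real.sqrt k) * (1 / (l * Real.sqrt l))) := by
  have hk' : (0 : ℝ) < k := by exact_mod_cast hk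
  have hl0 : (0 : ℝ) < l := by exact_mod_cast (by omega : 0 < l)
  have hl' : 3 * (k : ℝ) ≤ l := by exact_mod_cast hl
  have ha : a ≠ 0 := by intro h; rw [h] at hak; simp at hak; omega
  have hakR : |(a : ℝ)| = k := by exact_mod_cast hak
  have hclR : |(c : ℝ)| = l := by exact_mod_cast hcl
  have hbR : 2 * |(b : ℝ)| ≤ 3 * k := by rw [← hakR]; exact_mod_cast hb
  have ha2 : (a : ℝ) ^ 2 = (k : ℝ) ^ 2 := by rw [← sq_abs, hakR]
  have hb2 : 4 * (b : ℝ) ^ 2 ≤ 9 * (k : ℝ) ^ 2 := by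
    rw [← sq_abs (b : ℝ)]; nlinarith [abs_nonneg (b : ℝ)]
  have hYp : 0 < Y := by rw [hY]; positivity
  refine (leaf1 a b c Y hYp ha).mono (fun _ h => h) ?_
  have h1 := sqrt_len2 (4 * ((b : ℝ) ^ 2 - 3 * a * c) ^ 3) (27 * Y * (a : ℝ) ^ 2) (by positivity)
  have hAl : (k : ℝ) * l ≤ |(b : ℝ) ^ 2 - 3 * a * c| := by
    have e1 : |3 * (a : ℝ) * c| = 3 * k * l := by rw [abs_mul, abs_mul, hakR, hclR]; norm_num
    have e2 := abs_sub_abs_le_abs_sub (3 * (a : ℝ) * c) ((b : ℝ) ^ 2)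
    rw [abs_sub_comm (3 * (a : ℝ) * c), e1, abs_of_nonneg (sq_nonneg (b : ℝ))] at e2
    nlinarith
  set s := (k : ℝ) * Real.sqrt k * (l * Real.sqrt l) with hs
  have hs0 : 0 < s := by positivity
  have hs2 : s ^ 2 = ((k : ℝ) * l) ^ 3 := by
    rw [hs]
    have e1 : Real.sqrt k ^ 2 = (k : ℝ) := Real.sq_sqrt hk'.le
    have e2 : Real.sqrt l ^ 2 = (l : ℝ) := Real.sq_sqrt hl0.le
    calc ((k : ℝ) * Real.sqrt k * (l * Real.sqrt l)) ^ 2 = (k : ℝ) ^ 2 * l ^ 2 * (Real.sqrt k ^ 2) * (Real.sqrt l ^ 2) := by ring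
      _ = _ := by rw [e1, e2]; ring
  have h2 : 2 * s ≤ Real.sqrt |4 * ((b : ℝ) ^ 2 - 3 * a * c) ^ 3| := by
    apply Real.le_sqrt_of_sq_le
    rw [mul_pow, hs2, abs_mul, abs_pow]
    norm_num
    gcongr
  rw [ha2] at h1 ⊢
  set len := Real.sqrt (4 * ((b : ℝ) ^ 2 - 3 * a * c) ^ 3 + 27 * Y * (k : ℝ) ^ 2)
        - Real.sqrt (4 * ((b : ℝ) ^ 2 - 3 * a * c) ^ 3 - 27 * Y * (k : ℝ) ^ 2) with hlen
  have hlen0 : 0 ≤ len := by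
    rw [hlen, sub_nonneg]
    apply Real.sqrt_le_sqrt
    have : 0 ≤ 27 * Y * (k : ℝ) ^ 2 := by positivity
    linarith
  have h3 : len * (2 * s) ≤ 2 * (27 * Y * (k : ℝ) ^ 2) := le_trans (by gcongr) h1
  have h4 : len ≤ 27 * Y * (k : ℝ) ^ 2 / s := by rw [le_div_iff₀ hs0]; linarith
  have h5 : len / (27 * (k : ℝ) ^ 2) ≤ (27 * Y * (k : ℝ) ^ 2 / s) / (27 * (k : ℝ) ^ 2) := by gcongr
  have h6 : (27 * Y * (k : ℝ) ^ 2 / s) / (27 * (k : ℝ) ^ 2) = Y / s := by field_simp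
  have h7 : 2 * μ ^ 4 / (k * Real.sqrt k) * (1 / (l * Real.sqrt l)) = 2 * (Y / s) := by
    rw [hY, hs]; field_simp
  rw [h7]; linarith

end CubicCount

namespace CubicCount

def sg : Finset ℤ := {1, -1}

lemma sg_abs {σ : ℤ} (h : σ ∈ sg) : |σ| = 1 := by
  simp [sg] at h
  rcases h with rfl | rfl <;> simp

lemma sg_exists (a : ℤ) : ∃ σ ∈ sg, a = σ * (a.natAbs : ℤ) := by
  rcases le_total 0 a with h | h
  · exact ⟨1, by simp [sg], by omega⟩
  · exact ⟨-1, by simp [sg], by omega⟩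

lemma sg_abs_mul {σ : ℤ} (h : σ ∈ sg) (k : ℕ) : |σ * (k : ℤ)| = k := by
  rw [abs_mul, sg_abs h, one_mul, Nat.abs_cast]

lemma sg_card : sg.card = 2 := by decide

lemma caseA (Y μ : ℝ) (n : ℕ) (hμ : 1 ≤ μ) (hY : Y = μ ^ 4) (hn : (n : ℝ) ≤ 2 * μ) :
    FC (fun x => x 0 = 0 ∧ x 1 ≠ 0 ∧ |x 2| ≤ |x 1| ∧ (x 1).natAbs ≤ n ∧ ((|cubicDisc x| : ℤ) : ℝ) < Y) (54 * Y) := by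
  have hYp : 0 < Y := by rw [hY]; positivity
  refine (FC.bind sg (fun σ x => ∃ k ∈ Finset.Icc 1 n, ∃ c ∈ Finset.Icc (-(k : ℤ)) k,
      (x 0 = 0 ∧ x 1 = σ * (k : ℤ) ∧ x 2 = c ∧ ((|cubicDisc x| : ℤ) : ℝ) < Y))
      (fun _ => ∑ k ∈ Finset.Icc 1 n, ∑ _c ∈ Finset.Icc (-(k : ℤ)) k, (2 * (Y / (4 * (k : ℝ) ^ 3) + 1))) ?_).mono ?_ ?_
  · intro σ hσ
    apply FC.bind (Finset.Icc 1 n)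
    intro k hk
    rw [Finset.mem_Icc] at hk
    apply FC.bind (Finset.Icc (-(k : ℤ)) k)
    intro c _
    have hk0 : σ * (k : ℤ) ≠ 0 := by
      rw [← abs_pos, sg_abs_mul hσ]; exact_mod_cast hk.1
    have := leaf0 (σ * (k : ℤ)) c Y hYp hk0
    have e : |((σ * (k : ℤ) : ℤ) : ℝ)| = k := by
      have := sg_abs_mul hσ k
      exact_mod_cast this
    rw [e] at this
    exact this
  · rintro x ⟨h0, h1, h2, h3, h4⟩
    obtain ⟨σ, hσ, e⟩ := sg_exists (x 1)
    refine ⟨σ, hσ, (x 1).natAbs, Finset.mem_Icc.2 ⟨by omega, h3⟩, x 2, ?_, h0, e, rfl, h4⟩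
    rw [Finset.mem_Icc, Int.natCast_natAbs]
    exact abs_le.1 h2
  · rw [Finset.sum_const, sg_card]
    have hb : ∑ k ∈ Finset.Icc 1 n, ∑ _c ∈ Finset.Icc (-(k : ℤ)) k, (2 * (Y / (4 * (k : ℝ) ^ 3) + 1))
        ≤ ∑ k ∈ Finset.Icc 1 n, (3 / 2 * Y * (1 / (k : ℝ) ^ 2) + 6 * (2 * μ)) := by
      apply Finset.sum_le_sum
      intro k hk
      rw [Finset.mem_Icc] at hk
      have hk1 : (1 : ℝ) ≤ k := by exact_mod_cast hk.1
      have hkn : (k : ℝ) ≤ 2 * μ := le_trans (by exact_mod_cast hk.2) hn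
      rw [Finset.sum_const, Int.card_Icc, nsmul_eq_mul]
      have e : (((k : ℤ) + 1 - -(k : ℤ)).toNat : ℝ) = 2 * k + 1 := by
        have : ((k : ℤ) + 1 - -(k : ℤ)).toNat = 2 * k + 1 := by omega
        rw [this]; push_cast; ring
      rw [e]
      calc (2 * (k : ℝ) + 1) * (2 * (Y / (4 * (k : ℝ) ^ 3) + 1)) ≤ (3 * k) * (2 * (Y / (4 * (k : ℝ) ^ 3) + 1)) := by
            gcongr; linarith
        _ = 3 / 2 * Y * (1 / (k : ℝ) ^ 2) + 6 * k := by field_simp; ring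
        _ ≤ _ := by gcongr
    rw [Finset.sum_add_distrib, ← Finset.mul_sum, Finset.sum_const, Nat.card_Icc, nsmul_eq_mul] at hb
    have h1 := sum_inv_sq n
    have h2 : 3 / 2 * Y * ∑ k ∈ Finset.Icc 1 n, (1 : ℝ) / (k : ℝ) ^ 2 ≤ 3 / 2 * Y * 2 := by gcongr
    have h3 : ((n + 1 - 1 : ℕ) : ℝ) * (6 * (2 * μ)) ≤ 24 * Y := by
      rw [Nat.add_sub_cancel, hY]
      have : μ ^ 2 ≤ μ ^ 4 := pow_le_pow_right₀ hμ (by norm_num)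
      nlinarith
    rw [nsmul_eq_mul]
    push_cast
    linarith

lemma caseB_inner (Y μ : ℝ) (n k : ℕ) (a b τ : ℤ) (hμ : 1 ≤ μ) (hY : Y = μ ^ 4) (hk : 0 < k) (hkn : k ≤ n)
    (hak : |a| = k) (hτ : τ ∈ sg) :
    FC (fun x => ∃ l : ℕ, l ≤ ⌊4 * μ ^ 2 / k⌋₊ ∧ 2 * |b| ≤ 3 * |a| ∧ x 0 = a ∧ x 1 = b ∧ x 2 = τ * (l : ℤ) ∧ ((|cubicDisc x| : ℤ) : ℝ) < Y)
      ((3 * n + 1) * (2 + μ ^ 2 / k) + 8 * μ ^ 2 / k + 2 * μ ^ 4 / (k * Real.sqrt k) * (2 / Real.sqrt n)) := by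
  have hn : 0 < n := by omega
  have hk' : (0 : ℝ) < k := by exact_mod_cast hk
  have hn' : (0 : ℝ) < n := by exact_mod_cast hn
  have f1 := FC.bind (Finset.range (3 * n + 1)) (fun l x => x 0 = a ∧ x 1 = b ∧ x 2 = τ * (l : ℤ) ∧ ((|cubicDisc x| : ℤ) : ℝ) < Y)
    (fun _ => 2 + μ ^ 2 / k) (fun l _ => leaf1_bound1 a b (τ * (l : ℤ)) Y μ k hk hak hμ hY)
  by_cases hb : 2 * |b| ≤ 3 * |a|
  swap
  · exact ⟨∅, by simp; positivity, fun x ⟨l, _, h, _⟩ => absurd h hb⟩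
  have f2 := FC.bind (Finset.Ioc (3 * n) ⌊4 * μ ^ 2 / k⌋₊) (fun l x => x 0 = a ∧ x 1 = b ∧ x 2 = τ * (l : ℤ) ∧ ((|cubicDisc x| : ℤ) : ℝ) < Y)
    (fun l => 2 + 2 * μ ^ 4 / (k * Real.sqrt k) * (1 / (l * Real.sqrt l)))
    (fun l hl => leaf1_bound2 a b (τ * (l : ℤ)) Y μ k l hk (by rw [Finset.mem_Ioc] at hl; omega) hak (sg_abs_mul hτ l) hb hμ hY)
  refine (f1.or f2).mono ?_ ?_
  · rintro x ⟨l, hl, -, h⟩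
    by_cases h3 : l ≤ 3 * n
    · left; exact ⟨l, Finset.mem_range.2 (by omega), h⟩
    · right; exact ⟨l, Finset.mem_Ioc.2 ⟨by omega, hl⟩, h⟩
  · rw [Finset.sum_const, Finset.card_range, nsmul_eq_mul, Finset.sum_add_distrib, ← Finset.mul_sum, Finset.sum_const, Nat.card_Ioc, nsmul_eq_mul]
    have h1 := sum_tail (3 * n) ⌊4 * μ ^ 2 / k⌋₊ (by omega)
    have h2 : 2 / Real.sqrt ((3 * n : ℕ) : ℝ) ≤ 2 / Real.sqrt n := by
      have : 0 < Real.sqrt n := Real.sqrt_pos.2 hn'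
      gcongr
      omega
    have h3 : 2 * μ ^ 4 / (k * Real.sqrt k) * ∑ l ∈ Finset.Ioc (3 * n) ⌊4 * μ ^ 2 / k⌋₊, (1 : ℝ) / (l * Real.sqrt l) ≤ 2 * μ ^ 4 / (k * Real.sqrt k) * (2 / Real.sqrt n) := by
      have := h1.trans h2
      gcongr
    have h4 : ((⌊4 * μ ^ 2 / k⌋₊ - 3 * n : ℕ) : ℝ) ≤ 4 * μ ^ 2 / k :=
      le_trans (by exact_mod_cast Nat.sub_le _ _) (Nat.floor_le (by positivity))
    have h5 : 8 * μ ^ 2 / k = 4 * μ ^ 2 / k * 2 := by ring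
    push_cast
    linarith

lemma caseB (Y μ : ℝ) (n : ℕ) (hμ : 1 ≤ μ) (hY : Y = μ ^ 4) (hn : (n : ℝ) ≤ 2 * μ) :
    FC (fun x => x 0 ≠ 0 ∧ (x 0).natAbs ≤ n ∧ 2 * |x 1| ≤ 3 * |x 0| ∧
      ((x 0).natAbs : ℝ) * ((x 2).natAbs : ℝ) ≤ 4 * μ ^ 2 ∧ ((|cubicDisc x| : ℤ) : ℝ) < Y) (1880 * Y) := by
  have hYp : 0 < Y := by rw [hY]; positivity
  refine (FC.bind sg (fun σ x => ∃ k ∈ Finset.Icc 1 n, ∃ b ∈ Finset.Icc (-(2 * k : ℤ)) (2 * k), ∃ τ ∈ sg,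
      ∃ l : ℕ, l ≤ ⌊4 * μ ^ 2 / k⌋₊ ∧ 2 * |b| ≤ 3 * |σ * (k : ℤ)| ∧ x 0 = σ * (k : ℤ) ∧ x 1 = b ∧ x 2 = τ * (l : ℤ) ∧ ((|cubicDisc x| : ℤ) : ℝ) < Y)
      (fun _ => ∑ k ∈ Finset.Icc 1 n, ∑ _b ∈ Finset.Icc (-(2 * k : ℤ)) (2 * k), ∑ _τ ∈ sg,
        ((3 * n + 1) * (2 + μ ^ 2 / k) + 8 * μ ^ 2 / k + 2 * μ ^ 4 / (k * Real.sqrt k) * (2 / Real.sqrt n))) ?_).mono ?_ ?_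
  · intro σ hσ
    apply FC.bind (Finset.Icc 1 n)
    intro k hk
    rw [Finset.mem_Icc] at hk
    apply FC.bind (Finset.Icc (-(2 * k : ℤ)) (2 * k))
    intro b _
    apply FC.bind sg
    intro τ hτ
    exact caseB_inner Y μ n k _ b τ hμ hY hk.1 hk.2 (sg_abs_mul hσ k) hτ
  · rintro x ⟨h0, h1, h2, h3, h4⟩
    obtain ⟨σ, hσ, e⟩ := sg_exists (x 0)
    obtain ⟨τ, hτ, e'⟩ := sg_exists (x 2)
    refine ⟨σ, hσ, (x 0).natAbs, Finset.mem_Icc.2 ⟨by omega, h1⟩, x 1, ?_, τ, hτ, (x 2).natAbs, ?_, ?_, e, rfl, e', h4⟩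
    · rw [Finset.mem_Icc, Int.natCast_natAbs]
      apply abs_le.1
      have := abs_nonneg (x 0)
      linarith
    · apply Nat.le_floor
      rw [le_div_iff₀ (by exact_mod_cast (by omega : 0 < (x 0).natAbs))]
      linarith
    · rw [← e]; exact h2
  · rw [Finset.sum_const, sg_card]
    have hb : ∑ k ∈ Finset.Icc 1 n, ∑ _b ∈ Finset.Icc (-(2 * k : ℤ)) (2 * k), ∑ _τ ∈ sg,
        ((3 * n + 1) * (2 + μ ^ 2 / k) + 8 * μ ^ 2 / k + 2 * μ ^ 4 / (k * Real.sqrt k) * (2 / Real.sqrt n))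
        ≤ ∑ k ∈ Finset.Icc 1 n, (430 * μ ^ 3 + 40 * μ ^ 4 / Real.sqrt n * (1 / Real.sqrt k)) := by
      apply Finset.sum_le_sum
      intro k hk
      rw [Finset.mem_Icc] at hk
      have hk1 : (1 : ℝ) ≤ k := by exact_mod_cast hk.1
      have hk0 : (0 : ℝ) < k := by linarith
      have hsk : 0 < Real.sqrt k := Real.sqrt_pos.2 hk0
      have hkn : (k : ℝ) ≤ 2 * μ := le_trans (by exact_mod_cast hk.2) hn
      have hn0 : (0 : ℝ) < n := by exact_mod_cast (by omega : 0 < n)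
      have hsn : 0 < Real.sqrt n := Real.sqrt_pos.2 hn0
      rw [Finset.sum_const, Int.card_Icc, Finset.sum_const, sg_card, nsmul_eq_mul, nsmul_eq_mul]
      have e : (((2 * k : ℤ) + 1 - -(2 * k : ℤ)).toNat : ℝ) = 4 * k + 1 := by
        have : ((2 * k : ℤ) + 1 - -(2 * k : ℤ)).toNat = 4 * k + 1 := by omega
        rw [this]; push_cast; ring
      rw [e]
      have h23 : μ ^ 2 ≤ μ ^ 3 := pow_le_pow_right₀ hμ (by norm_num)
      calc (4 * (k : ℝ) + 1) * (((2 : ℕ) : ℝ) * ((3 * n + 1) * (2 + μ ^ 2 / k) + 8 * μ ^ 2 / k + 2 * μ ^ 4 / (k * Real.sqrt k) * (2 / Real.sqrt n)))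
          ≤ (5 * k) * (((2 : ℕ) : ℝ) * ((3 * n + 1) * (2 + μ ^ 2 / k) + 8 * μ ^ 2 / k + 2 * μ ^ 4 / (k * Real.sqrt k) * (2 / Real.sqrt n))) := by
            gcongr; linarith
        _ = 10 * ((3 * n + 1) * (2 * k + μ ^ 2) + 8 * μ ^ 2) + 40 * μ ^ 4 / Real.sqrt n * (1 / Real.sqrt k) := by
            push_cast; field_simp; ring
        _ ≤ 10 * ((3 * (2 * μ) + μ) * (2 * (2 * μ) + μ ^ 2) + 8 * μ ^ 2) + 40 * μ ^ 4 / Real.sqrt n * (1 / Real.sqrt k) := by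
            gcongr
        _ ≤ _ := by
            nlinarith
    rw [Finset.sum_add_distrib, Finset.sum_const, Nat.card_Icc, nsmul_eq_mul, Nat.add_sub_cancel, ← Finset.mul_sum (Finset.Icc 1 n) (fun k : ℕ => (1 : ℝ) / Real.sqrt k)] at hb
    have h1 := sum_inv_sqrt n
    have h2 : 40 * μ ^ 4 / Real.sqrt n * ∑ k ∈ Finset.Icc 1 n, (1 : ℝ) / Real.sqrt k ≤ 80 * μ ^ 4 := by
      rcases Nat.eq_zero_or_pos n with h | h
      · subst h; simp; positivity
      · have hsn : 0 < Real.sqrt n := Real.sqrt_pos.2 (by exact_mod_cast h)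
        calc _ ≤ 40 * μ ^ 4 / Real.sqrt n * (2 * Real.sqrt n) := by gcongr
          _ = _ := by field_simp; ring
    have h3 : (n : ℝ) * (430 * μ ^ 3) ≤ 860 * μ ^ 4 := by
      calc (n : ℝ) * (430 * μ ^ 3) ≤ (2 * μ) * (430 * μ ^ 3) := by gcongr
        _ = _ := by ring
    rw [nsmul_eq_mul, hY]
    push_cast
    linarith

lemma base : ∃ C : ℝ, 0 < C ∧ ∀ Y : ℝ, 0 < Y →
    SCov (fun x => cubicDisc x ≠ 0 ∧ ((|cubicDisc x| : ℤ) : ℝ) < Y) (C * Y) := by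
  refine ⟨1934, by norm_num, fun Y hY0 => ?_⟩
  by_cases hY1 : Y ≤ 1
  · refine ⟨∅, by simp; positivity, ?_⟩
    rintro x ⟨h1, h2⟩
    exfalso
    have h3 : (1 : ℤ) ≤ |cubicDisc x| := Int.one_le_abs h1
    have h4 : (1 : ℝ) ≤ ((|cubicDisc x| : ℤ) : ℝ) := by exact_mod_cast h3
    linarith
  push Not at hY1
  obtain ⟨μ, hμ, hY⟩ : ∃ μ : ℝ, 1 ≤ μ ∧ Y = μ ^ 4 := by
    refine ⟨Real.sqrt (Real.sqrt Y), ?_, ?_⟩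
    · rw [Real.one_le_sqrt, Real.one_le_sqrt]; exact hY1.le
    · rw [show (4 : ℕ) = 2 * 2 by norm_num, pow_mul, Real.sq_sqrt (Real.sqrt_nonneg _), Real.sq_sqrt hY0.le]
  have hn : ((⌊2 * μ⌋₊ : ℕ) : ℝ) ≤ 2 * μ := Nat.floor_le (by positivity)
  obtain ⟨R, hR, hmem⟩ := (caseA Y μ ⌊2 * μ⌋₊ hμ hY hn).or (caseB Y μ ⌊2 * μ⌋₊ hμ hY hn)
  refine ⟨R, by linarith, ?_⟩
  rintro x ⟨hx, hxY⟩
  obtain ⟨y, hxy, y0, yA, yn, yz⟩ := reduce x hx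
  refine ⟨y, hmem y ?_, hxy.symm⟩
  rw [← hxy.disc] at hxY y0 yA
  have y0R : (y 0 : ℝ) ^ 4 ≤ 10 * ((|cubicDisc y| : ℤ) : ℝ) := by exact_mod_cast y0
  have yAR : (hA y : ℝ) ^ 2 ≤ 3 * ((|cubicDisc y| : ℤ) : ℝ) := by exact_mod_cast yA
  have key : ∀ z : ℤ, (z : ℝ) ^ 4 ≤ 16 * Y → z.natAbs ≤ ⌊2 * μ⌋₊ := by
    intro z hz
    apply Nat.le_floor
    rw [Nat.cast_natAbs, Int.cast_abs]
    by_contra hc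
    push Not at hc
    have : (2 * μ) ^ 4 < |(z : ℝ)| ^ 4 := by gcongr
    rw [show |(z : ℝ)| ^ 4 = (z : ℝ) ^ 4 by rw [← abs_pow]; exact abs_of_nonneg (by positivity)] at this
    rw [hY] at hz
    nlinarith
  by_cases h0 : y 0 = 0
  · left
    obtain ⟨h1, h2⟩ := yz h0
    refine ⟨h0, h1, h2, key _ ?_, hxY⟩
    have : (hA y : ℝ) ^ 2 = (y 1 : ℝ) ^ 4 := by
      unfold hA; rw [h0]; push_cast; ring
    rw [this] at yAR
    linarith
  · right
    refine ⟨h0, key _ (by linarith), yn h0, ?_, hxY⟩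
    have hb : 2 * |(y 1 : ℝ)| ≤ 3 * |(y 0 : ℝ)| := by exact_mod_cast yn h0
    have hb2 : 4 * (y 1 : ℝ) ^ 2 ≤ 9 * (y 0 : ℝ) ^ 2 := by
      rw [← sq_abs (y 1 : ℝ), ← sq_abs (y 0 : ℝ)]; nlinarith [abs_nonneg (y 1 : ℝ)]
    have ha2 : (y 0 : ℝ) ^ 2 ≤ 3.2 * μ ^ 2 := by
      apply abs_le_of_sq_le_sq' _ (by positivity) |>.2
      nlinarith
    have hA2 : |(hA y : ℝ)| ≤ 2 * μ ^ 2 := by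
      apply abs_le_of_sq_le_sq _ (by positivity)
      nlinarith
    rw [Nat.cast_natAbs, Nat.cast_natAbs, Int.cast_abs, Int.cast_abs, ← abs_mul]
    have e : 3 * ((y 0 : ℝ) * (y 2 : ℝ)) = (y 1 : ℝ) ^ 2 - (hA y : ℝ) := by unfold hA; push_cast; ring
    rw [abs_le] at hA2 ⊢
    constructor <;> nlinarith [sq_nonneg (y 1 : ℝ)]

end CubicCount

/-- There is an absolute constant `M` such that for every squarefree `r ≥ 1` and every
`Y > 1`, the number of `GL₂(ℤ)`-classes of integral binary cubic forms with
`0 < |D(x)| < Y` and `r² ∣ D(x)` is less than `M · 6^{ω(r)} · Y / r²`. -/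
theorem count_classes_with_square_divisor :
    ∃ M : ℝ, 0 < M ∧ ∀ r : ℕ, Squarefree r → ∀ Y : ℝ, 1 < Y →
      (classSet r Y).Finite ∧
      ((classSet r Y).ncard : ℝ) < M * 6 ^ r.primeFactors.card * Y / (r : ℝ) ^ 2 := by
  exact CubicCount.final CubicCount.base
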